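/- Every KS set in dimension 4 has at least 18 elements: if S is a finite set of unit vectors in ℂ^4 that admits no KS assignment, then the cardinality of S is at least 18. -/

import Mathlib

open BigOperators Finset Matrix

/-- A KS assignment for a finite set `S` of vectors in `ℂ^4`: a 0/1 assignment such that
(I) no two orthogonal vectors of `S` are both assigned 1, and (II) among any 4 mutually
orthogonal vectors of `S` at least one is assigned 1. -/
def IsKSAssignment4 (S : Finset (Fin 4 → ℂ)) (f : (Fin 4 → ℂ) → ℕ) : Prop :=
  (∀ u ∈ S, f u = 0 ∨ f u = 1) ∧
  (∀ u ∈ S, ∀ w ∈ S, star u ⬝ᵥ w = 0 → ¬(f u = 1 ∧ f w = 1)) ∧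
  (∀ b : Fin 4 → (Fin 4 → ℂ), (∀ k, b k ∈ S) →
    (∀ k l, k ≠ l → star (b k) ⬝ᵥ b l = 0) → ∃ k, f (b k) = 1)

namespace KSCheck

/-- Strict application, so that kernel evaluation does not duplicate unevaluated arguments. -/
def force {α : Type} (x : ℕ) (k : ℕ → α) : α :=
  Nat.rec (motive := fun _ => α) (k 0) (fun m _ => k (Nat.succ m)) x

def bt {α : Type} (b : Bool) (t e : α) : α := Bool.rec (motive := fun _ => α) e t b

def loop {α : Type} (z : α) (s : α → α) (n : ℕ) : α :=
  Nat.rec (motive := fun _ => α) z (fun _ ih => s ih) n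

def dig (c b : ℕ) (k : ℕ → ℕ → ℕ) : ℕ :=
  force (Nat.mod c b) fun d => force (Nat.div c b) fun c => k d c

/-- Decode from `c` a symbol below `m`; the base 64 digits of `W` are the frequencies, which sum to 64. -/
def ans (m W c : ℕ) (k : ℕ → ℕ → ℕ) : ℕ :=
  dig c 64 fun v c => loop (fun _ _ _ => 0) (fun ih o W v => force (Nat.mod W 64) fun f =>
    bt (Nat.ble f v) (force (Nat.div W 64) fun W => force (Nat.sub v f) fun v =>
      force (Nat.succ o) fun o => ih o W v) <|
    force (Nat.add (Nat.mul c f) v) fun c => k o c) m 0 W v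

def tb (w i : ℕ) : Bool := Nat.beq (Nat.land (Nat.shiftRight w i) 1) 1

def sh (i : ℕ) : ℕ := Nat.shiftLeft 1 i

def row (w a : ℕ) : ℕ := Nat.land (Nat.shiftRight w (Nat.mul 16 a)) 65535

def idx (a b : ℕ) : ℕ := Nat.add (Nat.mul 16 a) b

def addE (w a b : ℕ) : ℕ := Nat.lor w (Nat.lor (sh (idx a b)) (sh (idx b a)))

def mask (e : ℕ) : ℕ := Nat.land e 4095

def sz (e : ℕ) : ℕ := Nat.shiftRight e 12

def diff (K R : ℕ) : ℕ := Nat.xor K (Nat.land K R)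

abbrev Kont := ℕ → ℕ → ℕ → ℕ → ℕ → ℕ → ℕ

def getT (nt T c : ℕ) (k : ℕ → ℕ → ℕ) : ℕ :=
  dig c nt fun i c => force (row T i) fun e => bt (Nat.beq e 0) 0 (k e c)

def goY (k : Kont) (n Y X nt T c a b : ℕ) : ℕ :=
  bt (Nat.beq a b) c <| bt (tb X (idx a b)) c <|
    force (addE Y a b) fun Y => k n Y X nt T c

def goN (k : Kont) (n Y X nt T c a b : ℕ) : ℕ :=
  force (addE X a b) fun X => k n Y X nt T c

def opO (k : Kont) : Kont := fun n Y X nt T c =>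
  getT nt T c fun e c => dig c n fun y c => force (mask e) fun K => bt (tb K y) 0 <|
  force (diff K (row Y y)) fun P => bt (Nat.beq P 0) c <|
  force (Nat.log2 P) fun x => force (Nat.xor P (sh x)) fun Q =>
  bt (Nat.beq Q 0) (bt (Nat.beq (sz e) 4) c (goN k n Y X nt T c y x)) <|
  force (Nat.log2 Q) fun z => bt (Nat.beq Q (sh z)) (bt (Nat.beq (sz e) 4)
    (force (addE X y x) fun X => goN k n Y X nt T c y z) 0) 0

def opM (k : Kont) : Kont := fun n Y X nt T c =>
  getT nt T c fun e c => getT nt T c fun f c => dig c n fun z c =>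
  force (Nat.xor (mask e) (mask f)) fun D => bt (tb D z) 0 <|
  force (diff D (row Y z)) fun P => bt (Nat.beq P 0) 0 <|
  force (Nat.log2 P) fun x => force (Nat.xor P (sh x)) fun Q =>
  bt (Nat.beq Q 0) (goY k n Y X nt T c z x) <|
  force (Nat.log2 Q) fun w => bt (Nat.beq Q (sh w))
    (bt (tb X (idx z x)) (goN k n Y X nt T c z w) <|
      bt (tb X (idx z w)) (goN k n Y X nt T c z x) 0) 0

def opD (k : Kont) : Kont := fun n Y X nt T c =>
  dig c n fun a c => dig c n fun b c => dig c n fun x c => dig c n fun y c =>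
  dig c n fun z c => dig c n fun t c =>
  bt (Nat.beq a b) 0 <| bt (Nat.beq x y) 0 <|
  force (Nat.land (row Y a) (row Y b)) fun r =>
  bt (tb r x) (bt (tb r y) (bt (tb r z) (bt (tb (Nat.land (row Y x) (row Y y)) t)
    (goY k n Y X nt T c z t) 0) 0) 0) 0

def clq (K Y : ℕ) : ℕ :=
  loop (fun _ Y => Y) (fun ih M Y => bt (Nat.beq M 0) Y <|
    force (Nat.log2 M) fun b => force (Nat.xor M (sh b)) fun M =>
    force (Nat.lor Y (Nat.shiftLeft (Nat.xor K (sh b)) (Nat.mul 16 b))) fun Y => ih M Y) 12 K Y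

def push (k : Kont) (n Y X nt T c K s : ℕ) : ℕ :=
  force (clq K Y) fun Y =>
  force (Nat.add (Nat.mul T 65536) (Nat.add (Nat.mul s 4096) K)) fun T =>
  force (Nat.succ nt) fun nt => k n Y X nt T c

def opTQ (k : Kont) : Kont := fun n Y X nt T c =>
  dig c n fun a c => dig c n fun b c => dig c n fun x c => dig c n fun y c =>
  bt (tb (row Y a) b) (bt (tb (Nat.land (row Y a) (row Y b)) x)
    (bt (tb (Nat.land (Nat.land (row Y a) (row Y b)) (row Y x)) y)
      (force (Nat.lor (Nat.lor (sh a) (sh b)) (Nat.lor (sh x) (sh y))) fun K =>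
        push k n Y X nt T c K 4) 0) 0) 0

def chain (Y nt T y : ℕ) (fin : ℕ → ℕ) : ℕ → ℕ → ℕ → ℕ :=
  loop (fun x c => bt (Nat.beq x y) (fin c) 0)
    (fun ih x c => getT nt T c fun e c => force (mask e) fun K => bt (tb K x) 0 <|
      force (diff K (row Y x)) fun P => force (Nat.log2 P) fun z =>
      bt (Nat.beq P (sh z)) (ih z c) 0)

def opOC (k : Kont) : Kont := fun n Y X nt T c =>
  dig c 2 fun f c => dig c n fun y c =>
  bt (Nat.beq f 0) (dig c 8 fun l c => chain Y nt T y (fun c => c) (Nat.add l 2) y c) <|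
  dig c n fun z c => dig c 8 fun l c => getT nt T c fun e c => force (mask e) fun K =>
    bt (tb K y) 0 <| force (diff K (row Y y)) fun P => force (Nat.xor P (sh z)) fun Q =>
    force (Nat.log2 Q) fun x => bt (Nat.beq Q (sh x))
      (chain Y nt T y (fun c => goN k n Y X nt T c y z) (Nat.add l 1) x c) 0

def opE (k : Kont) : Kont := fun n Y X nt T c =>
  dig c n fun a c => dig c n fun b c => force (addE Y a b) fun Y' =>
  force (k n Y' X nt T c) fun c => bt (Nat.beq c 0) 0 <| goN k n Y X nt T c a b

/-- All pairs of elements of `I` occur in the relation `X`. -/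
def stab (X I : ℕ) : Bool :=
  loop (fun _ => false) (fun ih M => bt (Nat.beq M 0) true <|
    force (Nat.log2 M) fun b => force (Nat.xor M (sh b)) fun M =>
    bt (Nat.beq (diff M (row X b)) 0) (ih M) false) 13 I

def leaf1 (N : ℕ) (k : Kont) (n Y X nt T A s j c : ℕ) : ℕ :=
  bt (Nat.beq c 0) 0 <| bt (Nat.ble (Nat.add s j) 4) (bt (Nat.ble 2 (Nat.add s j))
    (bt (Nat.ble (Nat.add n j) N)
      (force (Nat.add n j) fun m =>
        force (Nat.lor A (Nat.shiftLeft (Nat.sub (sh j) 1) n)) fun K =>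
        force (Nat.add s j) fun t => push k m Y X nt T c K t) c) c) c

def leaf (N : ℕ) (k : Kont) (n Y X nt T A s c : ℕ) : ℕ :=
  force (leaf1 N k n Y X nt T A s 0 c) fun c => force (leaf1 N k n Y X nt T A s 1 c) fun c =>
  force (leaf1 N k n Y X nt T A s 2 c) fun c => force (leaf1 N k n Y X nt T A s 3 c) fun c =>
  leaf1 N k n Y X nt T A s 4 c

def enum (N : ℕ) (k : Kont) (n Y X nt T f : ℕ) : ℕ → ℕ → ℕ → ℕ → ℕ :=
  loop (fun _ _ _ _ => 0) (fun ih A s C c =>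
    bt (Nat.beq c 0) 0 <| bt (Nat.beq s 4) (leaf N k n Y X nt T A s c) <|
    bt (Nat.beq C 0) (leaf N k n Y X nt T A s c) <|
    force (Nat.log2 C) fun v => force (Nat.xor C (sh v)) fun C =>
    force (ih A s C c) fun c => force (Nat.lor A (sh v)) fun A =>
    force (diff C (row X v)) fun C => force (Nat.succ s) fun s => ih A s C c) f

def opI (N : ℕ) (k : Kont) : Kont := fun n Y X nt T c =>
  force (sh n) fun q => dig c q fun I c => bt (stab X I)
    (force (Nat.xor (Nat.sub q 1) I) fun C => enum N k n Y X nt T 14 0 0 C c) 0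

def sgd (g b : ℕ) : ℕ := Nat.land (Nat.shiftRight g (Nat.mul 4 b)) 15

def cand (W g : ℕ) : ℕ → ℕ → ℕ :=
  loop (fun _ _ => 0) (fun ih M C => bt (Nat.beq M 0) C <|
    force (Nat.log2 M) fun b => force (Nat.xor M (sh b)) fun M =>
    force (Nat.land C (row W (sgd g b))) fun C => ih M C) 13

def mapm (g : ℕ) : ℕ → ℕ → ℕ :=
  loop (fun _ _ => 0) (fun ih M A => bt (Nat.beq M 0) A <|
    force (Nat.log2 M) fun b => force (Nat.xor M (sh b)) fun M =>
    force (Nat.lor A (sh (sgd g b))) fun A => ih M A) 13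

def memT (e : ℕ) : ℕ → Bool :=
  loop (fun _ => false) (fun ih T => bt (Nat.beq T 0) false <|
    bt (Nat.beq (Nat.land T 65535) e) true <| force (Nat.shiftRight T 16) fun T => ih T) 20

def allT (T g : ℕ) : ℕ → Bool :=
  loop (fun _ => false) (fun ih U => bt (Nat.beq U 0) true <| force (Nat.land U 65535) fun e =>
    force (mapm g (mask e) 0) fun A => force (Nat.add (Nat.mul (sz e) 4096) A) fun f =>
    bt (memT f T) (force (Nat.shiftRight U 16) fun U => ih U) false) 20

def pop : ℕ → ℕ :=
  loop (fun _ => 0) (fun ih M => bt (Nat.beq M 0) 0 <|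
    force (Nat.xor M (sh (Nat.log2 M))) fun M => Nat.succ (ih M)) 13

def nth (i C : ℕ) : ℕ :=
  loop Nat.log2 (fun ih C => force (Nat.xor C (sh (Nat.log2 C))) fun C => ih C) i C

def pick (C c : ℕ) (k : ℕ → ℕ → ℕ) : ℕ :=
  bt (Nat.beq C 0) 0 <| force (Nat.log2 C) fun p => bt (Nat.beq C (sh p)) (k p c) <|
    force (pop C) fun m => dig c m fun i c => force (nth i C) fun p => bt (tb C p) (k p c) 0

def mtch (Y X T r : ℕ) : ℕ → ℕ → ℕ → ℕ → ℕ → ℕ :=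
  loop (fun _ _ g c => bt (allT T g (Nat.shiftRight r 400)) c 0)
    (fun ih a F g c => force (sh a) fun q =>
      force (cand Y g (Nat.mod (row r (Nat.add a 1)) q) F) fun C =>
      force (cand X g (Nat.mod (row r (Nat.add a 13)) q) C) fun C =>
      pick C c fun p c => force (Nat.xor F (sh p)) fun F =>
      force (Nat.add g (Nat.shiftLeft p (Nat.mul 4 a))) fun g => force (Nat.succ a) fun a => ih a F g c)

def opL (db : ℕ) : Kont := fun n Y X _ T c =>
  ans 10 18876766841496082 c fun j c => dig c (sh j) fun i c => force (Nat.pred (Nat.add (sh j) i)) fun i =>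
  force (Nat.land (Nat.shiftRight db (Nat.mul 640 i)) (Nat.sub (sh 640) 1)) fun r =>
  force (row r 0) fun k => bt (Nat.beq k 0) 0 <|
  force (Nat.sub (sh n) 1) fun F => mtch Y X T r k 0 F 0 c

def findT (x : ℕ) (k : ℕ → ℕ → ℕ) : ℕ → ℕ :=
  loop (fun _ => 0) (fun ih T => bt (Nat.beq T 0) 0 <|
    force (Nat.land T 65535) fun e => force (Nat.shiftRight T 16) fun T =>
    bt (tb (mask e) x) (k (mask e) T) (ih T)) 20

def opB3 : Kont := fun n _ _ _ T c => dig c n fun x c =>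
  findT x (fun K T => findT x (fun L T => findT x (fun M _ =>
    bt (Nat.beq K L) 0 <| bt (Nat.beq L M) 0 <| bt (Nat.beq K M) 0 c) T) T) T

def opS1 (k : Kont) : Kont := fun n Y X nt T c => dig c n fun x c => dig c n fun z c =>
  findT x (fun K U => findT x (fun L _ => bt (Nat.beq (Nat.land K L) (sh x))
    (bt (tb (Nat.lor K L) z) 0 <| bt (tb Y (idx x z)) c <| goN k n Y X nt T c x z) 0) U) T

def opH (h : ℕ) : Kont := fun _ _ _ _ T c =>
  loop (fun _ _ _ => 0) (fun ih T a s => bt (Nat.ble h a) c <| bt (Nat.beq T 0) 0 <|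
    force (Nat.land T 65535) fun e => force (Nat.shiftRight T 16) fun T =>
    bt (Nat.beq e 0) 0 <| bt (tb s e) (ih T a s) (force (Nat.lor s (sh e)) fun s =>
      force (Nat.add a (Nat.sub 4 (sz e))) fun a => ih T a s)) 20 T 0 0

def two (P : ℕ) (k : ℕ) : ℕ :=
  bt (Nat.beq P 0) 0 <| force (Nat.xor P (sh (Nat.log2 P))) fun Q => bt (Nat.beq Q 0) 0 <|
    bt (Nat.beq Q (sh (Nat.log2 Q))) k 0

def opD2 (k : Kont) : Kont := fun n Y X nt T c => dig c n fun x c => dig c n fun z c =>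
  findT x (fun K U => findT x (fun L _ => two (Nat.land K L) <|
    bt (Nat.beq K L) 0 <| force (diff (row Y x) (Nat.lor K L)) fun E => bt (Nat.beq E 0) 0 <|
    bt (Nat.beq z x) (bt (Nat.beq E (sh (Nat.log2 E))) 0 c) <|
    bt (tb (Nat.lor (Nat.lor K L) E) z) 0 <| goN k n Y X nt T c x z) U) T

def opQ3 : Kont := fun _ _ _ nt T c => getT nt T c fun b c => getT nt T c fun e c => getT nt T c fun f c =>
  bt (Nat.beq (sz b) 4) (bt (Nat.beq (sz e) 3) (bt (Nat.beq (sz f) 3)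
    (force (mask b) fun B => force (mask e) fun K => force (mask f) fun L =>
      bt (Nat.beq (diff B (Nat.lor K L)) 0) (two (Nat.land K B) <| two (Nat.land L B) c) 0) 0) 0) 0

def opLP : Kont := fun n Y _ nt T c => dig c 16 fun s c => bt (Nat.beq s 4) (
  getT nt T c fun e c => getT nt T c fun f c => getT nt T c fun g c => getT nt T c fun h c =>
  force (sh n) fun q => dig c q fun A c => dig c q fun B c => dig c q fun C c =>
  force (Nat.lor (mask e) (mask f)) fun U => force (Nat.lor (mask g) (mask h)) fun V =>
  bt (Nat.beq (Nat.land (mask e) (mask f)) 0) (bt (Nat.beq (Nat.land (mask g) (mask h)) 0)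
    (bt (Nat.beq (Nat.land U V) 0) (bt (Nat.beq (diff (Nat.lor U V) (Nat.lor A (Nat.lor B C))) 0)
      (bt (stab Y A) (bt (stab Y B) (bt (stab Y C) c 0) 0) 0) 0) 0) 0) 0) 0

/-- Answer `c` when the continuation `st` refutes the state with the code suggested by `o`. -/
def attempt (st : Kont) (o : ℕ → ℕ → ℕ → ℕ → ℕ) (k : Kont) : Kont := fun n Y X nt T c =>
  force (o n Y nt T) fun q => bt (Nat.beq q 0) (k n Y X nt T c) <|
    force (st n Y X nt T q) fun r => bt (Nat.beq r 0) (k n Y X nt T c) c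

def stuck : Kont := fun n Y X nt T c => bt (Nat.beq n 0) 0 (opO (fun _ _ _ _ _ _ => 0) n Y X nt T c)

/-- Suggest a vertex adjacent to all members of the newest tight set. -/
def common (n Y nt T : ℕ) : ℕ :=
  force (loop (fun _ _ => 0) (fun ih M C => bt (Nat.beq M 0) C <|
    force (Nat.log2 M) fun b => force (Nat.xor M (sh b)) fun M =>
    force (Nat.land C (row Y b)) fun C => ih M C) 13 (mask (row T 0)) 4095) fun C =>
  bt (Nat.beq C 0) 0 (Nat.mul nt (Nat.add (Nat.log2 C) n))

/-- Suggest a vertex lying in three sets of the stack. -/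
def triple (n _ _ T : ℕ) : ℕ :=
  loop (fun _ _ _ _ => 0) (fun ih T a b c => bt (Nat.beq T 0)
      (bt (Nat.beq c 0) 0 (Nat.add (Nat.log2 c) n)) <|
    force (mask T) fun K => force (Nat.shiftRight T 16) fun T =>
    force (Nat.lor c (Nat.land b K)) fun c => force (Nat.lor b (Nat.land a K)) fun b =>
    force (Nat.lor a K) fun a => ih T a b c) 20 T 0 0 0

/-- Suggest counting when the sets of the stack, with repetition, miss `h` places. -/
def missing (h _ _ _ T : ℕ) : ℕ :=
  loop (fun _ _ => 0) (fun ih T a => bt (Nat.ble h a) 1 <| bt (Nat.beq T 0) 0 <|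
    force (Nat.add a (Nat.sub 4 (sz (Nat.land T 65535)))) fun a =>
    force (Nat.shiftRight T 16) fun T => ih T a) 20 T 0

def auto (ob h : ℕ) (k : Kont) : Kont :=
  attempt stuck common fun n Y X nt T c => bt (Nat.beq ob 8) (k n Y X nt T c) <|
    attempt opB3 triple (attempt (opH h) (missing h) k) n Y X nt T c

/-- The frequencies of the operations below `ob`. -/
def freq (ob : ℕ) : ℕ := bt (Nat.beq ob 8) 4608602199181 307101665559635163632773

def step (ob N h db : ℕ) (k : Kont) : Kont := fun n Y X nt T c =>
  ans ob (freq ob) c fun o c => bt (Nat.beq o 6) (opI N (auto ob h k) n Y X nt T c) <| bt (Nat.beq n 0) 0 <|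
    bt (Nat.ble o 3)
      (bt (Nat.beq o 0) (opO k n Y X nt T c) <| bt (Nat.beq o 1) (opL db n Y X nt T c) <|
        bt (Nat.beq o 2) (opOC k n Y X nt T c) (opE k n Y X nt T c)) <|
      bt (Nat.beq o 4) (opM k n Y X nt T c) <| bt (Nat.beq o 5) (opD k n Y X nt T c) <|
      bt (Nat.beq o 7) (opTQ k n Y X nt T c) <|
      bt (Nat.beq o 9) (opS1 k n Y X nt T c) <|
      bt (Nat.beq o 11) (opD2 k n Y X nt T c) <|
      bt (Nat.beq o 12) (opQ3 n Y X nt T c) (opLP n Y X nt T c)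

def run (ob N h db fuel : ℕ) : Kont :=
  loop (fun _ _ _ _ _ _ => 0) (step ob N h db) fuel

def hdrT (n : ℕ) (k : ℕ → ℕ → ℕ → ℕ) : ℕ → ℕ → ℕ → ℕ → ℕ :=
  loop (fun Y T c => k Y T c) (fun ih Y T c => force (sh n) fun q => dig c q fun K c =>
    force (loop (fun _ a => a) (fun ih M a => bt (Nat.beq M 0) a <|
      force (Nat.xor M (sh (Nat.log2 M))) fun M => force (Nat.succ a) fun a => ih M a) 12 K 0) fun s =>
    force (clq K Y) fun Y => force (Nat.add (Nat.mul T 65536) (Nat.add (Nat.mul s 4096) K)) fun T =>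
      ih Y T c)

def hdrP (n : ℕ) (k : ℕ → ℕ → ℕ → ℕ) : ℕ → ℕ → ℕ → ℕ → ℕ → ℕ :=
  loop (fun _ _ _ _ _ => 0) (fun ih a b Y X c => bt (Nat.beq a n) (k Y X c) <|
    bt (Nat.beq a b) (force (Nat.succ a) fun a => ih a 0 Y X c) <|
    force (Nat.succ b) fun b' => bt (tb Y (idx a b)) (ih a b' Y X c) <|
    ans 3 90343 c fun d c => bt (Nat.beq d 0) (ih a b' Y X c) <|
      bt (Nat.beq d 1) (force (addE Y a b) fun Y => ih a b' Y X c)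
        (force (addE X a b) fun X => ih a b' Y X c)) 200

/-- Decode a lemma header into its packed record. -/
def hdr (c : ℕ) (k : ℕ → ℕ → ℕ → ℕ) : ℕ :=
  dig c 12 fun n c => dig c 12 fun nt c =>
  hdrT n (fun Y T c => hdrP n (fun Y X c =>
    force (Nat.lor (Nat.lor n (Nat.shiftLeft Y 16)) (Nat.lor (Nat.shiftLeft X 208) (Nat.shiftLeft T 400)))
      fun r => k r nt c) 0 0 Y 0 c) nt 0 0 c

def low (r o : ℕ) : ℕ → ℕ → ℕ → ℕ :=
  loop (fun _ W => W) (fun ih a W => force (Nat.mod (row r (Nat.add a o)) (sh a)) fun M =>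
    force (loop (fun _ W => W) (fun ih M W => bt (Nat.beq M 0) W <| force (Nat.log2 M) fun b =>
      force (Nat.xor M (sh b)) fun M => force (addE W a b) fun W => ih M W) 12 M W) fun W =>
    force (Nat.succ a) fun a => ih a W)

/-- All tight sets on the stack consist of vertices below `n`. -/
def lowT (n : ℕ) : ℕ → Bool :=
  loop (fun _ => false) (fun ih T => bt (Nat.beq T 0) true <|
    bt (Nat.beq (Nat.shiftRight (mask T) n) 0) (force (Nat.shiftRight T 16) fun T => ih T) false) 20

def chk1 (ob N h db r nt c : ℕ) : ℕ :=
  force (row r 0) fun n => bt (Nat.ble n 12) (force (low r 1 n 0 0) fun Y => force (low r 13 n 0 0) fun X =>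
  force (Nat.shiftRight r 400) fun T => bt (lowT n T) (run ob N h db 1000 n Y X nt T c) 0) 0

def addRec (db r : ℕ) : ℕ := Nat.add (Nat.mul db (sh 640)) r

def chks (ob N h z : ℕ) (l : List ℕ) : ℕ → Bool :=
  List.rec (motive := fun _ => ℕ → Bool)
    (fun db => Nat.blt 0 (run ob N h db 1000 0 0 0 0 0 z)) (fun c _ ih db =>
    force c fun c => force (hdr c fun r nt c => force (chk1 ob N h db r nt c) fun x =>
      bt (Nat.beq x 0) (sh 640) r) fun r => bt (Nat.ble (sh 640) r) false <|
        force (addRec db r) fun db => ih db) l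

section Bits

@[simp] theorem force_eq {α : Type} (x : ℕ) (k : ℕ → α) : force x k = k x := by
  cases x <;> rfl

@[simp] theorem bt_eq {α : Type} (b : Bool) (t e : α) : bt b t e = if b = true then t else e := by
  cases b <;> rfl

@[simp] theorem loop_zero {α : Type} (z : α) (s : α → α) : loop z s 0 = z := rfl

@[simp] theorem loop_succ {α : Type} (z : α) (s : α → α) (n : ℕ) :
    loop z s (n + 1) = s (loop z s n) := rfl

theorem dig_eq (c b : ℕ) (k : ℕ → ℕ → ℕ) : dig c b k = k (c % b) (c / b) := by
  simp only [dig, force_eq]; rfl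

theorem ans_eq (m W c : ℕ) (k : ℕ → ℕ → ℕ) :
    ans m W c k = 0 ∨ ∃ o < m, ∃ c', ans m W c k = k o c' := by
  rw [ans, dig_eq]
  generalize hL : (loop (α := ℕ → ℕ → ℕ → ℕ) _ _) = L
  suffices H : ∀ f o W v, o + f ≤ m → L f o W v = 0 ∨ ∃ i < m, ∃ c', L f o W v = k i c' from
    H m 0 W _ (by omega)
  intro f
  induction f with
  | zero => intro o W v _; rw [← hL]; exact Or.inl rfl
  | succ f ih =>
    intro o W v ho
    rw [← hL, loop_succ, hL]
    simp only [force_eq, bt_eq]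
    split_ifs
    · exact ih _ _ _ (by rw [Nat.succ_eq_add_one]; omega)
    · exact Or.inr ⟨o, by omega, _, rfl⟩

theorem beq_iff (a b : ℕ) : Nat.beq a b = true ↔ a = b := by simp

theorem ble_iff (a b : ℕ) : Nat.ble a b = true ↔ a ≤ b := by simp

@[simp] theorem testBit_sh (a i : ℕ) : (sh a).testBit i = decide (a = i) := by
  rw [show sh a = 2 ^ a from Nat.one_shiftLeft a, Nat.testBit_two_pow]

@[simp] theorem testBit_land (a b i : ℕ) :
    (Nat.land a b).testBit i = (a.testBit i && b.testBit i) := Nat.testBit_and a b i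

@[simp] theorem testBit_lor (a b i : ℕ) :
    (Nat.lor a b).testBit i = (a.testBit i || b.testBit i) := Nat.testBit_or a b i

@[simp] theorem testBit_xor (a b i : ℕ) :
    (Nat.xor a b).testBit i = (a.testBit i ^^ b.testBit i) := Nat.testBit_xor a b i

theorem tb_eq (w i : ℕ) : tb w i = w.testBit i := by
  rw [Nat.testBit_eq_decide_div_mod_eq]
  change Nat.beq ((w >>> i) &&& 1) 1 = _
  rw [Nat.and_one_is_mod, Nat.shiftRight_eq_div_pow, Bool.eq_iff_iff]
  simp

theorem testBit_row (w a i : ℕ) : (row w a).testBit i = (decide (i < 16) && w.testBit (16 * a + i)) := by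
  change ((w >>> (16 * a)) &&& (2 ^ 16 - 1)).testBit i = _
  rw [Nat.testBit_and, Nat.testBit_shiftRight, Nat.testBit_two_pow_sub_one, Bool.and_comm]

theorem testBit_diff (K R i : ℕ) : (diff K R).testBit i = (K.testBit i && !R.testBit i) := by
  simp only [diff, testBit_xor, testBit_land]; cases K.testBit i <;> cases R.testBit i <;> rfl

theorem testBit_mask (e i : ℕ) : (mask e).testBit i = (decide (i < 12) && e.testBit i) := by
  change (e &&& (2 ^ 12 - 1)).testBit i = _
  rw [Nat.testBit_and, Nat.testBit_two_pow_sub_one, Bool.and_comm]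

theorem testBit_addE (w a b i : ℕ) :
    (addE w a b).testBit i = (w.testBit i || (decide (16 * a + b = i) || decide (16 * b + a = i))) := by
  simp only [addE, testBit_lor, testBit_sh]; rfl

theorem testBit_log2_self {M : ℕ} (h : M ≠ 0) : M.testBit (Nat.log2 M) = true :=
  Nat.testBit_log2 h

theorem testBit_peel {M : ℕ} (h : M ≠ 0) (i : ℕ) :
    (Nat.xor M (sh (Nat.log2 M))).testBit i = (M.testBit i && decide (i ≠ Nat.log2 M)) := by
  rw [testBit_xor, testBit_sh]
  by_cases e : Nat.log2 M = i
  · subst e; simp [testBit_log2_self h]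
  · simp [e, Ne.symm e]

theorem testBit_of_eq_sh {M b : ℕ} (h : M = sh b) (i : ℕ) : M.testBit i = true ↔ i = b := by
  subst h; simp [eq_comm]

theorem eq_zero_of_bits {M : ℕ} (h : ∀ i, M.testBit i = false) : M = 0 :=
  Nat.eq_of_testBit_eq fun i => by simp [h i]

/-- The set of positions below `12` of the ones of `M`. -/
def bits (M : ℕ) : Finset ℕ := (Finset.range 12).filter fun i => M.testBit i = true

theorem mem_bits {M i : ℕ} : i ∈ bits M ↔ i < 12 ∧ M.testBit i = true := by simp [bits]

theorem mem_bits_mask {e i : ℕ} : i ∈ bits (mask e) ↔ (mask e).testBit i = true := by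
  rw [mem_bits, testBit_mask]; simp

theorem bits_inj {M M' : ℕ} (h : ∀ i, M.testBit i = true → i < 12)
    (h' : ∀ i, M'.testBit i = true → i < 12) (e : bits M = bits M') : M = M' := by
  refine Nat.eq_of_testBit_eq fun i => ?_
  have := congrArg (i ∈ ·) e
  simp only [mem_bits, eq_iff_iff] at this
  rw [Bool.eq_iff_iff]
  exact ⟨fun q => (this.1 ⟨h i q, q⟩).2, fun q => (this.2 ⟨h' i q, q⟩).2⟩

end Bits

/-- The combinatorial data carried by the rays `T` not orthogonal to a fixed unit vector: the
orthogonality relation, the sets whose span contains the vector, and the squared overlaps. -/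
structure Sys {α : Type} [DecidableEq α] (T : Finset α) (adj : α → α → Prop)
    (Tight : Finset α → Prop) (w : α → ℝ) : Prop where
  symm : ∀ {x y}, adj x y → adj y x
  irrefl : ∀ x, ¬ adj x x
  sub : ∀ {K}, Tight K → K ⊆ T
  clique : ∀ {K}, Tight K → ∀ x ∈ K, ∀ y ∈ K, x ≠ y → adj x y
  two_le : ∀ {K}, Tight K → 2 ≤ K.card
  le_four : ∀ {K}, Tight K → K.card ≤ 4
  tight_of_clique : ∀ K ⊆ T, K.card = 4 → (∀ x ∈ K, ∀ y ∈ K, x ≠ y → adj x y) → Tight K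
  exists_not_adj : ∀ {K}, Tight K → ∀ y ∈ T, y ∉ K → ∃ x ∈ K, ¬ adj y x
  overlap_lt : ∀ {K}, Tight K → ∀ y ∈ T, y ∉ K → ∀ x ∈ K, (∀ z ∈ K, z ≠ x → adj y z) → w y < w x
  four : ∀ {K}, Tight K → K.card = 4 → ∀ y ∈ T, y ∉ K → ∀ x ∈ K, ¬ ∀ z ∈ K, z ≠ x → adj y z
  diff : ∀ {K L}, Tight K → Tight L → ∀ z ∈ T, z ∉ symmDiff K L → ∀ p ∈ symmDiff K L,
    (∀ q ∈ symmDiff K L, q ≠ p → adj z q) → adj z p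
  square : ∀ {a b x y z t}, a ≠ b → x ≠ y → adj a x → adj a y → adj b x → adj b y →
    adj a z → adj b z → adj x t → adj y t → adj z t
  nonneg : ∀ x, 0 ≤ w x
  clique_le : ∀ K ⊆ T, (∀ x ∈ K, ∀ y ∈ K, x ≠ y → adj x y) → ∑ x ∈ K, w x ≤ 1
  sum_eq : ∀ {K}, Tight K → ∑ x ∈ K, w x = 1
  unsat : ∀ I ⊆ T, (∀ x ∈ I, ∀ y ∈ I, ¬ adj x y) → ∃ K, Tight K ∧ Disjoint K I

/-- Counting restrictions available when every degree is at most six. -/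
structure BRules {α : Type} [DecidableEq α] (T : Finset α) (adj : α → α → Prop)
    (Tight : Finset α → Prop) : Prop where
  two_bases : ∀ {K L M}, Tight K → Tight L → Tight M → ∀ x, x ∈ K → x ∈ L → x ∈ M →
    K = L ∨ L = M ∨ K = M
  single : ∀ {K L}, Tight K → Tight L → ∀ x, K ∩ L = {x} → ∀ z ∈ T, adj x z → z ∈ K ∪ L
  double : ∀ {K L}, Tight K → Tight L → K ≠ L → (K ∩ L).card = 2 → ∀ x ∈ K ∩ L, ∀ z ∈ T, ∀ z' ∈ T,
    adj x z → adj x z' → z ∉ K ∪ L → z' ∉ K ∪ L → z = z'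
  hidden : ∀ P : Finset (Finset α), (∀ K ∈ P, Tight K) → ∑ K ∈ P, (4 - K.card) ≤ 6
  quad : ∀ {B K L}, Tight B → Tight K → Tight L → B.card = 4 → K.card = 3 → L.card = 3 →
    B ⊆ K ∪ L → (K ∩ B).card = 2 → (L ∩ B).card = 2 → False

section Soundness

variable {α : Type} [DecidableEq α] {T : Finset α} {adj : α → α → Prop} {Tight : Finset α → Prop}
  {w : α → ℝ}

/-- The set named by the mask `M` under the assignment `σ`. -/
def im (σ : ℕ → α) (M : ℕ) : Finset α := (bits M).image σ

theorem mem_im {σ : ℕ → α} {M : ℕ} {x : α} :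
    x ∈ im σ M ↔ ∃ i, (i < 12 ∧ M.testBit i = true) ∧ σ i = x := by
  simp [im, mem_bits]

theorem mem_im_mask {σ : ℕ → α} {e : ℕ} {x : α} :
    x ∈ im σ (mask e) ↔ ∃ i, (mask e).testBit i = true ∧ σ i = x := by
  simp [im, mem_bits_mask]

/-- The entry `e` of a tight-set stack is correct for `σ`. -/
def Ent (Tight : Finset α → Prop) (σ : ℕ → α) (n e : ℕ) : Prop :=
  (∀ i, (mask e).testBit i = true → i < n) ∧ Tight (im σ (mask e)) ∧ sz e = (im σ (mask e)).card

/-- Every nonzero entry of the stack `t` is correct for `σ`. -/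
def Good (Tight : Finset α → Prop) (σ : ℕ → α) (n t : ℕ) : Prop :=
  ∀ i, row t i ≠ 0 → Ent Tight σ n (row t i)

/-- The assignment `σ` realizes the state `(n, Y, X, t)` of the checker. -/
structure Realizes (T : Finset α) (adj : α → α → Prop) (Tight : Finset α → Prop) (n Y X t : ℕ)
    (σ : ℕ → α) : Prop where
  le : n ≤ 12
  inj : ∀ i < n, ∀ j < n, σ i = σ j → i = j
  mem : ∀ i < n, σ i ∈ T
  yes : ∀ a b, b < 16 → Y.testBit (16 * a + b) = true → a < n ∧ b < n ∧ adj (σ a) (σ b)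
  no : ∀ a b, b < 16 → X.testBit (16 * a + b) = true → a < n ∧ b < n ∧ ¬ adj (σ a) (σ b)
  good : Good Tight σ n t

/-- A nonzero answer of `k` refutes the state. -/
def Snd (T : Finset α) (adj : α → α → Prop) (Tight : Finset α → Prop) (k : Kont) : Prop :=
  ∀ n Y X nt t c, k n Y X nt t c ≠ 0 → ∀ σ : ℕ → α, ¬ Realizes T adj Tight n Y X t σ

namespace Realizes

variable {n Y X t : ℕ} {σ : ℕ → α}

theorem row_yes (m : Realizes T adj Tight n Y X t σ) {a b : ℕ} (h : (row Y a).testBit b = true) :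
    a < n ∧ b < n ∧ adj (σ a) (σ b) := by
  rw [testBit_row] at h
  simp only [Bool.and_eq_true, decide_eq_true_eq] at h
  exact m.yes a b h.1 h.2

theorem row_no (m : Realizes T adj Tight n Y X t σ) {a b : ℕ} (h : (row X a).testBit b = true) :
    a < n ∧ b < n ∧ ¬ adj (σ a) (σ b) := by
  rw [testBit_row] at h
  simp only [Bool.and_eq_true, decide_eq_true_eq] at h
  exact m.no a b h.1 h.2

theorem tb_yes (m : Realizes T adj Tight n Y X t σ) {a b : ℕ} (hb : b < n)
    (h : tb Y (idx a b) = true) : a < n ∧ b < n ∧ adj (σ a) (σ b) := by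
  rw [tb_eq] at h
  exact m.yes a b (by have := m.le; omega) h

theorem tb_no (m : Realizes T adj Tight n Y X t σ) {a b : ℕ} (hb : b < n)
    (h : tb X (idx a b) = true) : a < n ∧ b < n ∧ ¬ adj (σ a) (σ b) := by
  rw [tb_eq] at h
  exact m.no a b (by have := m.le; omega) h

theorem addE_aux {W n a b : ℕ} {R : ℕ → ℕ → Prop} (hR : ∀ {x y}, R x y → R y x) (hn : n ≤ 12)
    (h : ∀ a b, b < 16 → W.testBit (16 * a + b) = true → a < n ∧ b < n ∧ R a b) (ha : a < n)
    (hb : b < n) (hab : R a b) :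
    ∀ c d, d < 16 → (addE W a b).testBit (16 * c + d) = true → c < n ∧ d < n ∧ R c d := by
  intro c d hd e
  rw [testBit_addE] at e
  simp only [Bool.or_eq_true, decide_eq_true_eq] at e
  rcases e with e | e | e
  · exact h c d hd e
  · obtain rfl : a = c := by omega
    obtain rfl : b = d := by omega
    exact ⟨ha, hb, hab⟩
  · obtain rfl : b = c := by omega
    obtain rfl : a = d := by omega
    exact ⟨hb, ha, hR hab⟩

theorem addY (S : Sys T adj Tight w) (m : Realizes T adj Tight n Y X t σ) {a b : ℕ} (ha : a < n)
    (hb : b < n) (h : adj (σ a) (σ b)) : Realizes T adj Tight n (addE Y a b) X t σ :=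
  { m with yes := addE_aux (R := fun x y => adj (σ x) (σ y)) S.symm m.le m.yes ha hb h }

theorem addX (S : Sys T adj Tight w) (m : Realizes T adj Tight n Y X t σ) {a b : ℕ} (ha : a < n)
    (hb : b < n) (h : ¬ adj (σ a) (σ b)) : Realizes T adj Tight n Y (addE X a b) t σ :=
  have q := addE_aux (R := fun x y => ¬ adj (σ x) (σ y)) (fun h q => h (S.symm q)) m.le m.no ha hb h
  { m with no := q }

theorem mem_im_lt (m : Realizes T adj Tight n Y X t σ) {e i : ℕ} (he : Ent Tight σ n e) (hi : i < n) :
    σ i ∈ im σ (mask e) ↔ (mask e).testBit i = true := by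
  rw [mem_im_mask]
  exact ⟨fun ⟨j, hj, q⟩ => m.inj j (he.1 j hj) i hi q ▸ hj, fun h => ⟨i, h, rfl⟩⟩

end Realizes

theorem getT_ne {nt t c : ℕ} {k : ℕ → ℕ → ℕ} (h : getT nt t c k ≠ 0) :
    ∃ i c', row t i ≠ 0 ∧ k (row t i) c' ≠ 0 := by
  simp only [getT, dig_eq, force_eq, bt_eq, beq_iff] at h
  split_ifs at h with h0
  · exact absurd rfl h
  · exact ⟨_, _, h0, h⟩

theorem not_goN (S : Sys T adj Tight w) {k : Kont} (hk : Snd T adj Tight k) {n Y X nt t c a b : ℕ}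
    {σ : ℕ → α} (m : Realizes T adj Tight n Y X t σ) (ha : a < n) (hb : b < n)
    (h : goN k n Y X nt t c a b ≠ 0) : adj (σ a) (σ b) := by
  by_contra q
  simp only [goN, force_eq] at h
  exact hk _ _ _ _ _ _ h σ (m.addX S ha hb q)

theorem not_goY (S : Sys T adj Tight w) {k : Kont} (hk : Snd T adj Tight k) {n Y X nt t c a b : ℕ}
    {σ : ℕ → α} (m : Realizes T adj Tight n Y X t σ) (ha : a < n) (hb : b < n)
    (h : goY k n Y X nt t c a b ≠ 0) : ¬ adj (σ a) (σ b) := by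
  intro q
  simp only [goY, force_eq, bt_eq, beq_iff] at h
  split_ifs at h with h1 h2
  · exact S.irrefl _ (h1 ▸ q)
  · exact (m.tb_no hb h2).2.2 q
  · exact hk _ _ _ _ _ _ h σ (m.addY S ha hb q)

/-- The elements of `K` outside row `y` other than the listed one are related to `y`. -/
theorem row_of_diff {K Y y i : ℕ} (hK : K.testBit i = true)
    (h : (diff K (row Y y)).testBit i = false) : (row Y y).testBit i = true := by
  rw [testBit_diff, hK] at h
  simpa using h

theorem dig_lt {n c : ℕ} (hn : n ≠ 0) : c % n < n := Nat.mod_lt _ (Nat.pos_of_ne_zero hn)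

theorem snd_opO (S : Sys T adj Tight w) {k : Kont} (hk : Snd T adj Tight k)
    {n Y X nt t c : ℕ} (hn : n ≠ 0) (h : opO k n Y X nt t c ≠ 0) {σ : ℕ → α}
    (m : Realizes T adj Tight n Y X t σ) : False := by
  obtain ⟨i, c', hi, h⟩ := getT_ne h
  have he := m.good i hi
  generalize row t i = e at h he
  rw [dig_eq] at h
  have hy := dig_lt (c := c') hn
  generalize c' % n = y at h hy
  simp only [force_eq, bt_eq, beq_iff, tb_eq] at h
  split_ifs at h with h1 h2 h3 h4 h5 h6
  · exact h rfl
  · obtain ⟨x, hx, q⟩ := S.exists_not_adj he.2.1 (σ y) (m.mem y hy)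
      (by rw [m.mem_im_lt he hy]; exact h1)
    obtain ⟨j, hj, rfl⟩ := mem_im_mask.1 hx
    exact q (m.row_yes (row_of_diff hj (by simp [h2]))).2.2
  all_goals
    set P := diff (mask e) (row Y y) with hP
    have hPx := testBit_log2_self h2
    have hKx : (mask e).testBit (Nat.log2 P) = true := by
      rw [hP, testBit_diff] at hPx; exact (Bool.and_eq_true_iff.1 hPx).1
    have hyK : σ y ∉ im σ (mask e) := by rw [m.mem_im_lt he hy]; exact h1
    have hxm : σ (Nat.log2 P) ∈ im σ (mask e) := mem_im_mask.2 ⟨_, hKx, rfl⟩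
  · refine S.four he.2.1 (he.2.2 ▸ h4) (σ y) (m.mem y hy) hyK _ hxm fun z hz hzx => ?_
    obtain ⟨j, hj, rfl⟩ := mem_im_mask.1 hz
    refine (m.row_yes (row_of_diff hj ?_)).2.2
    have := testBit_peel h2 j
    rw [h3] at this
    have hjx : j ≠ Nat.log2 P := fun q => hzx (by rw [q])
    simpa [hjx] using this
  · have q := not_goN S hk m hy (he.1 _ hKx) h
    obtain ⟨x, hx, q'⟩ := S.exists_not_adj he.2.1 (σ y) (m.mem y hy) hyK
    obtain ⟨j, hj, rfl⟩ := mem_im_mask.1 hx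
    by_cases hjx : j = Nat.log2 P
    · exact q' (hjx ▸ q)
    · refine q' (m.row_yes (row_of_diff hj ?_)).2.2
      have := testBit_peel h2 j
      rw [h3] at this
      simpa [hjx] using this
  · set Q := Nat.xor P (sh (Nat.log2 P)) with hQ
    have hQz := testBit_log2_self h3
    have hPz : P.testBit (Nat.log2 Q) = true ∧ Nat.log2 Q ≠ Nat.log2 P := by
      have := testBit_peel h2 (Nat.log2 Q)
      rw [← hQ, hQz] at this
      simpa using this.symm
    have hKz : (mask e).testBit (Nat.log2 Q) = true := by
      have := hPz.1
      rw [hP, testBit_diff] at this; exact (Bool.and_eq_true_iff.1 this).1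
    have key : ∀ j, (mask e).testBit j = true → j ≠ Nat.log2 P → j ≠ Nat.log2 Q →
        adj (σ y) (σ j) := by
      intro j hj h1 h2'
      refine (m.row_yes (row_of_diff hj ?_)).2.2
      have := testBit_peel h2 j
      rw [← hQ, h5, testBit_sh] at this
      simpa [h1, Ne.symm h2'] using this
    have hx1 : ¬ adj (σ y) (σ (Nat.log2 P)) := by
      intro q
      refine S.four he.2.1 (he.2.2 ▸ h6) (σ y) (m.mem y hy) hyK _
        (mem_im_mask.2 ⟨_, hKz, rfl⟩) fun z hz hzx => ?_
      obtain ⟨j, hj, rfl⟩ := mem_im_mask.1 hz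
      by_cases hjx : j = Nat.log2 P
      · exact hjx ▸ q
      · exact key j hj hjx fun q => hzx (by rw [q])
    have q := not_goN S hk (m.addX S hy (he.1 _ hKx) hx1) hy (he.1 _ hKz) h
    refine S.four he.2.1 (he.2.2 ▸ h6) (σ y) (m.mem y hy) hyK _ hxm fun z hz hzx => ?_
    obtain ⟨j, hj, rfl⟩ := mem_im_mask.1 hz
    by_cases hjx : j = Nat.log2 Q
    · exact hjx ▸ q
    · exact key j hj (fun q => hzx (by rw [q])) hjx
  · exact h rfl
  · exact h rfl


end Soundness

section Soundness

variable {α : Type} [DecidableEq α] {T : Finset α} {adj : α → α → Prop} {Tight : Finset α → Prop}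
  {w : α → ℝ}

theorem mem_symmDiff_im {n Y X t : ℕ} {σ : ℕ → α} (m : Realizes T adj Tight n Y X t σ) {e f i : ℕ}
    (he : Ent Tight σ n e) (hf : Ent Tight σ n f) (hi : i < n) :
    σ i ∈ symmDiff (im σ (mask e)) (im σ (mask f)) ↔
      (Nat.xor (mask e) (mask f)).testBit i = true := by
  rw [Finset.mem_symmDiff, m.mem_im_lt he hi, m.mem_im_lt hf hi, testBit_xor]
  cases (mask e).testBit i <;> cases (mask f).testBit i <;> simp

theorem exists_of_mem_symmDiff {n Y X t : ℕ} {σ : ℕ → α} (m : Realizes T adj Tight n Y X t σ)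
    {e f : ℕ} (he : Ent Tight σ n e) (hf : Ent Tight σ n f) {x : α}
    (hx : x ∈ symmDiff (im σ (mask e)) (im σ (mask f))) :
    ∃ i < n, (Nat.xor (mask e) (mask f)).testBit i = true ∧ σ i = x := by
  have : ∃ i < n, σ i = x := by
    rw [Finset.mem_symmDiff] at hx
    rcases hx with ⟨h, -⟩ | ⟨h, -⟩ <;> obtain ⟨i, hi, q⟩ := mem_im_mask.1 h
    exacts [⟨i, he.1 i hi, q⟩, ⟨i, hf.1 i hi, q⟩]
  obtain ⟨i, hi, rfl⟩ := this
  exact ⟨i, hi, (mem_symmDiff_im m he hf hi).1 hx, rfl⟩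

theorem lt_of_xor_testBit {n e f i : ℕ} {σ : ℕ → α} (he : Ent Tight σ n e) (hf : Ent Tight σ n f)
    (h : (Nat.xor (mask e) (mask f)).testBit i = true) : i < n := by
  rw [testBit_xor] at h
  cases q : (mask e).testBit i
  · rw [q] at h; exact hf.1 i (by simpa using h)
  · exact he.1 i q

theorem snd_opM (S : Sys T adj Tight w) {k : Kont} (hk : Snd T adj Tight k)
    {n Y X nt t c : ℕ} (hn : n ≠ 0) (h : opM k n Y X nt t c ≠ 0) {σ : ℕ → α}
    (m : Realizes T adj Tight n Y X t σ) : False := by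
  obtain ⟨i, c₁, hi, h⟩ := getT_ne h
  have he := m.good i hi
  obtain ⟨j, c₂, hj, h⟩ := getT_ne h
  have hf := m.good j hj
  generalize row t i = e at h he
  generalize row t j = f at h hf
  rw [dig_eq] at h
  have hz := dig_lt (c := c₂) hn
  generalize c₂ % n = z at h hz
  simp only [force_eq, bt_eq, beq_iff, tb_eq (Nat.xor _ _)] at h
  set D := Nat.xor (mask e) (mask f) with hD
  have hlt : ∀ i, D.testBit i = true → i < n := fun i h => lt_of_xor_testBit he hf h
  split_ifs at h with h1 h2 h3 h4 h5 h6
  · exact h rfl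
  · exact h rfl
  all_goals try exact h rfl
  all_goals
    set P := diff D (row Y z) with hP
    have hDx : D.testBit (Nat.log2 P) = true := by
      have hPx := testBit_log2_self h2
      rw [hP, testBit_diff] at hPx; exact (Bool.and_eq_true_iff.1 hPx).1
    have hzD : σ z ∉ symmDiff (im σ (mask e)) (im σ (mask f)) := by
      rw [mem_symmDiff_im m he hf hz]; exact h1
  · refine not_goY S hk m hz (hlt _ hDx) h ?_
    refine S.diff he.2.1 hf.2.1 _ (m.mem z hz) hzD _
      ((mem_symmDiff_im m he hf (hlt _ hDx)).2 hDx) fun q hq hqx => ?_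
    obtain ⟨j, hj, hjD, rfl⟩ := exists_of_mem_symmDiff m he hf hq
    refine (m.row_yes (row_of_diff hjD ?_)).2.2
    have := testBit_peel h2 j
    rw [h3] at this
    have hjx : j ≠ Nat.log2 P := fun q => hqx (by rw [q])
    rw [Nat.zero_testBit, decide_eq_true hjx, Bool.and_true] at this
    exact this.symm
  all_goals
    set Q := Nat.xor P (sh (Nat.log2 P)) with hQ
    have hPz : P.testBit (Nat.log2 Q) = true ∧ Nat.log2 Q ≠ Nat.log2 P := by
      have := testBit_peel h2 (Nat.log2 Q)
      rw [← hQ, testBit_log2_self h3] at this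
      simpa using this.symm
    have hDz : D.testBit (Nat.log2 Q) = true := by
      have := hPz.1
      rw [hP, testBit_diff] at this; exact (Bool.and_eq_true_iff.1 this).1
    have key : ∀ j, D.testBit j = true → j ≠ Nat.log2 P → j ≠ Nat.log2 Q →
        adj (σ z) (σ j) := by
      intro j hj h1 h2'
      refine (m.row_yes (row_of_diff hj ?_)).2.2
      have := testBit_peel h2 j
      rw [← hQ, h4, testBit_sh] at this
      simpa [h1, Ne.symm h2'] using this
  · have q := not_goN S hk m hz (hlt _ hDz) h
    refine (m.tb_no (hlt _ hDx) h5).2.2 (S.diff he.2.1 hf.2.1 _ (m.mem z hz) hzD _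
      ((mem_symmDiff_im m he hf (hlt _ hDx)).2 hDx) fun p hp hpx => ?_)
    obtain ⟨j, hj, hjD, rfl⟩ := exists_of_mem_symmDiff m he hf hp
    by_cases hjx : j = Nat.log2 Q
    · exact hjx ▸ q
    · exact key j hjD (fun q => hpx (by rw [q])) hjx
  · have q := not_goN S hk m hz (hlt _ hDx) h
    refine (m.tb_no (hlt _ hDz) h6).2.2 (S.diff he.2.1 hf.2.1 _ (m.mem z hz) hzD _
      ((mem_symmDiff_im m he hf (hlt _ hDz)).2 hDz) fun p hp hpx => ?_)
    obtain ⟨j, hj, hjD, rfl⟩ := exists_of_mem_symmDiff m he hf hp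
    by_cases hjx : j = Nat.log2 P
    · exact hjx ▸ q
    · exact key j hjD hjx (fun q => hpx (by rw [q]))

theorem snd_opD (S : Sys T adj Tight w) {k : Kont} (hk : Snd T adj Tight k)
    {n Y X nt t c : ℕ} (hn : n ≠ 0) (h : opD k n Y X nt t c ≠ 0) {σ : ℕ → α}
    (m : Realizes T adj Tight n Y X t σ) : False := by
  simp only [opD, dig_eq, force_eq, bt_eq, beq_iff, tb_eq, testBit_land, Bool.and_eq_true] at h
  split_ifs at h with h1 h2 h3 h4 h5 h6
  all_goals try exact h rfl
  refine not_goY S hk m (dig_lt hn) (dig_lt hn) h (S.square (fun q => h1 ?_) (fun q => h2 ?_)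
    (m.row_yes h3.1).2.2 (m.row_yes h4.1).2.2 (m.row_yes h3.2).2.2 (m.row_yes h4.2).2.2
    (m.row_yes h5.1).2.2 (m.row_yes h5.2).2.2 (m.row_yes h6.1).2.2 (m.row_yes h6.2).2.2)
  · exact m.inj _ (dig_lt hn) _ (dig_lt hn) q
  · exact m.inj _ (dig_lt hn) _ (dig_lt hn) q

theorem testBit_clq_aux {K : ℕ} (f : ℕ) : ∀ M Y i, (∀ j, M.testBit j = true → K.testBit j = true) →
    (loop (fun _ Y => Y) (fun ih M Y => bt (Nat.beq M 0) Y <|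
      force (Nat.log2 M) fun b => force (Nat.xor M (sh b)) fun M =>
      force (Nat.lor Y (Nat.shiftLeft (Nat.xor K (sh b)) (Nat.mul 16 b))) fun Y => ih M Y)
      f M Y).testBit i = true →
    Y.testBit i = true ∨ ∃ a b, K.testBit a = true ∧ K.testBit b = true ∧ a ≠ b ∧ i = 16 * a + b := by
  induction f with
  | zero => intro M Y i _ h; exact Or.inl h
  | succ f ih =>
    intro M Y i hM h
    rw [loop_succ] at h
    generalize loop _ _ f = L at ih h
    simp only [force_eq, bt_eq, beq_iff] at h
    split_ifs at h with h0
    · exact Or.inl h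
    · have hb := hM _ (testBit_log2_self h0)
      have := ih _ _ _ (fun j hj => hM j (by
        rw [testBit_peel h0] at hj; exact (Bool.and_eq_true_iff.1 hj).1)) h
      rcases this with h | h
      · rw [testBit_lor, Bool.or_eq_true] at h
        rcases h with h | h
        · exact Or.inl h
        · right
          change (Nat.xor K (sh (Nat.log2 M)) <<< (16 * Nat.log2 M)).testBit i = true at h
          rw [Nat.testBit_shiftLeft, testBit_xor, testBit_sh] at h
          simp only [Bool.and_eq_true, decide_eq_true_eq] at h
          by_cases e : Nat.log2 M = i - 16 * Nat.log2 M
          · rw [← e, hb] at h; simp at h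
          · exact ⟨Nat.log2 M, i - 16 * Nat.log2 M, hb, by simpa [e] using h.2, e, by omega⟩
      · exact Or.inr h

theorem testBit_clq {K Y i : ℕ} (h : (clq K Y).testBit i = true) :
    Y.testBit i = true ∨ ∃ a b, K.testBit a = true ∧ K.testBit b = true ∧ a ≠ b ∧ i = 16 * a + b :=
  testBit_clq_aux 12 K Y i (fun _ h => h) h

theorem lt_of_bits {K n : ℕ} (h : ∀ i, K.testBit i = true → i < n) : K < 2 ^ n :=
  Nat.lt_pow_two_of_testBit K fun i hi => by
    by_contra q
    exact absurd (h i (by simpa using q)) (by omega)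

theorem row_push_zero {t e : ℕ} (he : e < 65536) : row (t * 65536 + e) 0 = e := by
  change ((t * 65536 + e) >>> (16 * 0)) &&& (2 ^ 16 - 1) = e
  rw [Nat.and_two_pow_sub_one_eq_mod]
  simp only [mul_zero, Nat.shiftRight_zero]
  omega

theorem row_push_succ {t e i : ℕ} (he : e < 65536) : row (t * 65536 + e) (i + 1) = row t i := by
  change ((t * 65536 + e) >>> (16 * (i + 1))) &&& (2 ^ 16 - 1) = (t >>> (16 * i)) &&& (2 ^ 16 - 1)
  rw [mul_add, mul_one, add_comm (16 * i), Nat.shiftRight_add, Nat.shiftRight_eq_div_pow _ 16]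
  congr 2
  omega

theorem mask_entry {K s : ℕ} (hK : K < 4096) : mask (s * 4096 + K) = K := by
  change (s * 4096 + K) &&& (2 ^ 12 - 1) = K
  rw [Nat.and_two_pow_sub_one_eq_mod]; omega

theorem sz_entry {K s : ℕ} (hK : K < 4096) : sz (s * 4096 + K) = s := by
  change (s * 4096 + K) >>> 12 = s
  rw [Nat.shiftRight_eq_div_pow]; omega

theorem snd_push (S : Sys T adj Tight w) {k : Kont} (hk : Snd T adj Tight k)
    {n Y X nt t c K s : ℕ} (h : push k n Y X nt t c K s ≠ 0) {σ : ℕ → α}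
    (m : Realizes T adj Tight n Y X t σ) (hK : ∀ i, K.testBit i = true → i < n)
    (hT : Tight (im σ K)) (hs : s = (im σ K).card) : False := by
  simp only [push, force_eq] at h
  have hK' : K < 4096 := lt_of_bits (n := 12) fun i hi => (hK i hi).trans_le m.le
  have hs4 : s ≤ 4 := hs ▸ S.le_four hT
  have he : s * 4096 + K < 65536 := by omega
  refine hk _ _ _ _ _ _ h σ { m with yes := ?_, good := ?_ }
  · intro a b hb q
    rcases testBit_clq q with q | ⟨c, d, hc, hd, hcd, q⟩
    · exact m.yes a b hb q
    · have := hK c hc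
      have := hK d hd
      have := m.le
      obtain rfl : a = c := by omega
      obtain rfl : b = d := by omega
      refine ⟨hK _ hc, hK _ hd, S.clique hT _ ?_ _ ?_ fun e => hcd (m.inj _ ‹_› _ ‹_› e)⟩
      · exact mem_im.2 ⟨_, ⟨by omega, hc⟩, rfl⟩
      · exact mem_im.2 ⟨_, ⟨by omega, hd⟩, rfl⟩
  · intro i
    change row (t * 65536 + (s * 4096 + K)) i ≠ 0 → Ent Tight σ n (row (t * 65536 + (s * 4096 + K)) i)
    rcases i with _ | i
    · rw [row_push_zero he]
      intro _
      rw [Ent, mask_entry hK', sz_entry hK']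
      exact ⟨hK, hT, hs⟩
    · rw [row_push_succ he]
      exact m.good i

theorem snd_opTQ (S : Sys T adj Tight w) {k : Kont} (hk : Snd T adj Tight k)
    {n Y X nt t c : ℕ} (hn : n ≠ 0) (h : opTQ k n Y X nt t c ≠ 0) {σ : ℕ → α}
    (m : Realizes T adj Tight n Y X t σ) : False := by
  simp only [opTQ, dig_eq, force_eq, bt_eq, tb_eq, testBit_land, Bool.and_eq_true] at h
  have ha := dig_lt (c := c) hn
  have hb := dig_lt (c := c / n) hn
  have hx := dig_lt (c := c / n / n) hn
  have hy := dig_lt (c := c / n / n / n) hn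
  generalize c % n = a at *
  generalize c / n % n = b at *
  generalize c / n / n % n = x at *
  generalize c / n / n / n % n = y at *
  split_ifs at h with h1 h2 h3
  all_goals try exact h rfl
  have r1 := (m.row_yes h1).2.2
  have r2 := (m.row_yes h2.1).2.2
  have r3 := (m.row_yes h2.2).2.2
  have r4 := (m.row_yes h3.1.1).2.2
  have r5 := (m.row_yes h3.1.2).2.2
  have r6 := (m.row_yes h3.2).2.2
  have hle := m.le
  have him : im σ (Nat.lor (Nat.lor (sh a) (sh b)) (Nat.lor (sh x) (sh y))) =
      {σ a, σ b, σ x, σ y} := by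
    ext z
    simp only [mem_im, testBit_lor, testBit_sh, Bool.or_eq_true, decide_eq_true_eq,
      Finset.mem_insert, Finset.mem_singleton]
    constructor
    · rintro ⟨i, ⟨_, (rfl | rfl) | rfl | rfl⟩, rfl⟩ <;> simp
    · rintro (rfl | rfl | rfl | rfl)
      exacts [⟨a, by omega, rfl⟩, ⟨b, by omega, rfl⟩, ⟨x, by omega, rfl⟩, ⟨y, by omega, rfl⟩]
  have ne : ∀ {u v : α}, adj u v → u ≠ v := fun h e => S.irrefl _ (e ▸ h)
  have hc : ({σ a, σ b, σ x, σ y} : Finset α).card = 4 := by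
    rw [Finset.card_insert_of_notMem, Finset.card_insert_of_notMem,
      Finset.card_insert_of_notMem, Finset.card_singleton] <;>
      simp [ne r1, ne r2, ne r3, ne r4, ne r5, ne r6]
  refine snd_push S hk h m ?_ (him ▸ S.tight_of_clique _ ?_ hc ?_) (him ▸ hc.symm)
  · intro i hi
    simp only [testBit_lor, testBit_sh, Bool.or_eq_true, decide_eq_true_eq] at hi
    omega
  · intro z hz
    simp only [Finset.mem_insert, Finset.mem_singleton] at hz
    rcases hz with rfl | rfl | rfl | rfl
    exacts [m.mem _ ha, m.mem _ hb, m.mem _ hx, m.mem _ hy]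
  · intro u hu v hv huv
    simp only [Finset.mem_insert, Finset.mem_singleton] at hu hv
    rcases hu with rfl | rfl | rfl | rfl <;> rcases hv with rfl | rfl | rfl | rfl <;>
      first
        | exact absurd rfl huv
        | assumption
        | exact S.symm (by assumption)

theorem snd_opE (S : Sys T adj Tight w) {k : Kont} (hk : Snd T adj Tight k)
    {n Y X nt t c : ℕ} (hn : n ≠ 0) (h : opE k n Y X nt t c ≠ 0) {σ : ℕ → α}
    (m : Realizes T adj Tight n Y X t σ) : False := by
  simp only [opE, dig_eq, force_eq, bt_eq, beq_iff] at h
  split_ifs at h with h1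
  · exact h rfl
  · exact hk _ _ _ _ _ _ h1 σ (m.addY S (dig_lt hn) (dig_lt hn)
      (not_goN S hk m (dig_lt hn) (dig_lt hn) h))

end Soundness

section Soundness

variable {α : Type} [DecidableEq α] {T : Finset α} {adj : α → α → Prop} {Tight : Finset α → Prop}
  {w : α → ℝ}


theorem chain_spec (S : Sys T adj Tight w) {n Y X nt t y : ℕ} {fin : ℕ → ℕ} {σ : ℕ → α}
    (m : Realizes T adj Tight n Y X t σ) (f : ℕ) : ∀ x c, x < n →
    chain Y nt t y fin f x c ≠ 0 → w (σ x) ≤ w (σ y) ∧ (f ≠ 0 → w (σ x) < w (σ y)) ∧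
      ∃ c', fin c' ≠ 0 := by
  induction f with
  | zero =>
    intro x c _ h
    simp only [chain, loop_zero, bt_eq, beq_iff] at h
    split_ifs at h with h0
    · exact ⟨h0 ▸ le_rfl, fun q => absurd rfl q, c, h⟩
    · exact absurd rfl h
  | succ f ih =>
    intro x c hx h
    rw [chain, loop_succ] at h
    simp only [chain] at ih
    generalize loop _ _ f = L at ih h
    obtain ⟨i, c', hi, h⟩ := getT_ne h
    have he := m.good i hi
    generalize row t i = e at h he
    simp only [force_eq, bt_eq, beq_iff, tb_eq] at h
    split_ifs at h with h1 h2
    · exact absurd rfl h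
    · set z := Nat.log2 (diff (mask e) (row Y x)) with hz
      have hz1 := (testBit_of_eq_sh h2 z).2 rfl
      rw [testBit_diff, Bool.and_eq_true] at hz1
      have hzn := he.1 _ hz1.1
      obtain ⟨r1, -, r3⟩ := ih z c' hzn h
      have hlt : w (σ x) < w (σ z) := by
        refine S.overlap_lt he.2.1 _ (m.mem x hx) (by rw [m.mem_im_lt he hx]; exact h1) _
          (mem_im_mask.2 ⟨z, hz1.1, rfl⟩) fun u hu huz => ?_
        obtain ⟨j, hj, rfl⟩ := mem_im_mask.1 hu
        refine (m.row_yes (row_of_diff hj ?_)).2.2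
        by_contra q
        exact huz (by rw [(testBit_of_eq_sh h2 j).1 (by simpa using q)])
      exact ⟨(hlt.trans_le r1).le, fun _ => hlt.trans_le r1, r3⟩
    · exact absurd rfl h

theorem snd_opOC (S : Sys T adj Tight w) {k : Kont} (hk : Snd T adj Tight k)
    {n Y X nt t c : ℕ} (hn : n ≠ 0) (h : opOC k n Y X nt t c ≠ 0) {σ : ℕ → α}
    (m : Realizes T adj Tight n Y X t σ) : False := by
  rw [opOC, dig_eq, dig_eq] at h
  have hy := dig_lt (c := c / 2) hn
  generalize c / 2 % n = y at h hy
  rw [bt_eq] at h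
  split_ifs at h with h0
  · rw [dig_eq] at h
    exact lt_irrefl _ ((chain_spec S m _ _ _ hy h).2.1 (Nat.succ_ne_zero _))
  rw [dig_eq, dig_eq] at h
  have hz := dig_lt (c := c / 2 / n) hn
  generalize c / 2 / n % n = z at h hz
  obtain ⟨i, c', hi, h⟩ := getT_ne h
  have he := m.good i hi
  generalize row t i = e at h he
  simp only [force_eq, bt_eq, beq_iff, tb_eq] at h
  split_ifs at h with h1 h2
  · exact h rfl
  · set P := diff (mask e) (row Y y) with hP
    set x := Nat.log2 (Nat.xor P (sh z)) with hx
    have hPb : ∀ j, (xor (P.testBit j) (decide (z = j))) = decide (x = j) := by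
      intro j
      have := congrArg (Nat.testBit · j) h2
      simpa only [testBit_xor, testBit_sh] using this
    have hyK : σ y ∉ im σ (mask e) := by rw [m.mem_im_lt he hy]; exact h1
    have hPne : ¬ ∀ j, P.testBit j = false := by
      intro q
      obtain ⟨u, hu, q'⟩ := S.exists_not_adj he.2.1 (σ y) (m.mem y hy) hyK
      obtain ⟨j, hj, rfl⟩ := mem_im_mask.1 hu
      exact q' (m.row_yes (row_of_diff hj (q j))).2.2
    have hxz : x ≠ z := by
      intro q
      refine hPne fun j => ?_
      have := hPb j
      rw [q] at this
      cases r : P.testBit j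
      · rfl
      · rw [r] at this; cases r' : decide (z = j) <;> rw [r'] at this <;> simp at this
    have hPx : P.testBit x = true := by
      have := hPb x
      simpa [Ne.symm hxz] using this
    have hxK : (mask e).testBit x = true := by
      rw [hP, testBit_diff, Bool.and_eq_true] at hPx; exact hPx.1
    have hxn := he.1 _ hxK
    obtain ⟨-, r2, c₂, h⟩ := chain_spec S m _ _ _ hxn h
    have hyz := not_goN S hk m hy hz h
    refine lt_asymm (r2 (Nat.succ_ne_zero _)) (S.overlap_lt he.2.1 _ (m.mem y hy) hyK _
      (mem_im_mask.2 ⟨x, hxK, rfl⟩) fun u hu hux => ?_)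
    obtain ⟨j, hj, rfl⟩ := mem_im_mask.1 hu
    by_cases hjz : z = j
    · exact hjz ▸ hyz
    · refine (m.row_yes (row_of_diff hj ?_)).2.2
      have := hPb j
      have hjx : x ≠ j := fun q => hux (by rw [q])
      simpa [hjz, hjx] using this
  · exact h rfl

theorem stab_aux {X : ℕ} (f : ℕ) : ∀ M,
    loop (fun _ => false) (fun ih M => bt (Nat.beq M 0) true <|
      force (Nat.log2 M) fun b => force (Nat.xor M (sh b)) fun M =>
      bt (Nat.beq (diff M (row X b)) 0) (ih M) false) f M = true →
    ∀ i j, M.testBit i = true → M.testBit j = true → i ≠ j →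
      (row X i).testBit j = true ∨ (row X j).testBit i = true := by
  induction f with
  | zero => intro M h; exact absurd h Bool.false_ne_true
  | succ f ih =>
    intro M h i j hi hj hij
    rw [loop_succ] at h
    generalize loop _ _ f = L at ih h
    simp only [force_eq, bt_eq, beq_iff] at h
    split_ifs at h with h0 h1
    · simp [h0] at hi
    · have key : ∀ j, M.testBit j = true → j ≠ Nat.log2 M → (row X (Nat.log2 M)).testBit j = true := by
        intro j hj q
        refine row_of_diff (K := Nat.xor M (sh (Nat.log2 M))) ?_ (by rw [h1]; exact Nat.zero_testBit j)
        rw [testBit_peel h0, hj, decide_eq_true q]; rfl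
      by_cases hi' : i = Nat.log2 M
      · left; rw [hi']; exact key j hj (fun q => hij (hi'.trans q.symm))
      by_cases hj' : j = Nat.log2 M
      · right; rw [hj']; exact key i hi hi'
      exact ih _ h i j (by rw [testBit_peel h0, hi, decide_eq_true hi']; rfl)
        (by rw [testBit_peel h0, hj, decide_eq_true hj']; rfl) hij

theorem stab_spec {X I : ℕ} (h : stab X I = true) {i j : ℕ} (hi : I.testBit i = true)
    (hj : I.testBit j = true) (hij : i ≠ j) :
    (row X i).testBit j = true ∨ (row X j).testBit i = true :=
  stab_aux 13 I h i j hi hj hij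

end Soundness

section Soundness

variable {α : Type} [DecidableEq α] {T : Finset α} {adj : α → α → Prop} {Tight : Finset α → Prop}
  {w : α → ℝ}


theorem leaf1_ne {N : ℕ} {k : Kont} {n Y X nt t A s j c : ℕ}
    (h : leaf1 N k n Y X nt t A s j c ≠ 0) : c ≠ 0 ∧ (s + j ≤ 4 → 2 ≤ s + j → n + j ≤ N →
      push k (n + j) Y X nt t c (Nat.lor A (Nat.shiftLeft (sh j - 1) n)) (s + j) ≠ 0) := by
  simp only [leaf1, force_eq, bt_eq, beq_iff, ble_iff] at h
  split_ifs at h with h0 h1 h2 h3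
  · exact absurd rfl h
  · exact ⟨h0, fun _ _ _ => h⟩
  · exact ⟨h0, fun _ _ q => absurd q h3⟩
  · exact ⟨h0, fun _ q _ => absurd q h2⟩
  · exact ⟨h0, fun q _ _ => absurd q h1⟩

theorem leaf_ne {N : ℕ} {k : Kont} {n Y X nt t A s c : ℕ}
    (h : leaf N k n Y X nt t A s c ≠ 0) : c ≠ 0 ∧ ∀ j ≤ 4, ∃ c', leaf1 N k n Y X nt t A s j c' ≠ 0 := by
  simp only [leaf, force_eq] at h
  have h3 := (leaf1_ne h).1
  have h2 := (leaf1_ne h3).1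
  have h1 := (leaf1_ne h2).1
  have h0 := (leaf1_ne h1).1
  refine ⟨(leaf1_ne h0).1, fun j hj => ?_⟩
  interval_cases j
  exacts [⟨_, h0⟩, ⟨_, h1⟩, ⟨_, h2⟩, ⟨_, h3⟩, ⟨_, h⟩]

theorem enum_ne {N : ℕ} {k : Kont} {n Y X nt t : ℕ} (f : ℕ) : ∀ A s C c,
    enum N k n Y X nt t f A s C c ≠ 0 → c ≠ 0 := by
  cases f with
  | zero => intro A s C c h; exact absurd rfl h
  | succ f =>
    intro A s C c h
    rw [enum, loop_succ] at h
    generalize loop _ _ f = L at h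
    rw [bt_eq] at h
    split_ifs at h with h0
    · exact absurd rfl h
    · simpa using h0

theorem enum_spec {N : ℕ} {k : Kont} {n Y X nt t : ℕ} (f : ℕ) : ∀ A s C c,
    enum N k n Y X nt t f A s C c ≠ 0 → ∀ M : Finset ℕ, (∀ i ∈ M, C.testBit i = true) →
    (∀ i ∈ M, ∀ j ∈ M, i ≠ j → (row X i).testBit j = false) → s + M.card ≤ 4 →
    ∃ A' c', (∀ i, A'.testBit i = true ↔ A.testBit i = true ∨ i ∈ M) ∧
      leaf N k n Y X nt t A' (s + M.card) c' ≠ 0 := by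
  induction f with
  | zero => intro A s C c h; exact absurd rfl h
  | succ f ih =>
    intro A s C c h M hM hX hs
    rw [enum, loop_succ] at h
    have hne := enum_ne (N := N) (k := k) (n := n) (Y := Y) (X := X) (nt := nt) (t := t) f
    simp only [enum] at ih hne
    generalize loop _ _ f = L at h ih hne
    simp only [force_eq, bt_eq, beq_iff] at h
    split_ifs at h with h0 h1 h2
    · exact absurd rfl h
    · obtain rfl : M = ∅ := Finset.card_eq_zero.1 (by omega)
      exact ⟨A, c, by simp, by simpa using h⟩
    · obtain rfl : M = ∅ := Finset.eq_empty_of_forall_notMem fun i hi => by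
        have := hM i hi; simp [h2] at this
      exact ⟨A, c, by simp, by simpa using h⟩
    · by_cases hv : Nat.log2 C ∈ M
      · have hcard := Finset.card_erase_of_mem hv
        have hpos := Finset.card_pos.2 ⟨_, hv⟩
        obtain ⟨A', c', q, q'⟩ := ih _ _ _ _ h (M.erase (Nat.log2 C)) (fun i hi => by
          rw [Finset.mem_erase] at hi
          rw [testBit_diff, testBit_peel h2, hM i hi.2, decide_eq_true hi.1,
            hX _ hv _ hi.2 (Ne.symm hi.1)]; rfl) (fun i hi j hj =>
          hX i (Finset.mem_of_mem_erase hi) j (Finset.mem_of_mem_erase hj)) (by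
          rw [hcard]; change s + 1 + _ ≤ 4; omega)
        refine ⟨A', c', fun i => ?_, ?_⟩
        · rw [q, testBit_lor, testBit_sh, Bool.or_eq_true, decide_eq_true_eq, Finset.mem_erase]
          by_cases e : Nat.log2 C = i
          · subst e; simp [hv]
          · simp [e, Ne.symm e]
        · rw [hcard] at q'
          change leaf N k n Y X nt t A' (s + 1 + (M.card - 1)) c' ≠ 0 at q'
          rwa [show s + 1 + (M.card - 1) = s + M.card by omega] at q'
      · refine ih _ _ _ _ (hne _ _ _ _ h) M (fun i hi => ?_) hX hs
        have e : i ≠ Nat.log2 C := fun e => hv (e ▸ hi)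
        rw [testBit_peel h2, hM i hi, decide_eq_true e]; rfl

theorem Realizes.extend {n Y X t m : ℕ} {σ τ : ℕ → α} (r : Realizes T adj Tight n Y X t σ)
    (hm : n + m ≤ 12) (hτ : ∀ i < n, τ i = σ i)
    (inj : ∀ i < n + m, ∀ j < n + m, τ i = τ j → i = j) (mem : ∀ i < n + m, τ i ∈ T) :
    Realizes T adj Tight (n + m) Y X t τ where
  le := hm
  inj := inj
  mem := mem
  yes a b hb h := by
    obtain ⟨h1, h2, h3⟩ := r.yes a b hb h
    rw [hτ a h1, hτ b h2]
    exact ⟨by omega, by omega, h3⟩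
  no a b hb h := by
    obtain ⟨h1, h2, h3⟩ := r.no a b hb h
    rw [hτ a h1, hτ b h2]
    exact ⟨by omega, by omega, h3⟩
  good i hi := by
    have := r.good i hi
    have e : im τ (mask (row t i)) = im σ (mask (row t i)) :=
      Finset.image_congr fun j hj => hτ j (this.1 j (mem_bits_mask.1 hj))
    rw [Ent, e]
    exact ⟨fun j hj => (this.1 j hj).trans_le (Nat.le_add_right _ _), this.2⟩

theorem testBit_sh_sub_one (j i : ℕ) : (sh j - 1).testBit i = decide (i < j) := by
  rw [show sh j = 2 ^ j from Nat.one_shiftLeft j, Nat.testBit_two_pow_sub_one]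

theorem snd_opI (S : Sys T adj Tight w) {N : ℕ} (hT : T.card ≤ N) (hN : N ≤ 12) {k : Kont}
    (hk : Snd T adj Tight k) {n Y X nt t c : ℕ} (h : opI N k n Y X nt t c ≠ 0) {σ : ℕ → α}
    (m : Realizes T adj Tight n Y X t σ) : False := by
  rw [opI, force_eq, dig_eq] at h
  have hI : c % sh n < 2 ^ n := by
    rw [show sh n = 2 ^ n from Nat.one_shiftLeft n]
    exact Nat.mod_lt _ (by positivity)
  generalize c % sh n = I at h hI
  have hIn : ∀ i, I.testBit i = true → i < n := fun i hi => by
    by_contra q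
    rw [Nat.testBit_eq_false_of_lt (hI.trans_le (Nat.pow_le_pow_right (by norm_num) (not_lt.1 q)))] at hi
    exact Bool.false_ne_true hi
  rw [bt_eq, force_eq] at h
  split_ifs at h with h1
  swap
  · exact h rfl
  have hn12 := m.le
  obtain ⟨K, hK, hd⟩ := S.unsat (im σ I)
    (fun x hx => by obtain ⟨i, hi, rfl⟩ := mem_im.1 hx; exact m.mem i (hIn i hi.2))
    (fun x hx y hy => by
      obtain ⟨i, hi, rfl⟩ := mem_im.1 hx
      obtain ⟨j, hj, rfl⟩ := mem_im.1 hy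
      by_cases e : i = j
      · subst e; exact S.irrefl _
      · rcases stab_spec h1 hi.2 hj.2 e with q | q
        · exact (m.row_no q).2.2
        · exact fun q' => (m.row_no q).2.2 (S.symm q'))
  set M : Finset ℕ := (Finset.range n).filter fun i => σ i ∈ K with hM
  have hMn : ∀ i ∈ M, i < n := fun i hi => Finset.mem_range.1 (Finset.mem_filter.1 hi).1
  have hMK : ∀ i ∈ M, σ i ∈ K := fun i hi => (Finset.mem_filter.1 hi).2
  have hinjM : Set.InjOn σ M := fun i hi j hj => m.inj i (hMn i hi) j (hMn j hj)
  have hMsub : M.image σ ⊆ K := Finset.image_subset_iff.2 hMK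
  have hMcard : (M.image σ).card = M.card := Finset.card_image_of_injOn hinjM
  set E := K \ M.image σ with hE
  have hEcard : E.card + M.card = K.card := by
    rw [← hMcard]; exact Finset.card_sdiff_add_card_eq_card hMsub
  have hK4 := S.le_four hK
  have hK2 := S.two_le hK
  obtain ⟨A, c', hA, hl⟩ := enum_spec 14 0 0 _ _ h M (fun i hi => by
    have e : (Nat.sub (sh n) 1).testBit i = true :=
      (testBit_sh_sub_one n i).trans (decide_eq_true (hMn i hi))
    rw [testBit_xor, e]
    cases q : I.testBit i
    · rfl
    · exact absurd (hMK i hi) (Finset.disjoint_right.1 hd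
        (mem_im.2 ⟨i, ⟨(hMn i hi).trans_le hn12, q⟩, rfl⟩))) (fun i hi j hj hij => by
    by_contra q
    exact (m.row_no (by simpa using q)).2.2 (S.clique hK _ (hMK i hi) _ (hMK j hj)
      fun e => hij (hinjM hi hj e))) (by omega)
  obtain ⟨c'', hl⟩ := (leaf_ne hl).2 E.card (by omega)
  have hEσ : ∀ x ∈ E, ∀ i < n, σ i ≠ x := fun x hx i hi e => by
    rw [hE, Finset.mem_sdiff] at hx
    exact hx.2 (Finset.mem_image.2 ⟨i, Finset.mem_filter.2 ⟨Finset.mem_range.2 hi, e ▸ hx.1⟩, e⟩)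
  have hnE : n + E.card ≤ N := by
    refine le_trans ?_ hT
    have : ((Finset.range n).image σ).card = n := by
      rw [Finset.card_image_of_injOn, Finset.card_range]
      exact fun i hi j hj => m.inj i (by simpa using hi) j (by simpa using hj)
    rw [← this, ← Finset.card_union_of_disjoint]
    · refine Finset.card_le_card (Finset.union_subset ?_ ?_)
      · exact Finset.image_subset_iff.2 fun i hi => m.mem i (Finset.mem_range.1 hi)
      · exact Finset.sdiff_subset.trans (S.sub hK)
    · rw [Finset.disjoint_right]
      intro x hx q
      obtain ⟨i, hi, e⟩ := Finset.mem_image.1 q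
      exact hEσ x hx i (Finset.mem_range.1 hi) e
  have hp := (leaf1_ne hl).2 (by omega) (by omega) hnE
  let ε := E.equivFin.symm
  let τ : ℕ → α := fun i => if h : n ≤ i ∧ i - n < E.card then ε ⟨i - n, h.2⟩ else σ i
  have hτ : ∀ i < n, τ i = σ i := fun i hi => dif_neg (by omega)
  have hτE : ∀ i, n ≤ i → (q : i - n < E.card) → τ i = ε ⟨i - n, q⟩ := fun i hi q => dif_pos ⟨hi, q⟩
  have hτE' : ∀ i, n ≤ i → i < n + E.card → τ i ∈ E := fun i hi q => by
    rw [hτE i hi (by omega)]; exact (ε _).2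
  have hbits : ∀ i, (Nat.lor A (Nat.shiftLeft (sh E.card - 1) n)).testBit i = true ↔
      i ∈ M ∨ n ≤ i ∧ i < n + E.card := by
    intro i
    rw [testBit_lor, Bool.or_eq_true, hA]
    change _ ∨ ((sh E.card - 1) <<< n).testBit i = true ↔ _
    rw [Nat.testBit_shiftLeft, testBit_sh_sub_one]
    simp only [Nat.zero_testBit, Bool.false_eq_true, false_or, ge_iff_le, Bool.and_eq_true,
      decide_eq_true_eq]
    exact or_congr_right (and_congr_right fun _ => by omega)
  have him : im τ (Nat.lor A (Nat.shiftLeft (sh E.card - 1) n)) = K := by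
    ext x
    rw [mem_im]
    simp only [hbits]
    constructor
    · rintro ⟨i, ⟨-, hi | hi⟩, rfl⟩
      · rw [hτ i (hMn i hi)]; exact hMK i hi
      · exact (Finset.mem_sdiff.1 (hτE' i hi.1 hi.2)).1
    · intro hx
      by_cases hx' : x ∈ M.image σ
      · obtain ⟨i, hi, rfl⟩ := Finset.mem_image.1 hx'
        exact ⟨i, ⟨(hMn i hi).trans_le hn12, Or.inl hi⟩, hτ i (hMn i hi)⟩
      · have hxE : x ∈ E := Finset.mem_sdiff.2 ⟨hx, hx'⟩
        have hlt := (ε.symm ⟨x, hxE⟩).2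
        refine ⟨n + ε.symm ⟨x, hxE⟩, ⟨by omega, Or.inr ⟨by omega, by omega⟩⟩, ?_⟩
        rw [hτE _ (by omega) (by omega)]
        simp only [Nat.add_sub_cancel_left, Fin.eta, Equiv.apply_symm_apply]
  refine snd_push S hk hp (m.extend (hnE.trans hN) hτ ?_ ?_) ?_ (him.symm ▸ hK) ?_
  · intro i hi j hj e
    rcases lt_or_ge i n with h1 | h1 <;> rcases lt_or_ge j n with h2 | h2
    · exact m.inj i h1 j h2 (by rwa [hτ i h1, hτ j h2] at e)
    · exact absurd (by rw [← hτ i h1, e]) (hEσ _ (hτE' j h2 hj) i h1)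
    · exact absurd (by rw [← hτ j h2, e]) (hEσ _ (hτE' i h1 hi) j h2)
    · rw [hτE i h1 (by omega), hτE j h2 (by omega)] at e
      have := Fin.mk.inj (ε.injective (Subtype.ext e))
      omega
  · intro i hi
    rcases lt_or_ge i n with h1 | h1
    · rw [hτ i h1]; exact m.mem i h1
    · exact S.sub hK (Finset.mem_sdiff.1 (hτE' i h1 hi)).1
  · intro i hi
    rcases (hbits i).1 hi with q | q
    · have := hMn i q; omega
    · exact q.2
  · rw [him]; omega

end Soundness

section Soundness

variable {α : Type} [DecidableEq α] {T : Finset α} {adj : α → α → Prop} {Tight : Finset α → Prop}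
  {w : α → ℝ}


theorem cand_spec {W g : ℕ} (f : ℕ) : ∀ M C i,
    (loop (fun _ _ => 0) (fun ih M C => bt (Nat.beq M 0) C <|
      force (Nat.log2 M) fun b => force (Nat.xor M (sh b)) fun M =>
      force (Nat.land C (row W (sgd g b))) fun C => ih M C) f M C : ℕ).testBit i = true →
    C.testBit i = true ∧ ∀ b, M.testBit b = true → (row W (sgd g b)).testBit i = true := by
  induction f with
  | zero => intro M C i h; simp [loop_zero] at h
  | succ f ih =>
    intro M C i h
    rw [loop_succ] at h
    generalize loop _ _ f = L at ih h
    simp only [force_eq, bt_eq, beq_iff] at h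
    split_ifs at h with h0
    · exact ⟨h, fun b hb => by simp [h0] at hb⟩
    · obtain ⟨h1, h2⟩ := ih _ _ _ h
      rw [testBit_land, Bool.and_eq_true] at h1
      refine ⟨h1.1, fun b hb => ?_⟩
      by_cases e : b = Nat.log2 M
      · exact e ▸ h1.2
      · exact h2 b (by rw [testBit_peel h0, hb, decide_eq_true e]; rfl)

theorem le_log2_of_testBit {M i : ℕ} (h : M.testBit i = true) : i ≤ Nat.log2 M := by
  have h0 : M ≠ 0 := by rintro rfl; simp at h
  exact (Nat.le_log2 h0).2 (Nat.ge_two_pow_of_testBit h)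

theorem mapm_spec {g : ℕ} (f : ℕ) : ∀ M A i, (∀ b, M.testBit b = true → b < f) →
    ((loop (fun _ _ => 0) (fun ih M A => bt (Nat.beq M 0) A <|
      force (Nat.log2 M) fun b => force (Nat.xor M (sh b)) fun M =>
      force (Nat.lor A (sh (sgd g b))) fun A => ih M A) (f + 1) M A : ℕ).testBit i = true ↔
    A.testBit i = true ∨ ∃ b, M.testBit b = true ∧ sgd g b = i) := by
  induction f with
  | zero =>
    intro M A i h
    obtain rfl : M = 0 := eq_zero_of_bits fun i => by
      by_contra q
      exact absurd (h i (by simpa using q)) (by omega)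
    rw [loop_succ]
    simp [bt_eq]
  | succ f ih =>
    intro M A i h
    rw [loop_succ]
    generalize loop _ _ (f + 1) = L at ih ⊢
    simp only [force_eq, bt_eq, beq_iff]
    split_ifs with h0
    · simp [h0]
    · have hl := testBit_log2_self h0
      rw [ih]
      · rw [testBit_lor, testBit_sh, Bool.or_eq_true, decide_eq_true_eq, or_assoc]
        refine or_congr_right ⟨?_, ?_⟩
        · rintro (e | ⟨b, hb, e⟩)
          · exact ⟨_, hl, e⟩
          · rw [testBit_peel h0, Bool.and_eq_true] at hb
            exact ⟨b, hb.1, e⟩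
        · rintro ⟨b, hb, e⟩
          by_cases q : b = Nat.log2 M
          · exact Or.inl (q ▸ e)
          · exact Or.inr ⟨b, by rw [testBit_peel h0, hb, decide_eq_true q]; rfl, e⟩
      · intro b hb
        rw [testBit_peel h0, Bool.and_eq_true, decide_eq_true_eq] at hb
        have := le_log2_of_testBit hb.1
        have := h _ hl
        omega

theorem row_zero_eq (t : ℕ) : row t 0 = Nat.land t 65535 := rfl

theorem row_succ (t i : ℕ) : row t (i + 1) = row (Nat.shiftRight t 16) i := by
  change (t >>> (16 * (i + 1))) &&& _ = ((t >>> 16) >>> (16 * i)) &&& _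
  rw [mul_add, mul_one, add_comm (16 * i), Nat.shiftRight_add]

theorem row_of_zero (i : ℕ) : row 0 i = 0 := eq_zero_of_bits fun j => by simp [testBit_row]

theorem memT_spec {e : ℕ} (f : ℕ) : ∀ t, loop (fun _ => false) (fun ih T =>
    bt (Nat.beq T 0) false <| bt (Nat.beq (Nat.land T 65535) e) true <|
      force (Nat.shiftRight T 16) fun T => ih T) f t = true → ∃ i, row t i = e := by
  induction f with
  | zero => intro t h; exact absurd h Bool.false_ne_true
  | succ f ih =>
    intro t h
    rw [loop_succ] at h
    generalize loop _ _ f = L at ih h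
    simp only [force_eq, bt_eq, beq_iff] at h
    split_ifs at h with h0 h1
    · exact ⟨0, h1⟩
    · obtain ⟨i, hi⟩ := ih _ h
      exact ⟨i + 1, by rw [row_succ, hi]⟩

theorem allT_spec {t g : ℕ} (f : ℕ) : ∀ u, loop (fun _ => false) (fun ih U =>
    bt (Nat.beq U 0) true <| force (Nat.land U 65535) fun e =>
    force (mapm g (mask e) 0) fun A => force (Nat.add (Nat.mul (sz e) 4096) A) fun f =>
    bt (memT f t) (force (Nat.shiftRight U 16) fun U => ih U) false) f u = true →
    ∀ i, row u i ≠ 0 → ∃ j, row t j = sz (row u i) * 4096 + mapm g (mask (row u i)) 0 := by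
  induction f with
  | zero => intro t h; exact absurd h Bool.false_ne_true
  | succ f ih =>
    intro u h i hi
    rw [loop_succ] at h
    generalize loop _ _ f = L at ih h
    simp only [force_eq, bt_eq, beq_iff] at h
    split_ifs at h with h0 h1
    · exact absurd (h0 ▸ row_of_zero i) hi
    · rcases i with _ | i
      · exact memT_spec 20 t h1
      · rw [row_succ] at hi ⊢
        exact ih _ h i hi

theorem pick_ne {C c : ℕ} {k : ℕ → ℕ → ℕ} (h : pick C c k ≠ 0) :
    ∃ p c', C.testBit p = true ∧ k p c' ≠ 0 := by
  simp only [pick, force_eq, dig_eq, bt_eq, beq_iff, tb_eq] at h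
  split_ifs at h with h0 h1 h2
  · exact absurd rfl h
  · exact ⟨_, _, testBit_log2_self h0, h⟩
  · exact ⟨_, _, h2, h⟩
  · exact absurd rfl h

/-- The assignment `τ` satisfies the hypotheses of the packed lemma `r`. -/
structure Fits (T : Finset α) (adj : α → α → Prop) (Tight : Finset α → Prop) (r : ℕ) (τ : ℕ → α) :
    Prop where
  inj : ∀ i < row r 0, ∀ j < row r 0, τ i = τ j → i = j
  mem : ∀ i < row r 0, τ i ∈ T
  yes : ∀ a < row r 0, ∀ b < a, (row r (a + 1)).testBit b = true → adj (τ a) (τ b)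
  no : ∀ a < row r 0, ∀ b < a, (row r (a + 13)).testBit b = true → ¬ adj (τ a) (τ b)
  tight : ∀ i, row (Nat.shiftRight r 400) i ≠ 0 →
    Tight (im τ (mask (row (Nat.shiftRight r 400) i))) ∧
      sz (row (Nat.shiftRight r 400) i) = (im τ (mask (row (Nat.shiftRight r 400) i))).card

def slot (db i : ℕ) : ℕ :=
  Nat.land (Nat.shiftRight db (Nat.mul 640 i)) (Nat.sub (sh 640) 1)

/-- All lemmas stored in the database `db` hold. -/
def Valid (T : Finset α) (adj : α → α → Prop) (Tight : Finset α → Prop) (db : ℕ) : Prop :=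
  ∀ i, row (slot db i) 0 ≠ 0 → ∀ τ : ℕ → α, ¬ Fits T adj Tight (slot db i) τ

theorem sgd_eq (g b : ℕ) : sgd g b = g / 2 ^ (4 * b) % 16 := by
  change (g >>> (4 * b)) &&& (2 ^ 4 - 1) = _
  rw [Nat.and_two_pow_sub_one_eq_mod, Nat.shiftRight_eq_div_pow]

theorem sgd_add_of_lt {g p a b : ℕ} (hb : b < a) : sgd (g + p * 2 ^ (4 * a)) b = sgd g b := by
  rw [sgd_eq, sgd_eq, show 4 * a = 4 * b + (4 + 4 * (a - b - 1)) by omega, pow_add, ← mul_assoc,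
    mul_right_comm, mul_comm, Nat.add_mul_div_left _ _ (by positivity), pow_add]
  rw [show p * (2 ^ 4 * 2 ^ (4 * (a - b - 1))) = 16 * (p * 2 ^ (4 * (a - b - 1))) by ring,
    Nat.add_mul_mod_self_left]

theorem sgd_add_self {g p a : ℕ} (hg : g < 2 ^ (4 * a)) (hp : p < 16) :
    sgd (g + p * 2 ^ (4 * a)) a = p := by
  rw [sgd_eq, mul_comm, Nat.add_mul_div_left _ _ (by positivity), Nat.div_eq_of_lt hg, zero_add,
    Nat.mod_eq_of_lt hp]

theorem sgd_of_lt {g a b : ℕ} (hg : g < 2 ^ (4 * a)) (hb : a ≤ b) : sgd g b = 0 := by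
  rw [sgd_eq, Nat.div_eq_of_lt (hg.trans_le (Nat.pow_le_pow_right (by norm_num) (by omega)))]

/-- Invariant of the matching loop. -/
structure Part (adj : α → α → Prop) (σ : ℕ → α) (n r a F g : ℕ) : Prop where
  lt : g < 2 ^ (4 * a)
  free : ∀ i, F.testBit i = true → i < n
  pos : ∀ b < a, sgd g b < n ∧ F.testBit (sgd g b) = false
  inj : ∀ b < a, ∀ d < a, sgd g b = sgd g d → b = d
  yes : ∀ d < a, ∀ b < d, (row r (d + 1)).testBit b = true → adj (σ (sgd g d)) (σ (sgd g b))
  no : ∀ d < a, ∀ b < d, (row r (d + 13)).testBit b = true → ¬ adj (σ (sgd g d)) (σ (sgd g b))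

theorem mtch_spec (S : Sys T adj Tight w) {n Y X t r : ℕ} {σ : ℕ → α}
    (m : Realizes T adj Tight n Y X t σ) (f : ℕ) : ∀ a F g c, mtch Y X t r f a F g c ≠ 0 →
    Part adj σ n r a F g → ∃ F g, Part adj σ n r (a + f) F g ∧
      allT t g (Nat.shiftRight r 400) = true := by
  induction f with
  | zero =>
    intro a F g c h q
    simp only [mtch, loop_zero, bt_eq] at h
    split_ifs at h with h0
    · exact ⟨F, g, q, h0⟩
    · exact absurd rfl h
  | succ f ih =>
    intro a F g c h q
    rw [mtch, loop_succ] at h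
    simp only [mtch] at ih
    generalize loop _ _ f = L at ih h
    simp only [force_eq] at h
    obtain ⟨p, c', hp₀, h⟩ := pick_ne h
    obtain ⟨hp₁, hX⟩ := cand_spec 13 _ _ _ hp₀
    obtain ⟨hp, hY⟩ := cand_spec 13 _ _ _ hp₁
    have hmod : ∀ o b, b < a → (row r o).testBit b = true →
        (Nat.mod (row r o) (sh a)).testBit b = true := fun o b hb h => by
      rw [show sh a = 2 ^ a from Nat.one_shiftLeft a]
      change (row r o % 2 ^ a).testBit b = true
      rw [Nat.testBit_mod_two_pow, h, decide_eq_true hb]; rfl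
    have hpn := q.free p hp
    have hn := m.le
    have eg : Nat.add g (Nat.shiftLeft p (Nat.mul 4 a)) = g + p * 2 ^ (4 * a) :=
      congrArg (g + ·) (Nat.shiftLeft_eq p (4 * a))
    rw [eg] at h
    have e1 : ∀ b < a, sgd (g + p * 2 ^ (4 * a)) b = sgd g b := fun b hb => sgd_add_of_lt hb
    have e2 : sgd (g + p * 2 ^ (4 * a)) a = p := sgd_add_self q.lt (by omega)
    have hne : ∀ b < a, sgd g b ≠ p := fun b hb e => by
      have := (q.pos b hb).2; rw [e, hp] at this; exact Bool.false_ne_true this.symm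
    rw [show a + (f + 1) = a + 1 + f by omega]
    refine ih _ _ _ _ h ⟨?_, ?_, ?_, ?_, ?_, ?_⟩
    · rw [mul_add, pow_add]
      have := q.lt
      have : p * 2 ^ (4 * a) ≤ 15 * 2 ^ (4 * a) := Nat.mul_le_mul_right _ (by omega)
      omega
    · intro i hi
      rw [testBit_xor, testBit_sh] at hi
      by_cases e : p = i
      · exact e ▸ hpn
      · exact q.free i (by simpa [e] using hi)
    · intro b hb
      rw [testBit_xor, testBit_sh]
      rcases Nat.lt_succ_iff_lt_or_eq.1 hb with hb | rfl
      · rw [e1 b hb, (q.pos b hb).2]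
        exact ⟨(q.pos b hb).1, by simpa using (hne b hb).symm⟩
      · rw [e2, show F.testBit p = true from hp]; exact ⟨hpn, by simp⟩
    · intro b hb d hd
      rcases Nat.lt_succ_iff_lt_or_eq.1 hb with hb | rfl <;>
        rcases Nat.lt_succ_iff_lt_or_eq.1 hd with hd | rfl
      · rw [e1 b hb, e1 d hd]; exact q.inj b hb d hd
      · rw [e1 b hb, e2]; exact fun e => absurd e (hne b hb)
      · rw [e1 d hd, e2]; exact fun e => absurd e.symm (hne d hd)
      · exact fun _ => rfl
    · intro d hd b hb hbit
      rcases Nat.lt_succ_iff_lt_or_eq.1 hd with hd | rfl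
      · rw [e1 d hd, e1 b (hb.trans hd)]; exact q.yes d hd b hb hbit
      · rw [e1 b hb, e2]
        exact S.symm (m.row_yes (hY b (hmod _ b hb hbit))).2.2
    · intro d hd b hb hbit
      rcases Nat.lt_succ_iff_lt_or_eq.1 hd with hd | rfl
      · rw [e1 d hd, e1 b (hb.trans hd)]; exact q.no d hd b hb hbit
      · rw [e1 b hb, e2]
        exact fun q => (m.row_no (hX b (hmod _ b hb hbit))).2.2 (S.symm q)

theorem snd_opL (S : Sys T adj Tight w) {db : ℕ} (hdb : Valid T adj Tight db)
    {n Y X nt t c : ℕ} (hn : n ≠ 0) (h : opL db n Y X nt t c ≠ 0) {σ : ℕ → α}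
    (m : Realizes T adj Tight n Y X t σ) : False := by
  rw [opL] at h
  obtain ⟨j, -, c', e⟩ := (ans_eq _ _ _ _).resolve_left h
  rw [e, dig_eq] at h
  simp only [force_eq, bt_eq, beq_iff] at h
  generalize Nat.pred (Nat.add (sh j) (c' % sh j)) = i at h
  split_ifs at h with h0
  · exact h rfl
  change row (slot db i) 0 ≠ 0 at h0
  change mtch Y X t (slot db i) (row (slot db i) 0) 0 _ 0 _ ≠ 0 at h
  have hv := hdb _ h0
  generalize slot db i = r at h hv
  obtain ⟨F, g, q, hT⟩ := mtch_spec S m _ _ _ _ _ h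
    ⟨by simp, fun i hi => by
      rw [show Nat.sub (sh n) 1 = sh n - 1 from rfl, testBit_sh_sub_one] at hi; simpa using hi,
      by simp, by simp, by simp, by simp⟩
  rw [zero_add] at q
  have hpos : ∀ b, sgd g b < n := fun b => by
    by_cases hb : b < row r 0
    · exact (q.pos b hb).1
    · rw [sgd_of_lt q.lt (not_lt.1 hb)]; omega
  have hn12 := m.le
  refine hv (fun b => σ (sgd g b))
    ⟨fun i hi j hj e => q.inj i hi j hj (m.inj _ (hpos i) _ (hpos j) e),
      fun i _ => m.mem _ (hpos i), q.yes, q.no, fun i hi => ?_⟩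
  obtain ⟨j, hj⟩ := allT_spec 20 _ hT i hi
  generalize row (Nat.shiftRight r 400) i = e at hi hj ⊢
  have hA : ∀ i, (mapm g (mask e) 0).testBit i = true ↔
      ∃ b, (mask e).testBit b = true ∧ sgd g b = i := fun i => by
    rw [mapm, mapm_spec 12 _ _ _ (fun b hb => (mem_bits.1 (mem_bits_mask.2 hb)).1)]
    simp
  have hA12 : mapm g (mask e) 0 < 4096 := lt_of_bits (n := 12) fun i hi => by
    obtain ⟨b, -, rfl⟩ := (hA i).1 hi
    exact (hpos b).trans_le hn12
  have hne : row t j ≠ 0 := by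
    rw [hj]
    intro h
    refine hi (eq_zero_of_bits fun i => ?_)
    have h1 : sz e = 0 := by omega
    have h2 : mapm g (mask e) 0 = 0 := by omega
    by_contra q
    rw [Bool.not_eq_false] at q
    by_cases hi12 : i < 12
    · have := (hA (sgd g i)).2 ⟨i, by rw [testBit_mask, q, decide_eq_true hi12]; rfl, rfl⟩
      rw [h2] at this; simp at this
    · have : (sz e).testBit (i - 12) = true := by
        rw [show sz e = e >>> 12 from rfl, Nat.testBit_shiftRight, ← q]; congr 1; omega
      rw [h1] at this; simp at this
  have hE := m.good j hne
  rw [hj, Ent, mask_entry hA12, sz_entry hA12] at hE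
  have him : im σ (mapm g (mask e) 0) = im (fun b => σ (sgd g b)) (mask e) := by
    ext x
    rw [mem_im, mem_im_mask]
    simp only [hA]
    constructor
    · rintro ⟨_, ⟨-, b, hb, rfl⟩, rfl⟩; exact ⟨b, hb, rfl⟩
    · rintro ⟨b, hb, rfl⟩; exact ⟨_, ⟨(hpos b).trans_le hn12, b, hb, rfl⟩, rfl⟩
  rw [him] at hE
  exact hE.2

end Soundness

section Soundness

variable {α : Type} [DecidableEq α] {T : Finset α} {adj : α → α → Prop} {Tight : Finset α → Prop}
  {w : α → ℝ}


theorem findT_spec {σ : ℕ → α} {n x : ℕ} {k : ℕ → ℕ → ℕ} {t : ℕ} (hg : Good Tight σ n t)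
    (h : findT x k t ≠ 0) : ∃ e t', Ent Tight σ n e ∧ (mask e).testBit x = true ∧
      Good Tight σ n t' ∧ k (mask e) t' ≠ 0 := by
  rw [findT] at h
  generalize 20 = f at h
  induction f generalizing t with
  | zero => exact absurd rfl h
  | succ f ih =>
    rw [loop_succ] at h
    generalize loop _ _ f = L at ih h
    simp only [force_eq, bt_eq, beq_iff, tb_eq] at h
    have hg' : Good Tight σ n (Nat.shiftRight t 16) := fun i hi => by
      rw [← row_succ] at hi ⊢; exact hg _ hi
    split_ifs at h with h0 h1
    · exact absurd rfl h
    · refine ⟨row t 0, _, hg 0 fun q => ?_, h1, hg', h⟩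
      change (mask (row t 0)).testBit x = true at h1
      rw [q, testBit_mask] at h1; simp at h1
    · exact ih hg' h

theorem Ent.mask_eq {n Y X t : ℕ} {σ : ℕ → α} (m : Realizes T adj Tight n Y X t σ) {e f : ℕ}
    (he : Ent Tight σ n e) (hf : Ent Tight σ n f) (h : im σ (mask e) = im σ (mask f)) :
    mask e = mask f := by
  refine Nat.eq_of_testBit_eq fun i => ?_
  by_cases hi : i < n
  · rw [Bool.eq_iff_iff, ← m.mem_im_lt he hi, ← m.mem_im_lt hf hi, h]
  · rw [Bool.eq_iff_iff]
    exact ⟨fun q => absurd (he.1 i q) hi, fun q => absurd (hf.1 i q) hi⟩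

theorem im_lor {σ : ℕ → α} (K L : ℕ) : im σ (Nat.lor K L) = im σ K ∪ im σ L := by
  ext x
  simp only [mem_im, Finset.mem_union, testBit_lor, Bool.or_eq_true]
  constructor
  · rintro ⟨i, ⟨h, q | q⟩, e⟩
    exacts [Or.inl ⟨i, ⟨h, q⟩, e⟩, Or.inr ⟨i, ⟨h, q⟩, e⟩]
  · rintro (⟨i, ⟨h, q⟩, e⟩ | ⟨i, ⟨h, q⟩, e⟩)
    exacts [⟨i, ⟨h, Or.inl q⟩, e⟩, ⟨i, ⟨h, Or.inr q⟩, e⟩]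

theorem im_land {n Y X t : ℕ} {σ : ℕ → α} (m : Realizes T adj Tight n Y X t σ) {K L : ℕ}
    (hK : ∀ i, K.testBit i = true → i < n) (hL : ∀ i, L.testBit i = true → i < n) :
    im σ (Nat.land K L) = im σ K ∩ im σ L := by
  ext x
  simp only [mem_im, Finset.mem_inter, testBit_land, Bool.and_eq_true]
  constructor
  · rintro ⟨i, ⟨h, q, q'⟩, e⟩
    exact ⟨⟨i, ⟨h, q⟩, e⟩, ⟨i, ⟨h, q'⟩, e⟩⟩
  · rintro ⟨⟨i, ⟨h, q⟩, e⟩, ⟨j, ⟨h', q'⟩, e'⟩⟩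
    obtain rfl := m.inj i (hK i q) j (hL j q') (e.trans e'.symm)
    exact ⟨i, ⟨h, q, q'⟩, e⟩

theorem mem_im_iff {n Y X t : ℕ} {σ : ℕ → α} (m : Realizes T adj Tight n Y X t σ) {K i : ℕ}
    (hK : ∀ i, K.testBit i = true → i < n) (hi : i < n) :
    σ i ∈ im σ K ↔ K.testBit i = true := by
  rw [mem_im]
  refine ⟨fun ⟨j, hj, q⟩ => m.inj j (hK j hj.2) i hi q ▸ hj.2, fun h => ⟨i, ⟨?_, h⟩, rfl⟩⟩
  exact hi.trans_le m.le

theorem lor_lt {n K L : ℕ} (hK : ∀ i, K.testBit i = true → i < n)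
    (hL : ∀ i, L.testBit i = true → i < n) (i : ℕ) (h : (Nat.lor K L).testBit i = true) : i < n := by
  rw [testBit_lor, Bool.or_eq_true] at h
  exact h.elim (hK i) (hL i)

theorem snd_opB3 (B : BRules T adj Tight) {n Y X nt t c : ℕ} (h : opB3 n Y X nt t c ≠ 0)
    {σ : ℕ → α} (m : Realizes T adj Tight n Y X t σ) : False := by
  rw [opB3, dig_eq] at h
  obtain ⟨e₁, t₁, he₁, hx₁, hg, h⟩ := findT_spec m.good h
  obtain ⟨e₂, t₂, he₂, hx₂, hg, h⟩ := findT_spec hg h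
  obtain ⟨e₃, t₃, he₃, hx₃, hg, h⟩ := findT_spec hg h
  simp only [bt_eq, beq_iff] at h
  split_ifs at h with h1 h2 h3
  all_goals try exact h rfl
  rcases B.two_bases he₁.2.1 he₂.2.1 he₃.2.1 _ (mem_im_mask.2 ⟨_, hx₁, rfl⟩)
    (mem_im_mask.2 ⟨_, hx₂, rfl⟩) (mem_im_mask.2 ⟨_, hx₃, rfl⟩) with q | q | q
  exacts [h1 (he₁.mask_eq m he₂ q), h2 (he₂.mask_eq m he₃ q), h3 (he₁.mask_eq m he₃ q)]

theorem snd_opS1 (S : Sys T adj Tight w) (B : BRules T adj Tight) {k : Kont}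
    (hk : Snd T adj Tight k) {n Y X nt t c : ℕ} (hn : n ≠ 0) (h : opS1 k n Y X nt t c ≠ 0)
    {σ : ℕ → α} (m : Realizes T adj Tight n Y X t σ) : False := by
  rw [opS1, dig_eq, dig_eq] at h
  have hx := dig_lt (c := c) hn
  have hz := dig_lt (c := c / n) hn
  generalize c % n = x at h hx
  generalize c / n % n = z at h hz
  obtain ⟨e, t₁, he, -, hg, h⟩ := findT_spec m.good h
  obtain ⟨f, t₂, hf, -, -, h⟩ := findT_spec hg h
  have hzn : z < 16 := by have := m.le; omega
  simp only [bt_eq, beq_iff, tb_eq (Nat.lor _ _)] at h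
  split_ifs at h with h1 h2 h3
  all_goals try exact h rfl
  all_goals
    have hz' : σ z ∉ im σ (mask e) ∪ im σ (mask f) := by
      rw [← im_lor, mem_im_iff m (lor_lt he.1 hf.1) hz]; exact h2
    have hx' : im σ (mask e) ∩ im σ (mask f) = {σ x} := by
      rw [← im_land m he.1 hf.1, h1]
      ext y
      have := m.le
      simp only [mem_im, testBit_sh, decide_eq_true_eq, Finset.mem_singleton]
      exact ⟨fun ⟨i, ⟨_, q⟩, q'⟩ => by rw [← q', q], fun q => ⟨x, ⟨by omega, rfl⟩, q.symm⟩⟩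
  · exact hz' (B.single he.2.1 hf.2.1 _ hx' _ (m.mem z hz) (m.tb_yes hz h3).2.2)
  · exact hz' (B.single he.2.1 hf.2.1 _ hx' _ (m.mem z hz) (not_goN S hk m hx hz h))

theorem eq_sz_mask (e : ℕ) : e = sz e * 4096 + mask e := by
  change e = (e >>> 12) * 4096 + (e &&& (2 ^ 12 - 1))
  rw [Nat.and_two_pow_sub_one_eq_mod, Nat.shiftRight_eq_div_pow]
  omega

theorem opH_aux {n : ℕ} {σ : ℕ → α} {h c : ℕ}
    (f : ℕ) : ∀ t a s, Good Tight σ n t →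
    loop (fun _ _ _ => 0) (fun ih T a s => bt (Nat.ble h a) c <| bt (Nat.beq T 0) 0 <|
      force (Nat.land T 65535) fun e => force (Nat.shiftRight T 16) fun T =>
      bt (Nat.beq e 0) 0 <| bt (tb s e) (ih T a s) (force (Nat.lor s (sh e)) fun s =>
        force (Nat.add a (Nat.sub 4 (sz e))) fun a => ih T a s)) f t a s ≠ 0 →
    ∀ Q : Finset ℕ, (∀ e ∈ Q, s.testBit e = true ∧ Ent Tight σ n e) →
      ∑ e ∈ Q, (4 - sz e) = a →
      ∃ Q : Finset ℕ, (∀ e ∈ Q, Ent Tight σ n e) ∧ h ≤ ∑ e ∈ Q, (4 - sz e) := by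
  induction f with
  | zero => intro t a s _ h; exact absurd rfl h
  | succ f ih =>
    intro t a s hg hh Q hQ hsum
    rw [loop_succ] at hh
    generalize loop _ _ f = L at ih hh
    simp only [force_eq, bt_eq, beq_iff, ble_iff, tb_eq] at hh
    have hg' : Good Tight σ n (Nat.shiftRight t 16) := fun i hi => by
      rw [← row_succ] at hi ⊢; exact hg _ hi
    split_ifs at hh with h0 h1 h2 h3
    · exact ⟨Q, fun e he => (hQ e he).2, hsum ▸ h0⟩
    · exact absurd rfl hh
    · exact absurd rfl hh
    · exact ih _ _ _ hg' hh Q hQ hsum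
    · have hnew : row t 0 ∉ Q := fun q => h3 (hQ _ q).1
      refine ih _ _ _ hg' hh (insert (row t 0) Q) (fun e he => ?_) ?_
      · rw [testBit_lor, testBit_sh, Bool.or_eq_true, decide_eq_true_eq]
        rcases Finset.mem_insert.1 he with rfl | he
        · exact ⟨Or.inr rfl, hg 0 h2⟩
        · exact ⟨Or.inl (hQ e he).1, (hQ e he).2⟩
      · rw [Finset.sum_insert hnew, hsum, add_comm]; rfl

theorem snd_opH (B : BRules T adj Tight) {h : ℕ} (h6 : 6 < h) {n Y X nt t c : ℕ}
    (hh : opH h n Y X nt t c ≠ 0) {σ : ℕ → α} (m : Realizes T adj Tight n Y X t σ) : False := by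
  obtain ⟨Q, hQ, hle⟩ := opH_aux 20 t 0 0 m.good hh ∅ (by simp) (by simp)
  have hinj : Set.InjOn (fun e => im σ (mask e)) Q := fun e he f hf q => by
    rw [eq_sz_mask e, eq_sz_mask f, (hQ e he).2.2, (hQ f hf).2.2, (hQ e he).mask_eq m (hQ f hf) q]
  have := B.hidden (Q.image fun e => im σ (mask e)) (fun K hK => by
    obtain ⟨e, he, rfl⟩ := Finset.mem_image.1 hK
    exact (hQ e he).2.1)
  rw [Finset.sum_image hinj] at this
  have e : ∑ e ∈ Q, (4 - sz e) = ∑ e ∈ Q, (4 - (im σ (mask e)).card) :=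
    Finset.sum_congr rfl fun e he => by rw [(hQ e he).2.2]
  omega

theorem two_spec {P k : ℕ} (h : two P k ≠ 0) : k ≠ 0 ∧ ∃ a b, a ≠ b ∧
    ∀ i, P.testBit i = true ↔ i = a ∨ i = b := by
  simp only [two, force_eq, bt_eq, beq_iff] at h
  split_ifs at h with h0 h1 h2
  · exact absurd rfl h
  · exact absurd rfl h
  · refine ⟨h, Nat.log2 P, Nat.log2 (Nat.xor P (sh (Nat.log2 P))), fun e => ?_, fun i => ?_⟩
    · have := testBit_log2_self h1
      rw [testBit_peel h0, Bool.and_eq_true, decide_eq_true_eq] at this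
      exact this.2 e.symm
    · have := testBit_of_eq_sh h2 i
      rw [testBit_peel h0, Bool.and_eq_true, decide_eq_true_eq] at this
      rw [← this]
      by_cases e : i = Nat.log2 P
      · simp [e, testBit_log2_self h0]
      · simp [e]
  · exact absurd rfl h

theorem card_im_of_two {n Y X t : ℕ} {σ : ℕ → α} (m : Realizes T adj Tight n Y X t σ) {P a b : ℕ}
    (hP : ∀ i, P.testBit i = true → i < n) (hab : a ≠ b)
    (h : ∀ i, P.testBit i = true ↔ i = a ∨ i = b) : (im σ P).card = 2 := by
  have ha := hP a ((h a).2 (Or.inl rfl))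
  have hb := hP b ((h b).2 (Or.inr rfl))
  have hn := m.le
  rw [Finset.card_eq_two]
  refine ⟨σ a, σ b, fun e => hab (m.inj a ha b hb e), ?_⟩
  ext x
  simp only [mem_im, h, Finset.mem_insert, Finset.mem_singleton]
  constructor
  · rintro ⟨i, ⟨-, rfl | rfl⟩, rfl⟩ <;> simp
  · rintro (rfl | rfl)
    exacts [⟨a, ⟨by omega, Or.inl rfl⟩, rfl⟩, ⟨b, ⟨by omega, Or.inr rfl⟩, rfl⟩]

theorem land_lt {n K L : ℕ} (hK : ∀ i, K.testBit i = true → i < n) (i : ℕ)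
    (h : (Nat.land K L).testBit i = true) : i < n := by
  rw [testBit_land, Bool.and_eq_true] at h
  exact hK i h.1

theorem snd_opD2 (S : Sys T adj Tight w) (B : BRules T adj Tight) {k : Kont}
    (hk : Snd T adj Tight k) {n Y X nt t c : ℕ} (hn : n ≠ 0) (h : opD2 k n Y X nt t c ≠ 0)
    {σ : ℕ → α} (m : Realizes T adj Tight n Y X t σ) : False := by
  rw [opD2, dig_eq, dig_eq] at h
  have hx := dig_lt (c := c) hn
  have hz := dig_lt (c := c / n) hn
  generalize c % n = x at h hx
  generalize c / n % n = z at h hz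
  obtain ⟨e, t₁, he, hxe, hg, h⟩ := findT_spec m.good h
  obtain ⟨f, t₂, hf, hxf, -, h⟩ := findT_spec hg h
  obtain ⟨h, a, b, hab, h2⟩ := two_spec h
  rw [bt_eq] at h
  split at h
  · exact h rfl
  have hef : mask e ≠ mask f := fun q => ‹¬ _› ((beq_iff _ _).2 q)
  have hKL : im σ (mask e) ≠ im σ (mask f) := fun q => hef (he.mask_eq m hf q)
  have hcard : (im σ (mask e) ∩ im σ (mask f)).card = 2 := by
    rw [← im_land m he.1 hf.1]
    exact card_im_of_two m (land_lt he.1) hab h2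
  have hxx : σ x ∈ im σ (mask e) ∩ im σ (mask f) :=
    Finset.mem_inter.2 ⟨mem_im_mask.2 ⟨x, hxe, rfl⟩, mem_im_mask.2 ⟨x, hxf, rfl⟩⟩
  have hlor := lor_lt he.1 hf.1
  have hout : ∀ i < n, (Nat.lor (mask e) (mask f)).testBit i = false →
      σ i ∉ im σ (mask e) ∪ im σ (mask f) := fun i hi q => by
    rw [← im_lor, mem_im_iff m hlor hi, q]; exact Bool.false_ne_true
  have hE : ∀ i, (diff (row Y x) (Nat.lor (mask e) (mask f))).testBit i = true →
      adj (σ x) (σ i) ∧ i < n ∧ (Nat.lor (mask e) (mask f)).testBit i = false := fun i hi => by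
    rw [testBit_diff, Bool.and_eq_true] at hi
    have := m.row_yes hi.1
    exact ⟨this.2.2, this.2.1, by simpa using hi.2⟩
  have dbl : ∀ i j, i < n → j < n → adj (σ x) (σ i) → adj (σ x) (σ j) →
      (Nat.lor (mask e) (mask f)).testBit i = false →
      (Nat.lor (mask e) (mask f)).testBit j = false → i = j := fun i j hi hj h1 h2 h3 h4 =>
    m.inj i hi j hj (B.double he.2.1 hf.2.1 hKL hcard _ hxx _ (m.mem i hi) _ (m.mem j hj) h1 h2
      (hout i hi h3) (hout j hj h4))
  simp only [force_eq, bt_eq, beq_iff, tb_eq (Nat.lor _ _), testBit_lor (Nat.lor _ _)] at h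
  set E := diff (row Y x) (Nat.lor (mask e) (mask f)) with hEdef
  split_ifs at h with h0 h3 h4 h5
  all_goals try exact h rfl
  · have hu := hE _ (testBit_log2_self h0)
    have hne : Nat.xor E (sh (Nat.log2 E)) ≠ 0 := fun q => h4 (Nat.xor_eq_zero_iff.1 q)
    have hv := testBit_log2_self hne
    rw [testBit_peel h0, Bool.and_eq_true, decide_eq_true_eq] at hv
    have hv' := hE _ hv.1
    exact hv.2 (dbl _ _ hv'.2.1 hu.2.1 hv'.1 hu.1 hv'.2.2 hu.2.2)
  · have hu := hE _ (testBit_log2_self h0)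
    rw [Bool.not_eq_true, Bool.or_eq_false_iff] at h5
    have := dbl _ _ hz hu.2.1 (not_goN S hk m hx hz h) hu.1 h5.1 hu.2.2
    rw [this, testBit_log2_self h0] at h5
    exact Bool.false_ne_true h5.2.symm

theorem snd_opQ3 (B : BRules T adj Tight) {n Y X nt t c : ℕ} (h : opQ3 n Y X nt t c ≠ 0)
    {σ : ℕ → α} (m : Realizes T adj Tight n Y X t σ) : False := by
  obtain ⟨i, c₁, hi, h⟩ := getT_ne h
  have hb := m.good i hi
  obtain ⟨j, c₂, hj, h⟩ := getT_ne h
  have he := m.good j hj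
  obtain ⟨l, c₃, hl, h⟩ := getT_ne h
  have hf := m.good l hl
  generalize row t i = b at h hb
  generalize row t j = e at h he
  generalize row t l = f at h hf
  simp only [force_eq, bt_eq, beq_iff] at h
  split_ifs at h with h1 h2 h3 h4
  all_goals try exact h rfl
  obtain ⟨h, a₁, a₂, ha, ha'⟩ := two_spec h
  obtain ⟨-, b₁, b₂, hb₁, hb'⟩ := two_spec h
  refine B.quad hb.2.1 he.2.1 hf.2.1 (hb.2.2 ▸ h1) (he.2.2 ▸ h2) (hf.2.2 ▸ h3) ?_ ?_ ?_
  · rw [← im_lor]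
    intro x hx
    obtain ⟨i, hi, rfl⟩ := mem_im_mask.1 hx
    rw [mem_im_iff m (lor_lt he.1 hf.1) (hb.1 i hi)]
    have := congrArg (Nat.testBit · i) h4
    simp only [testBit_diff, hi, Nat.zero_testBit, Bool.true_and] at this
    rwa [Bool.not_eq_false'] at this
  · rw [← im_land m he.1 hb.1]
    exact card_im_of_two m (land_lt he.1) ha ha'
  · rw [← im_land m hf.1 hb.1]
    exact card_im_of_two m (land_lt hf.1) hb₁ hb'

theorem disjoint_im {n Y X t : ℕ} {σ : ℕ → α} (m : Realizes T adj Tight n Y X t σ) {K L : ℕ}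
    (hK : ∀ i, K.testBit i = true → i < n) (hL : ∀ i, L.testBit i = true → i < n)
    (h : Nat.land K L = 0) : Disjoint (im σ K) (im σ L) := by
  rw [Finset.disjoint_iff_inter_eq_empty, ← im_land m hK hL, h]
  simp [im, bits]

theorem sum_im_le_one (S : Sys T adj Tight w) {n Y X t A : ℕ} {σ : ℕ → α}
    (m : Realizes T adj Tight n Y X t σ) (hA : A < 2 ^ n) (h : stab Y A = true) :
    ∑ x ∈ im σ A, w x ≤ 1 := by
  have hlt : ∀ i, A.testBit i = true → i < n := fun i hi =>
    (Nat.pow_lt_pow_iff_right (by norm_num)).1 ((Nat.ge_two_pow_of_testBit hi).trans_lt hA)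
  refine S.clique_le _ (fun x hx => ?_) fun x hx y hy hxy => ?_
  · obtain ⟨i, hi, rfl⟩ := mem_im.1 hx
    exact m.mem i (hlt i hi.2)
  · obtain ⟨i, hi, rfl⟩ := mem_im.1 hx
    obtain ⟨j, hj, rfl⟩ := mem_im.1 hy
    rcases stab_spec h hi.2 hj.2 (fun e => hxy (by rw [e])) with q | q
    · exact (m.row_yes q).2.2
    · exact S.symm (m.row_yes q).2.2

theorem snd_opLP (S : Sys T adj Tight w) {n Y X nt t c : ℕ} (h : opLP n Y X nt t c ≠ 0)
    {σ : ℕ → α} (m : Realizes T adj Tight n Y X t σ) : False := by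
  rw [opLP, dig_eq, bt_eq] at h
  split_ifs at h with h0
  swap
  · exact h rfl
  obtain ⟨i₁, c₁, hi₁, h⟩ := getT_ne h
  have h₁ := m.good _ hi₁
  obtain ⟨i₂, c₂, hi₂, h⟩ := getT_ne h
  have h₂ := m.good _ hi₂
  obtain ⟨i₃, c₃, hi₃, h⟩ := getT_ne h
  have h₃ := m.good _ hi₃
  obtain ⟨i₄, c₄, hi₄, h⟩ := getT_ne h
  have h₄ := m.good _ hi₄
  generalize row t i₁ = e at h h₁
  generalize row t i₂ = f at h h₂
  generalize row t i₃ = g at h h₃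
  generalize row t i₄ = k at h h₄
  have hq : ∀ c, c % sh n < 2 ^ n := fun c => by
    rw [show sh n = 2 ^ n from Nat.one_shiftLeft n]
    exact Nat.mod_lt _ (by positivity)
  simp only [dig_eq, force_eq, bt_eq, beq_iff] at h
  have hA := hq c₄
  have hB := hq (c₄ / sh n)
  have hC := hq (c₄ / sh n / sh n)
  generalize c₄ % sh n = A at h hA
  generalize c₄ / sh n % sh n = B at h hB
  generalize c₄ / sh n / sh n % sh n = C at h hC
  split_ifs at h with h1 h2 h3 h4 h5 h6 h7
  all_goals try exact h rfl
  have d1 := disjoint_im m h₁.1 h₂.1 h1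
  have d2 := disjoint_im m h₃.1 h₄.1 h2
  have l1 := lor_lt h₁.1 h₂.1
  have l2 := lor_lt h₃.1 h₄.1
  have d3 := disjoint_im m l1 l2 h3
  have hsum : ∑ x ∈ im σ (Nat.lor (Nat.lor (mask e) (mask f)) (Nat.lor (mask g) (mask k))), w x = 4 := by
    rw [im_lor, Finset.sum_union d3, im_lor, im_lor, Finset.sum_union d1, Finset.sum_union d2,
      S.sum_eq h₁.2.1, S.sum_eq h₂.2.1, S.sum_eq h₃.2.1, S.sum_eq h₄.2.1]
    norm_num
  have hsub : im σ (Nat.lor (Nat.lor (mask e) (mask f)) (Nat.lor (mask g) (mask k))) ⊆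
      im σ A ∪ (im σ B ∪ im σ C) := by
    rw [← im_lor, ← im_lor]
    intro x hx
    obtain ⟨i, hi, rfl⟩ := mem_im.1 hx
    refine mem_im.2 ⟨i, ⟨hi.1, ?_⟩, rfl⟩
    have := congrArg (Nat.testBit · i) h4
    simp only [testBit_diff, hi.2, Nat.zero_testBit, Bool.true_and] at this
    rwa [Bool.not_eq_false'] at this
  have hun : ∀ P Q : Finset α, ∑ x ∈ P ∪ Q, w x ≤ ∑ x ∈ P, w x + ∑ x ∈ Q, w x := fun P Q => by
    rw [← Finset.sum_union_inter]
    exact le_add_of_nonneg_right (Finset.sum_nonneg fun x _ => S.nonneg x)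
  have := Finset.sum_le_sum_of_subset_of_nonneg hsub fun x _ _ => S.nonneg x
  have := hun (im σ A) (im σ B ∪ im σ C)
  have := hun (im σ B) (im σ C)
  have := sum_im_le_one S m hA h5
  have := sum_im_le_one S m hB h6
  have := sum_im_le_one S m hC h7
  linarith

end Soundness

section Soundness

variable {α : Type} [DecidableEq α] {T : Finset α} {adj : α → α → Prop} {Tight : Finset α → Prop}
  {w : α → ℝ}


theorem bt_ne_zero {b : Bool} {x y : ℕ} (h : bt b x y ≠ 0) :
    (b = true ∧ x ≠ 0) ∨ (¬ b = true ∧ y ≠ 0) := by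
  rw [bt_eq] at h
  split at h
  · exact Or.inl ⟨‹_›, h⟩
  · exact Or.inr ⟨‹_›, h⟩

theorem snd_attempt {st k : Kont} {o : ℕ → ℕ → ℕ → ℕ → ℕ} (hs : Snd T adj Tight st)
    (hk : Snd T adj Tight k) : Snd T adj Tight (attempt st o k) := by
  intro n Y X nt t c h
  simp only [attempt, force_eq, bt_eq, beq_iff] at h
  split_ifs at h with h1 h2
  · exact hk _ _ _ _ _ _ h
  · exact hk _ _ _ _ _ _ h
  · exact hs _ _ _ _ _ _ h2

theorem snd_stuck (S : Sys T adj Tight w) : Snd T adj Tight stuck := by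
  intro n Y X nt t c h σ m
  rcases bt_ne_zero h with ⟨-, h⟩ | ⟨e, h⟩
  · exact h rfl
  · exact snd_opO S (fun _ _ _ _ _ _ h => absurd rfl h) (by rwa [beq_iff] at e) h m

theorem snd_auto (S : Sys T adj Tight w) {ob hd : ℕ} (hB : ob = 8 ∨ BRules T adj Tight)
    (hd6 : 6 < hd) {k : Kont} (hk : Snd T adj Tight k) : Snd T adj Tight (auto ob hd k) := by
  refine snd_attempt (snd_stuck S) fun n Y X nt t c h => ?_
  rcases bt_ne_zero h with ⟨-, h⟩ | ⟨e, h⟩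
  · exact hk _ _ _ _ _ _ h
  · have B := hB.resolve_left (by rwa [beq_iff] at e)
    exact snd_attempt (fun _ _ _ _ _ _ h _ m => snd_opB3 B h m)
      (snd_attempt (fun _ _ _ _ _ _ h _ m => snd_opH B hd6 h m) hk) _ _ _ _ _ _ h

theorem snd_step (S : Sys T adj Tight w) {ob N hd db : ℕ} (hT : T.card ≤ N) (hN : N ≤ 12)
    (hB : ob = 8 ∨ BRules T adj Tight) (hd6 : 6 < hd) (hdb : Valid T adj Tight db) {k : Kont}
    (hk : Snd T adj Tight k) : Snd T adj Tight (step ob N hd db k) := by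
  intro n Y X nt t c h σ m
  rw [step] at h
  obtain ⟨o, ho, c', e⟩ := (ans_eq _ _ _ _).resolve_left h
  rw [e] at h
  have hA := snd_auto S hB hd6 hk
  have hB : 8 ≤ o → BRules T adj Tight := fun q => by
    rcases hB with rfl | hB
    · exact absurd ho (by omega)
    · exact hB
  rcases bt_ne_zero h with ⟨-, h⟩ | ⟨e6, h⟩
  · exact snd_opI S hT hN hA h m
  rcases bt_ne_zero h with ⟨-, h⟩ | ⟨e0, h⟩
  · exact h rfl
  rw [beq_iff] at e6 e0
  rcases bt_ne_zero h with ⟨e3, h⟩ | ⟨e3, h⟩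
  · rcases bt_ne_zero h with ⟨-, h⟩ | ⟨-, h⟩
    · exact snd_opO S hk e0 h m
    rcases bt_ne_zero h with ⟨-, h⟩ | ⟨-, h⟩
    · exact snd_opL S hdb e0 h m
    rcases bt_ne_zero h with ⟨-, h⟩ | ⟨-, h⟩
    · exact snd_opOC S hk e0 h m
    · exact snd_opE S hk e0 h m
  rw [ble_iff] at e3
  rcases bt_ne_zero h with ⟨-, h⟩ | ⟨e4, h⟩
  · exact snd_opM S hk e0 h m
  rcases bt_ne_zero h with ⟨-, h⟩ | ⟨e5, h⟩
  · exact snd_opD S hk e0 h m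
  rcases bt_ne_zero h with ⟨-, h⟩ | ⟨e7, h⟩
  · exact snd_opTQ S hk e0 h m
  rw [beq_iff] at e4 e5 e7
  have B := hB (by omega)
  rcases bt_ne_zero h with ⟨-, h⟩ | ⟨-, h⟩
  · exact snd_opS1 S B hk e0 h m
  rcases bt_ne_zero h with ⟨-, h⟩ | ⟨-, h⟩
  · exact snd_opD2 S B hk e0 h m
  rcases bt_ne_zero h with ⟨-, h⟩ | ⟨-, h⟩
  · exact snd_opQ3 B h m
  · exact snd_opLP S h m

theorem snd_run (S : Sys T adj Tight w) {ob N hd db : ℕ} (hT : T.card ≤ N) (hN : N ≤ 12)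
    (hB : ob = 8 ∨ BRules T adj Tight) (h6 : 6 < hd) (hdb : Valid T adj Tight db) (f : ℕ) :
    Snd T adj Tight (run ob N hd db f) := by
  induction f with
  | zero => intro n Y X nt t c h; exact absurd rfl h
  | succ f ih => exact snd_step S hT hN hB h6 hdb ih

theorem hdrT_eq {n : ℕ} {k : ℕ → ℕ → ℕ → ℕ} (f : ℕ) : ∀ Y t c,
    ∃ Y' t' c', hdrT n k f Y t c = k Y' t' c' := by
  induction f with
  | zero => intro Y t c; exact ⟨Y, t, c, rfl⟩
  | succ f ih =>
    intro Y t c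
    rw [hdrT, loop_succ]
    simp only [hdrT] at ih
    generalize loop _ _ f = L at ih ⊢
    simp only [force_eq, dig_eq]
    exact ih _ _ _

theorem hdrP_eq {n : ℕ} {k : ℕ → ℕ → ℕ → ℕ} (a b Y X c : ℕ) :
    hdrP n k a b Y X c = 0 ∨ ∃ Y' X' c', hdrP n k a b Y X c = k Y' X' c' := by
  rw [hdrP]
  generalize 200 = f
  induction f generalizing a b Y X c with
  | zero => exact Or.inl rfl
  | succ f ih =>
    rw [loop_succ]
    generalize loop _ _ f = L at ih ⊢
    rw [bt_eq, bt_eq]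
    split_ifs
    · exact Or.inr ⟨_, _, _, rfl⟩
    · rw [force_eq]; exact ih _ _ _ _ _
    rw [force_eq, bt_eq]
    split_ifs
    · exact ih _ _ _ _ _
    rcases ans_eq 3 90343 c _ with e | ⟨d, -, c', e⟩ <;> rw [e]
    · exact Or.inl rfl
    simp only [force_eq, bt_eq]
    split_ifs <;> exact ih _ _ _ _ _

theorem hdr_eq (c : ℕ) (k : ℕ → ℕ → ℕ → ℕ) : hdr c k = 0 ∨ ∃ r nt c', hdr c k = k r nt c' := by
  simp only [hdr, dig_eq]
  obtain ⟨Y, t, c', e⟩ := hdrT_eq (n := c % 12) (k := fun Y T c' => hdrP (c % 12) (fun Y X c' =>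
    force (Nat.lor (Nat.lor (c % 12) (Nat.shiftLeft Y 16))
      (Nat.lor (Nat.shiftLeft X 208) (Nat.shiftLeft T 400))) fun r => k r (c / 12 % 12) c') 0 0 Y 0 c')
    (c / 12 % 12) 0 0 (c / 12 / 12)
  rw [e]
  refine (hdrP_eq 0 0 Y 0 c').imp id fun ⟨Y', X', c'', e⟩ => ?_
  rw [e, force_eq]
  exact ⟨_, _, _, rfl⟩

theorem low_inner {a : ℕ} (f : ℕ) : ∀ M W i,
    (loop (fun _ W => W) (fun ih M W => bt (Nat.beq M 0) W <| force (Nat.log2 M) fun b =>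
      force (Nat.xor M (sh b)) fun M => force (addE W a b) fun W => ih M W) f M W).testBit i = true →
    W.testBit i = true ∨ ∃ b, M.testBit b = true ∧ (16 * a + b = i ∨ 16 * b + a = i) := by
  induction f with
  | zero => intro M W i h; exact Or.inl h
  | succ f ih =>
    intro M W i h
    rw [loop_succ] at h
    generalize loop _ _ f = L at ih h
    simp only [force_eq, bt_eq, beq_iff] at h
    split_ifs at h with h0
    · exact Or.inl h
    · rcases ih _ _ _ h with h | ⟨b, hb, h⟩
      · rw [testBit_addE] at h
        simp only [Bool.or_eq_true, decide_eq_true_eq] at h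
        exact h.imp id fun h => ⟨_, testBit_log2_self h0, h⟩
      · rw [testBit_peel h0, Bool.and_eq_true] at hb
        exact Or.inr ⟨b, hb.1, h⟩

theorem low_spec {r o : ℕ} (f : ℕ) : ∀ a W i, (low r o f a W).testBit i = true →
    W.testBit i = true ∨ ∃ d b, d < a + f ∧ b < d ∧ (row r (d + o)).testBit b = true ∧
      (16 * d + b = i ∨ 16 * b + d = i) := by
  induction f with
  | zero => intro a W i h; exact Or.inl h
  | succ f ih =>
    intro a W i h
    rw [low, loop_succ] at h
    simp only [low] at ih
    generalize loop _ _ f = L at ih h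
    rw [force_eq, force_eq, force_eq] at h
    rcases ih _ _ _ h with h | ⟨d, b, h1, h2⟩
    · refine (low_inner _ _ _ _ h).imp id fun ⟨b, hb, h⟩ => ?_
      rw [show sh a = 2 ^ a from Nat.one_shiftLeft a] at hb
      change (row r (a + o) % 2 ^ a).testBit b = true at hb
      rw [Nat.testBit_mod_two_pow, Bool.and_eq_true, decide_eq_true_eq] at hb
      exact ⟨a, b, by omega, hb.1, hb.2, h⟩
    · exact Or.inr ⟨d, b, by rw [Nat.succ_eq_add_one] at h1; omega, h2⟩

theorem lowT_spec {n t : ℕ} (h : lowT n t = true) (i j : ℕ)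
    (hj : (mask (row t i)).testBit j = true) : j < n := by
  rw [lowT] at h
  generalize 20 = f at h
  induction f generalizing t i with
  | zero => exact absurd h Bool.false_ne_true
  | succ f ih =>
    rw [loop_succ] at h
    generalize loop _ _ f = L at ih h
    simp only [force_eq, bt_eq, beq_iff] at h
    split_ifs at h with h0 h1
    · rw [h0, row_of_zero, testBit_mask] at hj; simp at hj
    · rcases i with _ | i
      · by_contra q
        rw [testBit_mask, testBit_row] at hj
        simp only [Bool.and_eq_true, decide_eq_true_eq, mul_zero, zero_add] at hj
        have : (mask t).testBit (n + (j - n)) = true := by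
          rw [testBit_mask, show n + (j - n) = j by omega]; simp [hj]
        rw [← Nat.testBit_shiftRight] at this
        rw [show mask t >>> n = 0 from h1] at this
        simp at this
      · rw [row_succ] at hj
        exact ih i hj h

theorem Fits.realizes (S : Sys T adj Tight w) {r : ℕ} {τ : ℕ → α} (h : Fits T adj Tight r τ)
    (hn : row r 0 ≤ 12) (hl : lowT (row r 0) (Nat.shiftRight r 400) = true) :
    Realizes T adj Tight (row r 0) (low r 1 (row r 0) 0 0) (low r 13 (row r 0) 0 0)
      (Nat.shiftRight r 400) τ where
  le := hn
  inj := h.inj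
  mem := h.mem
  yes a b hb q := by
    rcases low_spec _ _ _ _ q with q | ⟨d, e, h1, h2, h3, h4⟩
    · simp at q
    · rw [zero_add] at h1
      have := h.yes d h1 e h2 h3
      rcases h4 with h4 | h4
      · obtain rfl : d = a := by omega
        obtain rfl : e = b := by omega
        exact ⟨h1, h2.trans h1, this⟩
      · obtain rfl : e = a := by omega
        obtain rfl : d = b := by omega
        exact ⟨h2.trans h1, h1, S.symm this⟩
  no a b hb q := by
    rcases low_spec _ _ _ _ q with q | ⟨d, e, h1, h2, h3, h4⟩
    · simp at q
    · rw [zero_add] at h1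
      have := h.no d h1 e h2 h3
      rcases h4 with h4 | h4
      · obtain rfl : d = a := by omega
        obtain rfl : e = b := by omega
        exact ⟨h1, h2.trans h1, this⟩
      · obtain rfl : e = a := by omega
        obtain rfl : d = b := by omega
        exact ⟨h2.trans h1, h1, fun q => this (S.symm q)⟩
  good i hi := ⟨lowT_spec hl i, h.tight i hi⟩

theorem chk1_spec (S : Sys T adj Tight w) {ob N hd db : ℕ} (hT : T.card ≤ N) (hN : N ≤ 12)
    (hB : ob = 8 ∨ BRules T adj Tight) (h6 : 6 < hd) (hdb : Valid T adj Tight db) {r nt c : ℕ}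
    (hr : chk1 ob N hd db r nt c ≠ 0) (τ : ℕ → α) : ¬ Fits T adj Tight r τ := by
  intro q
  simp only [chk1, force_eq, bt_eq, ble_iff] at hr
  split_ifs at hr with h1 h2
  · exact snd_run S hT hN hB h6 hdb _ _ _ _ _ _ _ hr τ (q.realizes S h1 h2)
  · exact hr rfl
  · exact hr rfl

theorem addRec_shift_zero {db r k : ℕ} (hr : r < 2 ^ k) :
    Nat.land (Nat.shiftRight (Nat.add (Nat.mul db (sh k)) r) (Nat.mul k 0)) (Nat.sub (sh k) 1) = r := by
  rw [show sh k = 2 ^ k from Nat.one_shiftLeft k]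
  change ((db * 2 ^ k + r) >>> (k * 0)) &&& (2 ^ k - 1) = r
  rw [Nat.and_two_pow_sub_one_eq_mod, mul_zero, Nat.shiftRight_zero, mul_comm,
    Nat.mul_add_mod_self_left, Nat.mod_eq_of_lt hr]

theorem addRec_shift_succ {db r k : ℕ} (hr : r < 2 ^ k) (i : ℕ) :
    Nat.shiftRight (Nat.add (Nat.mul db (sh k)) r) (Nat.mul k (i + 1)) =
      Nat.shiftRight db (Nat.mul k i) := by
  rw [show sh k = 2 ^ k from Nat.one_shiftLeft k]
  change (db * 2 ^ k + r) >>> (k * (i + 1)) = db >>> (k * i)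
  rw [mul_add, mul_one, add_comm (k * i), Nat.shiftRight_add, Nat.shiftRight_eq_div_pow _ k,
    mul_comm db, Nat.mul_add_div (by positivity), Nat.div_eq_of_lt hr, add_zero]

theorem slot_addRec_zero {db r k : ℕ} (hk : k = 640) (hr : r < 2 ^ k) : slot (addRec db r) 0 = r := by
  rw [slot, addRec, ← hk, addRec_shift_zero hr]

theorem slot_addRec_succ {db r k : ℕ} (hk : k = 640) (hr : r < 2 ^ k) (i : ℕ) :
    slot (addRec db r) (i + 1) = slot db i := by
  rw [slot, slot, addRec, ← hk, addRec_shift_succ hr]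

theorem Valid.addRec {db r k : ℕ} (h : Valid T adj Tight db) (hk : k = 640) (hr : r < 2 ^ k)
    (hv : row r 0 ≠ 0 → ∀ τ : ℕ → α, ¬ Fits T adj Tight r τ) :
    Valid T adj Tight (addRec db r) := by
  rintro (_ | i)
  · rw [slot_addRec_zero hk hr]; exact hv
  · rw [slot_addRec_succ hk hr]; exact h i

theorem not_chks_of_valid (S : Sys T adj Tight w) {ob N hd z : ℕ} (hT : T.card ≤ N) (hN : N ≤ 12)
    (hB : ob = 8 ∨ BRules T adj Tight) (h6 : 6 < hd) (σ : ℕ → α) (l : List ℕ) (db : ℕ)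
    (hdb : Valid T adj Tight db) : chks ob N hd z l db ≠ true := by
  induction l generalizing db with
  | nil =>
    intro hc
    change Nat.blt 0 (run ob N hd db 1000 0 0 0 0 0 z) = true at hc
    generalize e : run ob N hd db 1000 0 0 0 0 0 z = v at hc
    refine snd_run S hT hN hB h6 hdb _ _ _ _ _ _ _ (e.trans_ne ?_) σ
      ⟨by omega, by omega, by omega, by simp, by simp, fun i hi => absurd (row_of_zero i) hi⟩
    rintro rfl
    exact absurd hc Bool.false_ne_true
  | cons c l ih =>
    intro hc
    change (force c fun c => force (hdr c fun r nt c => force (chk1 ob N hd db r nt c) fun x =>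
      bt (Nat.beq x 0) (sh 640) r) fun r => bt (Nat.ble (sh 640) r) false <|
        force (addRec db r) fun db => chks ob N hd z l db) = true at hc
    obtain ⟨k, hk⟩ : ∃ k, k = 640 := ⟨_, rfl⟩
    rw [force_eq, force_eq, ← hk] at hc
    generalize hr : hdr c _ = r at hc
    rw [force_eq, bt_eq] at hc
    split_ifs at hc with h0
    rw [ble_iff, not_le, show sh k = 2 ^ k from Nat.one_shiftLeft k] at h0
    refine ih _ (hdb.addRec hk h0 ?_) hc
    intro hr0
    rcases hdr_eq c fun r nt c => force (chk1 ob N hd db r nt c) fun x =>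
      bt (Nat.beq x 0) (sh k) r with e | ⟨r', nt, c', e⟩
    · rw [hr] at e
      exact absurd (e ▸ row_of_zero 0) hr0
    · rw [hr, force_eq, bt_eq] at e
      split_ifs at e with h1
      · rw [e, show sh k = 2 ^ k from Nat.one_shiftLeft k] at h0
        exact absurd h0 (lt_irrefl _)
      · subst e
        exact chk1_spec S hT hN hB h6 hdb (fun q => h1 (by rw [q]; rfl))

/-- A successful run of the checker excludes every system on at most `N` rays. -/
theorem not_chks (S : Sys T adj Tight w) {ob N hd z : ℕ} (hT : T.card ≤ N) (hN : N ≤ 12)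
    (hB : ob = 8 ∨ BRules T adj Tight) (h6 : 6 < hd) (l : List ℕ) :
    chks ob N hd z l 0 ≠ true := by
  obtain ⟨K, hK, -⟩ := S.unsat ∅ (by simp) (by simp)
  obtain ⟨x, -⟩ := Finset.card_pos.1 ((S.two_le hK).trans_lt' (by norm_num) : 0 < K.card)
  refine not_chks_of_valid S hT hN hB h6 (fun _ => x) l 0 fun i hi => ?_
  have : slot 0 i = 0 := eq_zero_of_bits fun j => by
    rw [slot, testBit_land]
    change ((0 >>> (640 * i)).testBit j && _) = false
    simp
  rw [this] at hi
  exact absurd (row_of_zero 0) hi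

end Soundness

def certA0 : List ℕ := [
8624672747190098820308799218483802811890897,
332247383536392260850828071291620757392401,
34872570781451699780783454988309939507076296869,
8034656448110174975873955626905892081896136286572733894429324311683080322980668457482464311452,
3175475945073720130535627180510685,
912259440644787622407670612688010930988577728863466454619023703549,
118306141652726818903573551271793337939383698359271414322245479934828725275583618526142756798878853202610327897223963290758552226863994868299022870491647999163793650021091253188324273273873975595840835546193411870930091462325778680429347653319775215307772949341847903023041769354079336908258154727804379288736021581353014327534797066125436,
2969736521210441445810228566780073,
80023366147773383780013172917740592009381,
89695665346842547855094314318036429007889,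
112912695442605491709941733097921592391112209,
41441688683816196035760632030054872001275014239284347051629643860228213376643163493930680456,
288464132150592291482326542193103013,
15886768897591663728899475084206499416145508541845958129378664548017474234298474431650705454405287682328,
355493133132233947856283214821732185077078361889596677147106430109739889105160175835453645201642337711177142760323653834445917828622667927782122908858536,
13595795908238850200759580897277637577167513802450241203551988572944939929456727912860617313786402041411155544083366446897320,
4668942418854628572913205408623160772626734393187690073672798874621038669653387432,
549355384130881880156060557469841,
430091984735682427237463001967550869329,
38287831015448083129117250188768023510101131803813268527439734034402969538692125367998632,
2443924274996764689507025622611226699250597090541874410943140332325903904401831941392002736250996927586492028344428786719172776,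
300193041273824749725,
6319996198013065214511107169412962101221937707388281868051831891188545603356681632124626140792297871875374466066594269197542169476299525190601254472163737907518918479289272964844763015657502774943035528684944656114561513580476386928815121545645068104073019794732007786665,
80968913651094491134650954387394992755670522760950307192704329149762011819679698255193838672043613273524211167217982032199835830699600906626891417901117029132905341351069323538884911121895424866260868508044916570105206086277990007210445101414126960457239669894296893261587586405692103813131130941175768139488662787860503763682788991865590540411,
80023391490350556667526550938871110406309,
373119918956674223556126790216449520839418660585881132002359787637392936,
10206144511027602429083914472315770887462448154702872411819564887114557852509736,
51601386966724381827393831784314047772503034209877651365062480990999146345,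
67262471527833838056802903695314705723673,
5513276424137327658601878427994883429226423522110146125586576222221210563553988233567776684384630447944139215779049297550966329256697186639120910055982414191286057224818260215225019170143636318623631948524331700561183250851068882942773354861234135400966903118779046973715581882928782032091727611306470637766411663614822183082251,
212231996240936222869066129840142288077624523854534149570523943167628068001960,
17073146587740371600382861270834935130505519704964922989006225310991787245089037,
212711552543019514210473,
21630404813602193899258869163051814623260487172307224010825363166334089803542765957777577,
3438996472504578487711775541424224795190246138814780021392788989025683625,
1356014993734993848825800259756551117826146235948129923257127699274236806765211702398413739307175488245509296663062973484618938010205577371,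
39642214463777906661030775742138952053547542450611390942437179093490592744720238217537705,
47145062248296285321683705804675940818707121221236055292529225662680456880957911653360501783181590970671818960638341933962547914628513524096626905336020117959012766157727804257243416547339393044635,
108134784108148711869393274704794879912650821979824448601310401078357601648930731179414395831326216919866931740493340650170637319552684289615509226381027450337600795652649229,
25635147316864231581,
4929948461667014635993709212319209195527974526066796032931410201,
1737059733327262872904461688628895597664469959331626912224063006196113708950169397202473289148444745962680937356283657123517468266178824728285116024897899611876383458825228118616307728059245057646386595857081003488696022596442473596758110237237538283208495416925937588669049738099106953275544605253787035761560392178271303328866572,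
1214495688333989770351300622438572431150571724462010519341382718482965747911944459107710484888137150738657084285028084766011666324835758317306282029901443288084554901707823260,
1221570056527377699225252037850173074689422165119797489474501884761535823152199429683768356125252380572940245278099613,
9574905430576058305045660639949684508281415670139037,
3186199384293057700668387235645801457851287861161611894241248562303468497065072368116086136771486114698677225425059264276122599750504321257745687080155187357,
224174881537688559871817250110671005,
243143536785351630140108149786166513554653774197889908390433475845324609499418867477612350937788753994183883979798645613854901756486517307216319739805091992197890347029534871580900334187203313883656729940266076711853567946202515366880765523091347495364240405163753572509,
7215324134232741792632288512762662143456362225009187519135655139227423345818353132353699817611805315777996061008732887289409088999061909797613467322873117318747329107903291879439337981029997784255796650792871921600298168537694784175966365,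
2685917766275983852401751155274302603370927842175837521429799160468729015337,
233646870874786312783419717359708462217880473101357069451723526095603989023358040338062569,
9131759317611361537492762992797478275319972610726764501783362897356895006175015796005601986940460677854673476638348417235495759034249238897382369029491446932937228847417123711847766687744716777487087387046333981389548681053811742762595741665932207280384460182889023644,
208874292868327569576990898607261183120308380103820215568239069465245287836519048302738333740887725035131096065493148,
64519698952136494674567112815420536514724735058432155057427354281298950789555152467445903881940540679909023452650662180325911811056701273496250075292,
176598505559937326463394566155957006233193822208145485189392403246067287759062796113322686109836785608375261523431526386556788429452961069562422314710405737073113642126,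
140644361425404008260121848852956082366460895652631259045159949542077946748199320104368949167942076288126813,
1437438330792091624049211699132984579661331437184367575972823309620431572256632797916677940090011145,
8877159157565188797949865584833099875324350856692086817441437763352598844221982926808117325313007101,
5744811383291091227472582120794068939121835610335278827481529525990291594327187885193661482049520783892318460249468209459907957886431125414889496772009222613092491399031674257998575288746916380669181416996799538914604370077033623204139812909501661184877157821169542321893817404916785670990935185989033795972022719016134491842001522654286882259557948816962333528687978870872922763586429655656320027387098649107846491117745602696395899383897948,
329036486621365182607111532501005234473129,
209341986109339688606458234509386127015648604729765757344300833,
3157861455083179081017924474912233197826229061811229850367624966685509559647248292511027501396706321777473403654958921108828095681688879749378943383846481080916709471304934958889098375724361357618441137920987979112714047481331176,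
7172012342564133853149,
23739965972404094280736701,
550708562138478536892240383022420388366927258650158779692652501510370037225,
3659761422266229765715889306602012316116050706260352770340605640629165805500902365065336945997778409,
519891154618928452535185361910276500976714638819446360512357997379678983344448291226803447327521818827094893919489807227167192600725226695498500005005726682898345074073340,
786443021339335078542110396,
287444670203827620868271464137,
9650683723908184549014441675775224799127648373,
608310098561727794947533560145706125269770235703600622510812637637683793355350521066475205297574891222665777239478341937321,
6565759211894356532598119609207025731372466571371713173172883015067492112351133287108458778468941824467693676548721115089938882082370623944961101211591161877539636563411244217293909948,
142520005393925555352211048532154684898113827301380518535408491142676480325767022285115894925868122777117136911115249328073,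
335828833572399222210522588602804613327544486549822332917662372877453184885615284500693357699895911841825683100109233859578760957152987120087793434996558833610877,
879248796019308219771057676221,
1865681794877412536369618877,
8592745888232784376961769405,
38258341899789503564800017010756802230547748535312041537328726834444160504593305499343320927625551145031270467865916998694700720844893764261088541,
67450881371788756686142154781,
10351538569035705461685680444847300887939550651203861719321568939757820536861,
28623868396692245049417754653,
49608164325298370317060945437,
97113613273021809253930720860076927725405,
13836567693147998092424849565,
4735364863878931954331134404765,
5024216060877568517069713245,
12861980594251000582143941449291577726171867160628726317555221077439029089766786654210883762383729220553171412565031903434773496117431942237605502815989230740658362056554763873355397674477687760898507608327070334585750299829607276752666163865106015925949909697214490546399962549695967385586316109926543,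
511368234266959105260949237044523173,
287244248875467450753287649302343271549398461928004870345668060686516,
99602636772145832531415365584078951323516698514563669313500171847757594499252,
1052457135859966945437,
475386460329857663192778948257750434678713290889665023337892516227620541612907566999733,
318625418071808508929085672737975815544894680865414025418745611354521796060891384172499549645321212071,
447123890153153481156777,
364506047847287003461866699800323169883896653399127170208073776758704309,
61024382554899495041667510290662908316046904323950625245365,
75628145220060575500248350591099022155417781,
6161657086609018076048958831500588551020543787305962544939621844588248047080933603151288621752604839,
40910643796117958440320247977,
81909528575731670393587969514335847695572748841780798655659220858423184468137]

def certA1 : List ℕ := [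
310818356883383324554663948986537,
1447554710157009705790112625385019877659526845861599446214483414020594679683940182100149,
18130275637570515662049081434034416350940127661279651150229060946648210976220057564480547176205097756541238681673060317423723367450262817337708711,
1277172901219694641567847798158546969442202893149552709976997094090010599512602536013151276569391060746654639770883433397911324399472845411689545215338810055678515667103605452373327129819523008979179280552,
13196085399208282797619291112213078079583957787047145751715067656185501796533,
2709443332616049923496015874084461714874540276788101969256730858865364890762693829790715365484228757,
6237438164302239300328628818214190075440822110632541608904239285,
60232049436589119278878802782974669583846069978604672209954731678390026108826944150690295356532575247098601696655823366643587162171214829419003990495497988121852308088100758675309907907076561064,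
2858696305258325745665131696209234259633392013293,
4804027062233902987311292392387671355882428943128526743488973342999004023050221,
364424810013695510060142101368170496439850031478334273039662980741021115673157871615897033201245321672095791084311623289182124137317463050576854909856452781547784463961105895446088164222404281556751957825113756527153154546598158502057,
1561642209755689521575728089147541717025620743922383495501324434614961213767036416159171628071790055264100379048862589085380180549063890175563250024941706369829292705961,
24587852788012255113798245268310477412052746409053631035923470256529990412208102219940662047203077992916945065,
14301590537916189493153864916814415410604016442258722858134518211645520318269326905846122099084051859880581071352543062185,
120252137888041453384418317146867599529,
5527088948559446087152740227580676428204156321737729468927983076227054625389912801518946893801201250803338936118830922601866069589349057398953,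
1654856452629475819453451443295483155482374973885269078982270740553699755075697159884085,
36906599427271861201575425533449869329972037250512509154282368515388140116781237,
27335562991773955457798520615353301890228349296539743386061391159580024220981,
388858460399409234136287994515661241309966632390240437,
2054728599605044288970297634017319299794470118775912349548735717709646637351583992197171043503994474250717291998891263825557422187966001491550649631091966470102002663428112304975958113194813625793325122862994768082859252632520537490634038821065418598175806162523657789942321399634216395116770559474682949234649993068835867896074545556966468304106204571242580136,
284346580342197836954435139176961635929785356993637027311933555598170605053713138875596986550656374747074087436503744409323258808133226685961573328756448689004818442413549752060521031080939488233436080760306931415120491290530897615396737745906678157518580574949024162927403582736354989799741942583331628590490738537510548261032,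
1540900131529608263471927852754708835397016984342351005877125792558402771270684334666032973224069288,
4213934047079332995036736184306332806876753549166636553479308291357753087935089485975638276477283477150341978863835930933719281348762,
10055629765063288977,
5602103059313141480226793993098937685232684564785946292128288723445929,
76943782174747077739543034211058316296233836054709,
214543290484131260364273769344390004538670610743008558892070623363591980376467522559986214957395132055449946491965665708831164230536309352496470888615,
54190165295735321711028381,
84701397890174938866491787412825211969829085469473093976072285727262607541,
26858555778947773948974403249798874186357246133,
2300176349442636305724744076906892311678078058870558985966625366370554234719784828895270089075606113014344312999,
7235184805131088253366739043878321509394638537645989083168890416703838812871727566212835693626806422329505899779287815964960327367640012922156941749315718646155476237437602809911464,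
13550457130261283989749568007017633837889056185390821435311671560373,
21787918911708455422172240101593267407614329497781,
71262665728469929208165870432929711370494902542462338776453395734589377520350310845424117692247848235622643225359704597820032366176751643317946252393338414962856,
13508628008445478161346563045647891939750022032175433845576793976156948661,
96788785607380197600435237497965311534464429482114736203520510133,
52409364303401969705842529488335064761955536183121694068415823865031353202901359287270997395998542352030039120158536807691236395176,
434799356429273152204167333639218079351782267094179920310774505,
3131207158052976240604096186416744174162822487102490793,
13745978484638199464308516135134038630258119994087517309782160268908522486118407091817922640344941049499510059083489213779901219488198694351763489582491817,
643323186580579072800111105,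
813633328608744742899096075067716921205290586574954394848778398473659565749702649192886120031206190352095293872206654508019630404530051484345608139318872381982151111592379105606113902637932943545141465799602544626250660428669094022076653961971833147193008501748820793497768,
43194727835224551306635710734723964252621501895311326893941023160725376926476596415813669009977785862769259797429690324282059295898,
407990718482440726250897310251251588335310333623534555285,
72749795336628531745839561297106800448982784457341132137346505465511913964798109282000396061320165427246241833462464950734690525870570195493593307608300905853382427833094458276295231916200,
4401650573585238326230560294568901303150659146443506804917,
47684547880506748534169363689691006220950946815292352637109,
16693045354725947999651973,
264150784896562461842426350987960524575895770357572593287562722067491176752443541,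
4195396123116588295220364936404236766277510405001843323179644577973,
966423739852732617885867782169973926203099836803107700037356628149,
78203199702024612268530142662868375250371284329871869945988967665527751258056385916258066741512934770468711002477540468149830757345871166575605195457042600,
327825935372043470211777832600660084161,
31252739172134810521203779559489213826497,
44720031044613809474333057983102141950019761,
112506001292315985552825282954946321271489985,
2404056859393960850710697970358231500225,
302870997064837617398080751223600791776605003983438095534257,
50561516611385229745151015138623648121693361,
537802529030858278256630638077643413836957224353,
3831129342889331756388727011846178311134534905146361916707798967760333,
539479291613001743261356121175039537813493796681131119268385447101355767533,
194455463063664373777191785585278784742180825466194556925037582767580071678524503789,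
30059488466805806495611124526543615734565502499138226796564317,
799852253408429202593006549469443363406260225159034500817883203741,
205454297947592992127709141288961335425809219863465063543950761955048660418029598374542042043848643862757714253523202030646471082876169279931133701619773209072044716700096453216739157224013372799031399389030447463762701182430875580664467005534023662098932798958317045929,
2038932541019096736679405103713332821998546814384280852869567854737560152921196493144423971594267979813450534126715982706903424111990474437518572528138870617785993385,
4537583668769363329500451315606994173641964581931933776319208468778823097268880195958494854655000202649168185690320973988140541051739569410193459369,
7518412105081724315413133139929994722183081636599902333,
7733605320861310954578183623564113528676945613,
10906744883906075760154374647022293296633217074776716187546829228707515378843991372738433478724372231498723552019218542661576563456310335131368505835426119064143898700590969611892390918953080667815759576517341780677219772151246791600165375288158501107791478888793734588404970528708559270152899382890079757489699314369675799008873325218753739198744,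
4250295564185833030618133718372946970372164297267108318487285862864498196244558987840271455670364738901435611076044771364698747774245600239163619292533221093026223550063252050200,
185387209366492216273081604710550553157189128713765984373,
103938069247327744031828327102259742681106439111744319469820983839324132813889654209236212121084966774798177620119215284786524709469952011410184129968778003128156755526885261785959461683166054312100868054450609871004740510245282242335000,
18112545006498425985526162392546831711244530813253869201212118938672185428029061936730833882945939072678780305893899518049412504440013755054234,
307143218025866340810989122629797901,
419213308175820411451350424299230948973,
123857145558689681062452635734982775962300673028348864030835700654479847428668911808269238981706265893848231792221,
41373268309447177585977845728500146411806863961432342073404456177727857186390075621041454852018730375697012916747662315923482586582877,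
16509039682621690407643534140654426273061826013,
63183138013945235888783621194423320196548174547855678232556181536716818749160922996206352356084419775546571692423588012241952913420017537037726591477116381,
2907470332934570965716365338037700054057,
3031897584843891156834673066018151637235082083383802623474847632717408376341342615525720013145408840094748142830588416482616084263163922241053794316076456581956922845,
23057756030590725985416824091359622685220627461843443498842296153203825064643115270490561899393953687865020820691811343930793173553547526075637608644362690502902931135709,
1356033168432405068746922588533187987445004675113,
899604886019782383498982285751549820376818127473917912042675542278676482713229715289040839794929419126247341277653067201744889174759433948354476439530244246377543612960605,
89423074941262778393992269949505373,
441234380053341323603896722232491964591228333353,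
61499076451876469129945043673726794686647047148175415280696114841778744516784569363692962103156517283567742696853173464712936531986830511197466767982778865645453451819022496789144544243701392574621,
194709222245625539694569347522463901,
42637661165142761837170987298952426329514592554428694309593827615576799333622405918915770466414403327031356365486682784995296177474418856,
12916200483024037964825332387932016268907088801209616053964577769913986051716629466212815344945607233035745853657,
105073400869190573854140927958590728430501949094001545021558229228516497340085112696308605590290953678205708546155966585426116640416384521357978900539560,
106659461407971337556468174005953661315564818888773432227286857540908908204974352056622886737178089307982596331360060845742455333422857137663980459624273171433116221855940744,
2737426617458289005333676121792602006823965760288692648028341,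
94239805757202336732576220927498755325249604201602385095068075074407053099480069488647910124314998902934950062686213790706333362952429492538429979522884899094664,
6159697151715231177609558091260516580788927826100473309365,
6885087008466246428808229057811546233528148015784919351468925476760490318997953209009553554162459486393159146936524310777483820831845057448997859504082111388588200]

def certA2 : List ℕ := [
1224471587407391364845592767888791901873673307762429353567017045299858401555122316953379525178640127501086993157995162042570642293214026331682505678158938330483884796073,
107383028933163746829809630923794278052166370510861455670923237597083305655652592147951790249,
2712778392946369046141685405821097,
2165622085326839293732828514060039043688617,
26410199748118669830311182534979177812745265057,
268375352567732566434937099622808609,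
1319837403810931614694669608825652643608194453382883069744542978029,
8440836517413868234891009466072205878033868497835889266320991125957112492745008934850541,
13264310575882663788335845502586153,
7480959118943383286107226129796393,
103115270682267846363708653536640597814785180948312500581897152105498065358475563787769419325312936723644112071756521422539468400809,
1143682344206052343525774796016562044374337,
1940587232871710688600436277577885,
10654232965027580767366575944644851709545761830491877900529283982242014464712518689275656194198825,
73085772190291122822062609236630239684037929,
7480959118943383671204460724456745,
15632629087062267181385835938386044354721018679742726344495864463674550989639771705478804515488532351145,
2560790290824437424197891606697,
107068277265285703691312333810876597196749497066568123742069525364114559505790753180791906648406293073686785254577192354122258242311061674168385649072019624,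
1461332216128856286233651906725362310017514696083601343738511102966639910025700310754034758261299412956037372371453324654593019447957441507632318633,
3900636163619824514461978645413784092379305,
1399028066532719403266185071386920188199506234501355088832394234470407534113515738668773984425,
12989742478964011027830695880873,
2436130292433156732683347525957573013104498016914244655042197723126502572004981492439424619061116627313601928769801339565605707826086250665,
35974725267998198532531803555997,
1161165077081772710499498528107679727671346680691656873,
63599301800976411001265932292953842279215182837423402135517312854185,
7305417684043910312042959505696937,
9388080513463088737261607198222505,
548506138835563859906978955685188503063608522438990500471132471973995852077481747282508753337148845895990597561579855063025382072871442597118775571996348075455030536855021721716639180822544900549099870381696624800978252810643020765178944153080793169823990131726582716265886119309390343400646457083357283645110240615066177691,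
2000875253005667664117344044732568340355059817496505,
4888259682284390269961975488921115619611456741318950738511183136917673,
50463617969547376977329789433648415518273,
8831230752357987893114346164662259912688924601011034612574925393029092254204879470842396765150603349289,
480826569822777601070314700425366835049,
2913125179031902185462285748314046944218985,
23066994892014062965798115184489,
15110880419356675876240790551369833,
456025772170442909853,
2603554316654158839008741574252026586798571337575905709395547180329,
817034779467603386815906597956611488351788994928159422908585,
710151427727554367019233477525306039306409,
369238586193099358195731252982740153842763945,
2978507356601239409667886698587488001060337673103703287958955572747228917271679268400214832474503093016264103753828267653642656121139451302413321075909852135680957345825886586098771177847949711542993704899651667635039017095680426847229192820815580282721806605642961275247917558260199170896356328529532280764081139214076589353660421393543511482614913941004572139919965199195301189999466362421418993253744561473642540495310365478531946236955470818313970655449051808799029181796108152686917757056798147854963014093756861827567186508790441967822754684363955764997757020904082425125371746371119278272480906258663718426292319475490287426199239822678924376511068625785530908073959209589721179177033640566938531222584825668950173626484951293358822552202508773225123148154655672382011584791123252740141997615259,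
15666161243544263321755,
68811375238491676488446010513169117895214940946105683540203479313707135945655433802903891691701649238466196525842747945071548266830442349,
64659407738831498493118093694130042859062204017348404615216992587049,
11191751009705980499355206519931681,
3260982807816186302876161875306132118173198504003753,
919802313344711807167077638268521875696151533624806917474899822761,
316174347620681731073940036125169961089147698411587277498081480347242977901,
6898892421402142723819513804179490675056439346228750841550916856396168073870072404084828201,
19264756103328399965890847315589057188045591508068438389852719731520105598768320767797867455078941228111489494112919872181798616588127152798058508870696418299315912134906042286724721140131195221064197273526913705110588220312585815240034301741039919952854517300177344400842594749536874250361082500471315732706970908,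
16970015135880941995591368363454313317935865866898307098245496311789,
629080164250674889189845472512367553532302889,
145385126583307713649522184756457,
336391558172456386625676741484994237540646828910341609,
578323190292200294224691746684481367310088700617062936041,
5202665769171518288985329160170168380306027275765044510194528114574628552004271451783811704310836256527119689319668107999264031283731724194491746569849849071762541054373493688223900,
2866540397754687365588389335739961037,
202325560424325484468483000343574179594296855817778665548865535883038355025293152105,
48937856288909880092569220894756364220447506705379882548233628443031676474476928008238947508910266868119505748439324066088883821034602902539303915048615689312820389493134235681374595181979027419791775085857323247406551014052972700,
13882531066093369418531499318444712514339678806089,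
29703352441239326286867488324680438203076416735418589860694937645667752668882833490878550411152268151669996074947291531965497253629344547301576734924711533845954409776117182911328460009,
184315885069082845408169156011305623417694749410505795102498833967822750725192368831438925804450083707745039727546970460209978975005382669249703583125166225513838137201997338177876827269913537962099387365811207027869447974745105212261395788515689473167113261250403284324221853281446485709395162749463719881552003187716065614231404730153794856792606876,
398910299849699189177715132768311479827314007066676365490041361766793,
93254484812659620372146932974882445131999656544816108161886608985446228688018062205837170301318398194717745354767823358817872204185640507872666830795930102573002081188804383642903524795503699658975674139226553641127483403234191207896595405203688190435282945281396531687090380940289023811626462599129368068350440056064234073684939176724392401587332340317035559354292263735311967994575023615626525388184247176206779436587210867936703199234991804311591357556909751011393611971776445144248236931491547292,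
9287135052760291155117918773485499573293696531861232232916064762795455208778446989074595137003517486918526249412827670963473623793877241665772521,
155680301654451365110907560257509882842463117470690500840056382941446146792681,
19657339433881922772120972587419857108686350901704057352647874520172456489464126119105830287260783294349781388334822439235708784455834300618753676660566025742343366946966445228693656573138903817858373047445921264512892532563337928689685145738752800086763428576849021084,
14414787716210516543324157888668,
15710078939773186656054771970207617654856511171863778930777244234300732646931455742313633073515102331760549385460672948719814511107506691120132491413987101421839100827676495218312369385696010719764176802799747473688,
59711443859563501077377769262444752242645258359686766401681791153145588457077287491709010032293576118570248312587528429198209805708702365547505456894237011097484885908317895221833000,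
117529908654059465178779957782487870148505149161543832615574852359072683652734686480703768,
3097914016197291375717141286476820615322127772837437677784590479497,
105818546616554110968371498740101065840169,
133953369501541509428089510537257,
7714753863225847940992585910033946729,
1998602818300174165318681813603588028457649247903323399006031303302998297897,
105688532051349114908048202874241528477373700605064690077895729373286200738647052325761709641078329839033723782853918322282869936097143158490184806240105,
311931340138425869694964638526175276408835417155548386501101587524979081802123595773508702932265,
632774380990087939914790681421411929045616740192424073,
39388654373803433260899717026073,
2710615240064269091221514805,
684806068410410137600828065319427182277331027784714908489601526848164346491018169641,
10123812351771072724050458462690334483499496152165993306421923977,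
471918943461879904553747933930493260481849128733621417079112747649798756364500355148182802599608643233103228050733589499177,
5283487101750646986317387598171626880103464950907766341744079934019067332104886583446757545099497946637627442820232955233455836778506297448209168998070238519619223862035692081587510246633711273773683397327699170291340538750588618296114918589263546122602557860518260439183210415265919415699322098529023853185811801940870369141005512300676940165874762117182042760288166150013722963376079313394141887761135614420156400709409316402729203386087434021535385552574390954227029460594105206140408367808539080244615053480846444920709883793605163091689579672729001797648060823853767535528676157010367903311202785543114137027967207016591691287918919426899156731794581694130458190901075247724923041042787924894038368970907,
563045695015982484523778735956994788048667142514843,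
45792810569097317375904254533487591272367359598439207767337,
18132389192167775417521443117669609,
9750074770894729122276570868128975330537,
13445717227838500612771440897454401716852841,
1273302928323913936036740514423214664546004701484188070085812890605497049083360531769448902412380094855329336742049752982591612824203376452053732435181823183371439943264495771,
91330545517621763062628546866806755181304616114457894505115482572763152044288775906205387653395960364054225916794822172301,
204700391245532407910321541890634526099660549574349,
4003471724536060600243758030811923604921436724110547400250098785860468431018789469564721459472450332791363547687485918696778719475306200268008,
139939238747170148330697918002596943167063817266120251460366185,
11066160674337671043698724504495421860021,
18539641244941821167546218337149451130724035190268317102723645720323797995484621568677744103556139102800729501442692109439294564260233352]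

def certA3 : List ℕ := [
572802354036424824733921829970059930389542833072704699357102355829010391830972025463406503997477928896856728780654484269416584,
22457792791461736238177290221461275575504368221529876210051399552469773601198670079246918970411923513289,
1204377954927637190304086247054153,
1806233482703120609062214121603274015109862712380777919407348241878710659164432752139743082133898399125665881231213198974256747117040345177,
61675657484630684934734694020521929,
276790507515823905824559259393863468499000840500209387343163958579704586228519215444984898812063305999106421306011497,
39510215879553463716491613884265,
30720035532644842474869949207182663777104904483545304684768373827108479292314993452891857821593737,
2134511240254443325128336130404489,
1475096639737654760681176382488932489,
1042382357480299752001546046152040486728786508093384527718936545048482791320075014982916256755416244497137206264015500168405928838662549215459938325987437627261502855428684797903932612706125979276381508105356060977478840332916637337155344285096917231014776790542185167535452657320880017688926004929471464588745464402075,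
942526722534765850356936019613140463769850694868347037,
465509166854798375587966229279788841229181893,
54587865227297876783805611749598908104521516663301,
8270009628770360158062381323361878023549221,
95499711737784277519936572697260999030897566600481121523947794861386228020874401708469713940172477215391795367,
258748833126552136137626751818148693,
3915754082164734690439258554668637902637237,
12329727160154444441559774284429827317306128067284382741028467324833601900178784848053,
505992740706562082162270546103098869941,
4858413431641003610910648069309173825618342509110883088979143593916033478498652863500771052072477116878764358058640581835215337728624510732456,
677686508103586106930261351384334088344619197,
23416433718589047207350615687732653565521458862679548274540615691307629,
523976099032019515995871789546454874438531691578245452146483038829,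
1111468642414914323019689703717680870108580717,
55028548647821107324705663785202918099521,
91845675981973974209145655695581085577817920158681295804352858733,
4969701059425092513099783309707734758943279293,
586817469920115401135087888318183248990350134010242983622382185619688152143207536255445731653208233,
225786280171626611460249145251977403425418466037234881479833041416411448754767677609,
88522514800473607346157496346820433447204058611269723484121963253725263272564562808936567548356777,
10839342478387552766863091747086995492527859281250426937605478432595412515722347927611706420109568872615817529513,
465219467313106890943189816258589387542252032194705237199083489448267560280895612436844856766411120810458774137014756929079158417934633869000466514782416838153314342508193387247760825849805713943011911197801593578324987977163457347960631298194643533692602537,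
707764881609022301298590947954073719149838835028394494326948403734481296697845659531379327123434005647590408992354830643614314566064919077501538327401230156847056231200360527621626906435749482531515573757061765619237589771205427272,
4176392601151645622974779516526473460650783224,
119915381546046250185674379133296920,
2569962280555572754129478374159490712617887311297001551867328871317102541011473842229272849867982749190400070928905910822916377268187850107034,
6311506782920559799337377021846511745429663851842228760644709092048873553132723137060470988892794567078033916672195310193087064616544256790824219465292224042840419128433782612109603095335048992341905302017050690929602165436304588834810013,
1135326382886202258043822309199513757,
484812047062317790047073214750561733146879158039903745775787612637505085949025623751192508839874278632337192920609274307143178816365730097629352,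
1258818653839350510628124244723114979112372644602757699775597612662466929825469709124739514137183918328876159570373143499802793,
394313152478606190726344205892576079159060052256965954678679339117946349635176617,
11832241652149507537479849937065,
5505201989384946820722203750205609,
745556231445855212499452763040370478812002939369815719142796066297612404622023337417376006205393309019317312195909371623098925366098845942528268854059322771625,
3041225604858070111263462301372918611297,
383142337114345953352420720259254707260368623536985526433239727207690256595559759427658932052409020674896276570620091863361778107916319490244873810319907755400936229033,
60256392349021271788257539794738656919095465,
27297956765240678428323895986886135607134377,
2371389215018932023628645780588713,
1971143151010836996326319610824873,
3137593778457556420985189992617,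
6589302663372409358415419869353,
150103463452421318528432078356763487934614067238402263224898073380970208416744606103300104387567676542381078386130685238532113702725800,
332804864739893106463037275969442491012587256706841562987658180484763434415413119746582473643065986510588072,
21322670855872138239440721472707277155779388495107889,
46214792713054841780702260887230137161744630105654423303010390417279493536406323015818487245,
23595915379426210329379821600376854825837,
195052362989529815710478735747233460564301597549,
382953213955733327958599041243342865266645769695450365945153625540096914727486858004925,
7482312580728960900182654043505769873079915385137321,
163453495251509938996279631882409,
26768186098676866999974909158009309529549,
27839731408017892951830253740573879247775913,
149409851430372793352289336033640236726757643775750504798775954278137343273,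
119799192927695691989667521926909292078287194129641780750505,
10868691338987483289234717,
1009791096733458469293640338717,
397366608714161369372295048477,
1099690784440234319922112304528528612438937443912343288738878721693744466282585721001,
46379490517943959904788515612476587504204518233857785866160297,
14825317125770078223601035822663849,
18869024578334082260484141262063785,
30635920573656875962313361822366398386530235168981596869107708328242341021625682628556805383990679120718343632467461776624364403873010071608589180002979261607600159796438638238230120896679799284372664855555293443697330331,
38177406647544185734597779791072053687812559722109796002865935726343153338196864222608818554682469766599700246941532395753664793,
5342944730733327859472143058244851904420703190767669816081336100070379258973413794104187285084500298523958872035491117252781386564926662353580990154611488506544273636759177637282335659012404865898366567046758383789486103045883158626623354134153085671129835564896037033,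
60897465737442907636672562754573012540777427092225058762597668676864034136501559091007249206482584958283616984478451118488178721931193037990788476582248010896493320472407976181446856988027125438839698036392517252063150865888236802474767853922316162293180144625222901405852,
85749295461273890141106271520924,
1874101478350626006115255031479422206560189815820296297371414871787193067510436071665210345307977223566950481616785496023359957847672946684115034423576,
6119692778826262188465281114528503417483913656435225820458078157314158729,
161648140682283535464882262066749640768157666801399098895959452450458695856265,
59840259467886295496849842214781623480511613704279453428201577,
390462536290016890658588880217010313,
5719506289635351683362660486348198176797115083748543480428896248010819352231358665743209617948057584555294668159017673844223431998679414418498901310676005698087081,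
3764555140619005238290438310078440852371605475153263992813156288588248323169,
20173311979398919376569252040566773797113440046563978543285865250889,
24392330129200617007713154029645201326324567719193305760939583657,
114240977560345826706971388097396717306155107381372380184442488850038265236559945810347254460764234277558090943892226794007303014211025999237177957757697353597688730615767986429632557457167562372364446202899241985499070698949154251798959976927387,
881383607778312448001692916373824907016459637295416076263983053939757289997946047912685129444187885754059850318288559798925,
5097338072193833564384719379864717113810662331063556956766791616530855900117410937558107772045457286983201281361488004770700444011406225161472399625046154730873502069115471916578577020447971142109242613047315513553139557290090574978298125,
16120088372848300347128176701,
12806465796399472805349260497049576049242894586031948453319650280174702596616107802435362396994547446418739854175203110097672342506511455586533434056716027234121087040814717776095921851701951825507998356963377263489667821131150649341943736094081586070019344094048481894028907138011234936360026952306290571673675518457772305476794928204951829176425826437994260100504214618557371372675098459826680256259389399580364503259582093735514431921533040,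
402007553167021525048513464464,
6914389169918564016732632824862540604183978577426209020111919712425,
154164654470144811986190245472395367325658687740069023081277311937567634905267079753063906783720383740557683263657,
69277213532794541398680274033556066013027116890698827095652682439879740325664527771023784511153262439178037976536909993,
64177233126079167478664191757820874475079861464343795044871364599256751455170334619537470912348932541526789322613879990557931456323164987555578076293928986008562067284074061953412996812305184729600338677948298576141465658958914984492170073607151542693226176448470008600582982328797013826770222357570280827450916122897953385753748619099,
214183865452128861087232895120870701394250853687984409522317603746804577911637655138235873271678082004912791414855206216199150268738933210384238641225,
7966404032520024098919610384347273,
33721186325795998730347622855321994836347842082449411071865828969883738707462866640584842870630166019141116944752243750999016972771718865126452429207549390885040455127109579787418472938289311864867297626356140492969]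

def certA4 : List ℕ := [
133738714997967490501304679114936436905,
722429327669872346094693872921611237074795470182911922436586225960183585575663222763038679853593281360219635983557504044331145,
234888404755483787724969286576517992631272253689779460614523194116396428505581255810939555682141531825495822656798732082834023668749135388016225839542377226083349260614072834258186596696132134782681171637764677234507560648473484142709776483980726438197745699851373852396825810166595122141353591991785082233223772458132189158291857445172483577579578458958252123199699687336559760966261413988515964,
1586998558895333834560870556,
4006410025367772208566332,
393085177501792139410580841141456217326706759876512544819234113705,
767574346472969647846177528910220585,
356030468620032103476435968240080801213235504435850923387371840200232287706351395524686574213533192835035629388671419791365260057502680695382363606062463853776916459638606393128304613714602555083181754524,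
12098303393699506644027548,
396245457046585252996008092,
283314095685776049768974492,
1297415982726023276669084,
4274782116399101313296540,
594175534786816415961159562630367458395064021740970645099587753,
115874960246951943248978400255945,
538135593481736485924708676903246182233374810927241,
1424012316238382985469758785945673,
86086031572003445544496010146767083162649,
158569486175276031764774396033158366397096106824476768683679916603711099479183366207815382083080597740920413244179437596588430023802575032884982601049155250901138527858070530790840082290126176301283328962930694488307329160649466948249961627872108924620513663013995509930663240940610110132842211503365516774857455399730865511693630537819,
4565605120392670841829211,
58288939191273241984225435,
1372666241221431610735992886107974414386633302270170793580928589301917,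
181867566614781476741800452970421216092065,
369262995323737232776437314412546475373993829568950427711449434069127601923284732061,
137075418388856284810633841203976299497931038059324800271059101,
306878864244051279040332097352928151655774624261769246080436381,
1216156714714651468871463729963376577866974090565254177,
773769190177729532417128180352177483678890592370947740596483378388080129221745052028438685,
585376130470636940568833868106929195573370794906576104200746697183348964111987170320351660189,
327678926211496869626415557839005,
109126950462739653447766738200591344860418296228486474792335516720352239937579236161733709503224405785641904124153698869570088389095105676982485704580908070609497191374871708016882902867207921849001413917,
4062204096751102015111190503155614442514578184378059210838974682788721670143530145365334907199188109628797692863391534542524998437160906351054616338807273212373446004722367303935065490684392483562360756563726225305079069,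
1070186847061040024749328233883864349,
1928293279113767862025384289071562060531709492578075250978013278007980849949765154483114058691173799500290485006076235076541427140030248219550914676911725476071776921593068112529854128354186677073041942339537646388109011309987997,
490872191075026526185037572836752563852274878186539165,
177342954649458368997832442776235268735343292989096617876187890325276851878437500030520117906837583541119230753541653928198464609850298968433304104636746762712451586914015619033890125470645566933457247832233609358909051720885376930307848631061461233503495769475523104453915478173,
542553380795759882676207827461153333201053,
29387396907975790895569452018452637,
59089878372435515532371241117,
12399835093510659015398277982365,
13989560102992588548247895091357,
218001579764479634128501540385846924766137659336731944219818927578932895833377513136641628161926971801344089232615459113092900525055242304822915665569747243669920823644101804937693356593642548634863900831600128063671674515978376019870037468114628173232626812190764009628,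
2611863762408334808372043199701197813634699560545089094329415886232567361745878139199659955397940137573854645703701485284072670330751415293439946966647373293493444045211386124146706583897731853530490378721760569436983241050069794669109219955053249333942896796,
71892268696120347898442588073130235196602155829701957153753736958350777932421850426275576229339971885932359725828567185157079305142143780916391848092,
13533878301741216155052188,
22767060947212143718799516,
4274143080284459034616764572,
4822120342859410397638400156,
59304278936147549187094577893129225361506743608415445520467936911610926796034453869192813424275398463689900223443842286513096917078721267184170891630158535331282878874117799249405354516276670459208901906981777349836259204773500631422397793536014593955456851626421390,
4521358820281209110974215110510046318190157268303327639956581281342674431604792061739574936161966217295345676192355412019108441044489602188438700273630452988677595114191354146704775235013237755577261799267939414510912290669493194349011303119339841549540685,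
1871443571934840573271753386615467565,
240052111156898285202521353773,
7775494552267455465748782839066157,
152774982798430483036338974253,
681319349419770559113619689492192910071543063427625394389026209038553980299202981483990650416403325360200228640542671394444184382867169751774686875793804869550568361078476350466568804641876222274213218360171619863180436167009648351481554716160721876043161864100167514290677564180228704137432577499531924722695729845786103949343338329221735524529952912196831799824474977006353389008453975630608531049200081827817024298997980860,
144599279365913762147995772,
389143366634898879506992733410494620,
4064108089257478539720116011141273930082086540643729454229004215928541444978076313612161363814886721189414910895419952442899894963448166816263292532484954648067406167047027850971756778799039422656917049448129758949592058538949550432317,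
291270401814025539013963051423240461,
589125040011550563178919805520186653,
424516689863677475582432907490090483576660053673534404985426686750556054882461,
11332196356746381021141525516388509,
3288404149709006971356083077850237891982808943967357358361155438850937142010467443246690586275381441744249046124573794629502866796322737559512835553176728664747584445717601098530351625622930315011319788312165600167478080204913276159729460847999494769197084366048097753174387577079150056171366956172136230064011864330450482202767,
39489076601397064426293391,
39352556541428159164273752109521941068723214204922940855191402384133178983354979717839376883992714800330426368734387409862899144926330408117953696115424115274232182692777378741441644631589948114092153704556518441579912933214364,
81781017926120525699559548,
2155120097192931213976946032357302403401884,
1564948918415365829174409914757542446041249933589798531340949488457647780329447423342807738337705200328814584525109351996774532656355410149533848883991144430357002760826126185517921712141989114581469326,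
216638154689066242240305779218487993838277073716337993653105957460322714098188233849778544176150777824494293003414912,
5032365704989624483869822070908422347028990299834630995721666608401009998555729871924,
5024317511278511236701,
256032695373069347379287672096625,
19802840277310078814733970203891305609387960648950932959871524211435200023714563318820661959458502158043799328713511610843560128834952648733850813530572837,
701109784431978802476892230517462217183785575387373166419230368635639006246523466617391141,
82368436998881525910060753562304761945254206724822144896456783530128006092136334654631729893516029191720983,
383886614275984125553377101433112805255181,
3270889342491325551109838257529324564396506569202181082679610711454724101,
3860793779355261589722921529985236312520828710608761100512239512597,
13029980347339145615477907759517235960292535881,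
627673010884039307936805211781847779243650508703199673516406778571721554017630817051415533232406482794497357880679829367171109,
61931114747906540605879239708174145247157278077332742680128464351514880308000228095452044327340098601854860385455744091667193971466413428905497727707506286196008962562643254450200,
711515979906283677177870886860549525428671769439714559479596073,
11535492789128618730735218562770021024103462774673561784384717865,
3661848307660801116364360513016819422546262349,
1658380329913431919159052414911973304245230090814505,
10811873277959073184635331705090644854596083550597879135155726831722710170362742007943123266204773062096457670880590655153059628073,
10065384491958346366045876035633157804994298921,
6813074185055587494208156643305689821326341033315375945369031868105044308253924975313092773276493518286741618923981646955853545225704145961,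
4969275787917749322958715658570794025,
1646550319800034223972111527482252694966797304452265650568789158067348045881550103946265956137814466652948858966145637516905,
4767612198214285047428722814158934047669070355397788872838861,
1765128782844850582270289866306100820733757658096978513012673121865,
59942096785644278605373851238472178427043655288322306576383495199419161135514665,
3543603653436007172280057417642227292637065,
38980085966266909446670122611561671149531298619688416875812186144867369,
282685287480611118435709499513407243305,
27616030262576905751721752509970274911109651747513972569700391215514653,
325600460482413574947822223228346839155741,
163441728011297706348910072204781126685,
33355902816265884316595522013601719449151338142015460308244863459536676096087410452590337448078862094144558906442793]

def certA5 : List ℕ := [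
381478605870886946765628973535416580018051974185,
504319046279605238132429742134566967993075140391397382525856838114167497607925,
34438252985199190143379020643023913478635948909496753094655821705,
5628272731099317915325893344241928413361406674868357865,
177393256452895620946836309572096150796440978031047217561357851910557828560798773,
673988793730262149402771979603585677126467759492132835244852277,
728421872692040196786011280361940780372901503474579264921022661075387706264357636634569442035556037880479058087201937332697641014048923779412207248327720,
21729565500119161862298737551655699668551271998261642847656097566790470594891731457825937575463603884369079579257224224853231124681778429934470939688,
404085943243541625547118643081163286553,
211094029755303205808322615735720610365051196579391435658247065429962496835519809686876359726912772864877156807980068890431436477054139287937551067736313427229120207430599720,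
50564889375985990670795630186865869864,
18249390206755538412205546263380769518310913939145143479904527226348606656488672968557143230356013717463636919102518889302703714489873735258,
2156275937973875107179826925041067359036893,
331734759688228784945172510380437659676365,
3196306718780019941879192182016181396303096250874358565039270827514060552905632427228338248424,
48325996087559967691569226957074202091860557,
60591940112605211593576833666649909671860678677832745,
23988692869803246361951762870722007640014142007456403584093671935180562168222321273989071080473627959129468851313540057113902070294539683458016307031513720211907476593936286159068995855664094588945456561791146658501196059163360002358009790820011062248,
1228369444156275850157736803428749382873777640,
48597833662811298302769304616,
32348753687591607828963789171274086608145930262602719989586814127426773,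
14186509691044298525508770201414623032025434485205,
67553234109209830350957128508156931425635742213975379521757469459580093304255895373141113602210523574180553550555533990586642210666458623937071904070100823475696770783799788796282541497500599893397577517620027154243549472583424457687624678289940086631625753004625786228411476252651947848,
41587123025750187571795700497576713,
458600415249075410535418709157,
74200224340032394190947438836260195037,
9285648831866817903875583321117,
2313057321168252891192232962068210390937246176392089,
40587212333980354642706060429160869384238015048543148959829461,
1938559946665481223863138484013806956744528769014208000448754760690741651029417953326361002078564406892506973613422261306042760225376075101466524692069543982179730687330132867394513188766429124602830146908663213577076687844831017800367341576847345895960426076084070910284339230472853345112072409401098631597644758701656498601116290261,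
1590717594751073152517532885167952000779548567005,
664154318930183134706149972843599136275182273310343144469378159616159126695040367998335655128034641357958744171957713443354371306110244497425592776931878259224014487629955581953294761828765577270397914970943496251466984746138980910608968210308853722163175337890861008225596750388574515043621223963440082014085468670584422016049822756532394400072,
256056036168217099176163352,
15552866629183086345245816970628541636088976371285,
18276649381961489297167604686105823861103021831758268271182717471129547443937767416808435991756417798594135300350164572166293540582326885821017908335140015937029157606756131138701128,
8985795202136966955906274763805,
47178463371214347767312174634075613516441142981868620966185505728138467372582869173713995057419569333005991754966811501102643129798290413763702525415081118600190107081196742659292707159624,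
485486644987949213540802521017949627537464967790980826855340515718093862637,
14645754358691579402580866084608460278700621913826716305809588458962785689,
42505202544289469975998643188091204805013752504380177077044057,
2002219728946771748186321322758655359312792236094720891172241794400558488229580606661538292445864115511487035832450435087640836710570645840348913826166502717330133955677236822627846278615800590143394795167337206574439048967253036679994044851481774487581047721137295487492795680016320222388030063088602437750075730841,
51894835163640416105779152393088329,
229703523100058647798116518217,
186423098584424450838097494516366987552595289620680953452027466375044965357713035431393025006238674794423936534996211208903759123205884020434730069402720671515383497,
99261818979990355733101354453854111660201403926534662101407933,
194749768684396715386232513437220087985716125756499172798221091140967089150888265,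
162380064258244073609801121884526905432489624905770810044138501935815192356056576455088651011717273513879947353973628405298780594150045777756336591395217824287049,
11090372573672684410221789457737,
65762488093143961575763980285224954394707495241,
41569237724992747401366213495359817,
623434027167715647657987403591537786013905721588287041613540828750997689928448138313528268661124780554562926607432760451770930221510008404014344346584304740195495868156874251736096460068405945013967429313577,
1328264966399034232678467921608,
271867353586150815304414953128273426957723282326942427212534355098569,
128196598111057982413927630362710067301757105686989,
646838403051835825816937128935824553693514461,
210737518726222533425843972743372082741363402841373424547896057872850570996889,
11724256585611186013710082474651686486971995776449836551858548322477799758355826181094021586568675362784915313420191547739695790610702644071122537,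
698668569916860463451147183584730488279755165215989774101814500127607368835573568489,
47437944356964647057561182869071293500604036963940954571337219915000042473,
184426027822635270554728271536428671948100993,
72107970481809877072573720028912677415150627472107326461,
124612438294187971050469892010480309645,
49406994134013846847735187644366765226787105789,
229574653404181808465196005292497023050107249863401,
815600307880814540495780300879406111047196129450682880234918094571393068713018409,
827395515662672744774567025960060692981263910781,
4956342117460928302286399426235971557282487052117787227764053944742096317058775785022871778338022766772406879262766418341703813414754702313,
975194862840383190713109404981397743853731765741638530377749502168280521661616956216804393,
533124442952984317355935543205676207773182989069004298756445737206021369647924093314863261161,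
9152119335549015298262252897769,
33213396439158100293341133190188406685856757157960768772289999298533522181577,
19522519533992686973275237828578690099738573778708565132131730147241663390471504226329,
1617940841974718791514388143285289,
187399955669981752137903438943133646676799899621098260970699438897838672253830282412210073797482704960517362233372662909343091976850195068228428196731828563371497,
958724749594450813696786184780881317950443488441517545,
316302235060207533695215030011657,
239400535403920517660360433377406746127394467039919775121149529,
183730791331869734861190942202328224820063241,
162136320854197977043050925957107197667597627434025,
42539532897373829793203253839435111891698450234634896425,
14885834925111525134429945998818541688261149737,
900258260629674833334450574296736632881671575464764438651558044978867167454170696346587488505034997265673,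
2643687177119659027607167855692596168567978479650964504981239851903189383633293649684240120491730655412947885856050344357534194686058147241745288541883527819420114481508866295231090763432080623373181420673239995645062556338016063823982027487968423441919730997418660963127484382434420199227,
6510658296550154438203,
6022363572216009459259,
1963104731428886610783976248460317,
20520265588053815397233310333108166578442750141820469051411361353,
306626813638313985108752201257713,
296021418975789531890742203691537212077262532600376625158085733,
698065534656839618454129405441077456761589356649360892512357015484167884545911871141737283209162250981399011568157868066269448458832255459636121310318276588980437044954556446601032117670598963924688534081740414622050344247544636999,
47065976753724832272698350542561670001164082636043964319001701985,
11738661424863089517588842412000756934717858476031114161378418683983441314172938325157,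
1249670410866239140068640801786751453116677626110837992818840871860841459435833747349,
201606309694391262972565052328492965440221,
63298608131802008654342706906431784848876040169204484440387075182222322577755288079907452629530999045,
13891016247415532437954469195329496947312891403910016635423376233808844090017678389,
521974181336012220167941233730466821945234859658960939400440164122518417787539645181210997508868298754462155829,
617266528219298966973256753440621585,
4280789049046854027982944609540571899040711965635237862486298416219189,
204929034565732326786806590602748607298924648706106845766709]

def certA6 : List ℕ := [
11252898445748354060647047738976944229221875184579428301968242653725980559253,
321396842508750307022335183419840356276995125,
74227393411849440103412089262398987888772450586307334947146522312213750229296286272056925724740321182941058963105101804400620289878835158570962340722378972774912859676116066575891473541042311654556249896838062252411873776856304166032355330550014956714727,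
177255827238852870104021774377684976715367,
26953875713504473472467199070486142569531811437220482261,
526688085866272597265566341146537459949420346939992335005399104954214440827770567158866227536838912383017459688349458942573970208446245891169712324168,
5495899406140417989058823370163530149211013540459853212543986747338757,
603817968566144999770007006061579088230493956884223093545747045406303662148620628439626091061292640506668448134553,
549454752472786422440577018809948621110198776705,
1157917950051345677805049714677419983727925765858542270995745729510086122661671332597617975840035931072491776822132643545333788400596377,
58177587014235768070180601738610568772806444078285035011210661071037991167580611308541,
8588759620545308472106401197743747396692083053097045259859965305588895330827052262031083845610462405889626337575769875468414685849572329,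
38077442438302408641686600283954268905,
2509533936119301027969772732287323475512988964537333605,
12345548352279818145122459809017276691128440151421566022057813318609656528261,
64215760341087463224488975911083418107114772901413441898113094098319634713395957560455348223407234880352444941264307790221204282227382907700346650329443206915323694015379108865883798116634660920358320702797861802863923544783381225066198280,
67148116553067300130806785432,
176690364642370621585276275656,
39445999552700394293972728159570147571015351241,
339913537103330140701074294241164107936734271192511242464410450853374147704292162039373394525833626496852259211170372117617960047568672943291081054212255396835816881029905030672274129846691582451474506955432243028728088056381878073994586661060562226485537073801706662941217875007684957635109067513507593800,
268048490333942465897756675050423306734531306488839156721652906562342837893160700865827242769561026904851227145376016796645914618,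
5052327819930467681612814726758291023796058007369855461454429876008508562345467509331410108675909282895219778608367674609414895045033338512390021946525111207722881971618869,
253277927207490624394755688394708511769018272762450624547046760507865309558190059442246742121817521548861323531952641834324626760743,
516462927974641235946538731679698068263612340768853181680667401750228370555995265163015656404463783178080689472377984266276435490027506729067700610986373615016421356253886865124297594996143646455724603726646012324230813848154531605657,
1237210753804889117847493842741306926699454778540614827491345053921304809965718681,
4349419813411725378825081305139710673439549529007370385819072594883886896763686572781018256779920307099968077068162898933161785868149858802294078001893103904793,
1269884767140276105049225183609660414280147763916641204650001058030498264036145233881155246203432429437,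
16541490190548515688863542136881441831395015408312041418466292771864092207868570945403044664415607219837216793,
113797441247109610877127587201617415339829519076079587354302506623046371210063376240530465559511180607890295893514568313920836848706000668465680873743162049988650112696576781985395761465427449524314770986370790350575231879522719009547828185932984938952580262978986669310283640705176810167857958575702385276731158031541120703884858997382224117892119502143809923192856,
107192344669558565891762360590829353596405594766744086098820568699073754876006019819494574122054791990643307139338054021923123056748434151441962189222241241651724604839105932635089719425586999012466360944430451862959621353736881272952897529714677827791362072,
10225915525440500857514679148356003447657372415436004161717593086461516689780017156098202284214159736390439454473030863415413346460771284101899273516551923592390040461562,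
150896103892378933463610,
6603274251747890989948352166844110979755713288651050659344253993,
1122029712875265869919807832232884156659545692154419021729095118386573004801065,
39731327376485909331854429419615320748537028187920359343732588060197879060982637579150437028658617126227544217722779131587083802330140,
135609323218025501851740107539909192212062887760513598118417976276266009641,
866120943020136441220588857716834416827937649859176610419826540737629991810157033,
3581492443101191900965792160734240153734486880698973434630080959752167303161867841944155891177,
86043155855637984110622491945418216920347528091670206770676889586180437503971471005057045735484459994182546670511512986666640743418588,
1432170535300427179386816833451025516570185636496412,
890582915974888968106380353825912123036064876861299425701431274677333337704305929,
1454719550307605918048742262164773785508689105457890976621368157264408866394069593645098395886514618941091096680969485506557836609013934295284085314348276237860382766308058147945341224149588014273051267478178565613964097356529245563829430462738037543926396071224455278185180,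
26903130611153366684597948233307879621660,
6128663914903511325050874888844740985698135232624318717082602538025,
42847734065916968902109795551340390262959269642718495700903850123272184678614057,
689064089688984963661510867695016379002477367827876943085217485147353952954882192746130335665554222404765638589711657038701436221545138028560015770652,
226176377475815543873297270474512441782619996606412400134301543276735360418857,
27630446386159668433962253781019355661792282728777160869972713,
3643972334999864877021539324917557425386466558342368457590377,
439210603162894401371431820528117818034015777254921446663657,
1157649911355968171950250838658357976581272484262068731531216627177,
676427895552834052597960994179539633874775339494427454325598901122418541413003902398387344333568793102854758329032899287487783523921053691270234802594482776698640889755282488335913414798565948382998339973306807623332299281651568864151408441411516051156649905881779257450916956052772905150890705697219075029188799138196175701020,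
22947204147747555021219310838430586315372671158021408515968294950214579333687036053588275194482568390633801853983342438522205796301085804832845239200480569685402036676129008470312491950352523090290312665284304114723649422391540423586409180344406248223273709407710448063388706384033298235461600852433448674763449881069515449543594757579463078399887474879463361837541833860152751806430559318106068142935147483118972185564554219094400047106530361686033923951476922345082477332783778524,
2967297588071439121715219244950029432761802823999222170652,
1719289365725334530429976334339643824058499940372735580,
1440858994929516314630460732055556965536220567149706522651130866502803443958939103690170914649017457388180561466946799129298507247843201659567642949729616932375529178811977,
8466892826974831525428732340271903149921918331759884541997600445334998296092681116261037480636262946302011342232260149230235142310778449598254689852,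
1032240832418820717574673843742767143138034840453334665012602319662145238729,
451846449158264625910889231677297372138693415750821457292234217273953004592217,
608429303283583005079266271548580822965518158755745500881341378737903761962881690603010204766100914266098193585811187005247495997871669632600253379589824526004159861537774205962581543248100191826030923096782023847489158250185088050453656674725263820482696272693698015161759548,
147595467813511639597623299851881775979545628,
11828911786796014927896762505050750914653301258433398206583135003007620505,
787979449084735378470343179323267926037913,
81924462151683302100852732870817754296072800057541571103296231050404839925362128243287184928299717844741507856742371202663736040941244749049831037339452128777731209190744903120934514293028261212188529022063268681205330622961871495643992698504348305999465,
2635828470695101853441160524118487768204852236017930516141573845519872383818877454121484802166917916712843829658668774815161874307270705912652396978064080788225301264426766592633381034486978747375396388440191972088670330125555554174767392793323100,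
22292889501182032245630651575566384092469384390696499977944822004451535771524194370482138154025,
43098079446026227686852127647372533033320086291099493137297205815483838050702952848984509054269365213296217008348746726134968093830493258055452785169002585496370544867964572850482481621998743292974733673630087065782107859570914025138071403215976596146644585839486066738918562958112532119245048249170464911012811691358389128833999131894958830522327207412373360415624273004532145905762776913426519753505303162221570291723932303704986188357255379422902819831460271306390754341439864312181861228812897834048917242557466143935244873315683529118762160377757392533935575011555933219784340466982987181937819452302329324649127219585145196651668691387554032763932,
4352045196120107438550360114065025516572,
1804566749148284707508494517086327245844024404939872737022556189708891425924945418929769,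
281387730431184074348313218845655554462940668135766198071320267210553739899759677221367955376703669356986964472049343005052596498251819332750542402117385577453461001097834552909251291075433799024786170152400528620283688482721376864465590262457658782072107191702656399004734353957232945431835338332,
27876279931372433222646375409244,
86609894842405743300700892,
2216248899922643450956490724956,
55121268368204331247080476,
10012696378555508205492530878677075005386413225674908229464565367353336993645751226125706398952131180643964843655920459687529,
392291080362933441249016976746089,
467158135788632119677298960511772331226285585385,
182405969338753791048057045299664734654221690362784233,
64226450342537237874380200020314249098959212876057454225189191816744644388595548312401889403308671400660099488498740410735919683792829363177,
45145848093104882341950112409080022310098024712576462426444475113,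
677088023292037347108850524223190813403088398683609134354657213015912744720416535758441,
26047257892350516823268207968950519886028910960140981076928016382233654091008295943837461634700923575207835662508609215349028335955829863232260334076204802653853617619767536294528212597898587395099,
240174970671218332944595664939779427746568607393,
168216510368803574104347718744329447175869,
166051142770991863440624133889157443840804889,
749276997742154427067196506663845248284353332265,
216876690909745090617811433621499002588313,
8795138568830639001743872197668397336494016537,
42750062307007814634756505848697706940441,
415516001241664766775234784123369665384764293772860722253216349725035534589734300681,
1097909478541589087361719562450270030290791729834403607156625533702308530608384372808969280703306561275708809716507816486857452807856275178175300971160822098113957505154121124096238619,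
1936323372034339689925187081125341512745,
54947996608685166445936291727108491137273928498475388715364615833619091298614671127907790553082521758230598234339871986287814389889465173603263926839166945162141909662078270709227206235,
22016482448008135572187,
18649437515877093472987,
997974211142033340660837979,
3293247400416037218384059413679120474783753916899661847802069435839604595606881660667950808539626546213485787053741143221363748777229430782071041243213700159750014617101,
150490264695312043464155662526632113,
318717874589700993934094787738284594434477128031299994689,
216634063310770582241544795161184115568504350926674076450856973282801885439169836845933144042210014446644]

def certA7 : List ℕ := [
93330010931912770167784026552609173613037985322984542905896376491800239480771222485,
37431707819913678249694361078213102640066106951927845,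
11661786673906901946040022595791948523553584131975685317789733,
53107000193881132924697294406643369482321493321953834435658809315349326125022469077,
1158144145063725643630575205959875598701192626165662197835473245201738438707957,
9521239409943915749014207075590217517134406563209281775900495260566009026325204849363993753683280091908549717879877321869464886378272154548074407073920998410956286413175574303490131861,
35579963861701153067164556584178215381808000913921690863907676523690485224546926096238183998742253874809647145355125053262652108425591496759584515555788429608880052769576707772296956585864,
378125687965636037111140298572846610728326738851720,
23933940968060388119067470718822195315752,
15211667208967778165214315276583976,
8617153644638679511214102609107847904494946041442717831375229342516198172784302109190479959899357205305791136262983926836,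
95927225613730130073031395952119802146356463016921646213403878213568144559844,
2620882020975070212844200489027270076640829,
740053285853783497614012037091110473,
35149931359040883888447111752175527817,
6455813083153960726390148747109417,
5980678914964403837053539083655332416957372351615109372549331490673994803134091364277555522580,
6876956392121720918767895245233481279393030696329463412,
546124424162309595796627247856983234844821541628686095792660794286771639688584606781116241206082623917080703603762965,
1020317699345337652859278452056311701,
5183319880464228390472398236613575452278791709502185,
24453552627366371010895561665487094656290126612230522439494864538448950350630429187446841148676349516701201965058249263058015115093,
325184874273463652736926496038114319256291619919743122187332757541,
121922381842729259991834700889961524726088600057072883901659173415932286246604225270827121739225455347605,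
365483073010537688233328183661392540210138277,
124548102631402937615608093856488842020389166533438266288165,
236293443594417787349744748172209639800888468912585104999168673543617652014665245821241561498603853719396349158987466877779865290989415597412795947975364590467523170529627645412834745579704652782151415908232646205472229922827136226133460724779874773916911130092799186823,
64080413953087320273505093623015968791,
373300041496266600802149007369072499266449758331594521528675556209452305276673049,
3208518467069069455992793284668965721602038287607115466985902053351040798698928424489236706702398092175241,
2068471214260006391668593746093305081624248241211401572864242021814049800164170510766316169984924141223187833424303581751775552688293626741004016221210382694926024,
2730970264136969899979424819880157575302787999222938995477524928727221944700692653521518581128519808357344100214435690799937579142816965945487367635534191047371695882411497419119910368307564112696822037025832,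
2155743242766931316560099282923414851260071405888499539998567290302106173871473122763522664093611725719443129330769289529350761227255726203925163766280655204579610426313,
19027867366168861271231756569053940993599511401152242480500918303222434089925225193,
58857139349058192729844376443305909317659176518169831748606485901999340290144285210833734045956389947369818123871014390702591803031376748691809879636264800386853436336572721847348913598273620117807841298337774119466267758328607634937986207323402046064449483389109740585,
2136766900760806758674318040292611751896969,
8326827170936972101402240913755081045747901481,
20070000211069489401299987410984516526358176444512347177,
642152548284824223984060851659172229178762590373830570775586328320956605,
924042454871226197871010996717620430277737787344667469,
47504317129696043207614560383458567771063818429,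
841322425585189454267301314880054667090783535603627629840812977481,
303663675697880080989050225148553555332297,
361083321087822839634032963102554987298505856713,
41883733083644984471905280726074800406252291697518779151480923177,
508141069044745510287897474748739553141882311260780073262640660650852340124444877322539951176109010996299835125763075662878160424988333736210993171620662611636894620538755677345954018878999188491593963838526830011611175379221242657801755374071945820717871104763064709174331917897409939803163,
15916383760435221969651328027,
7733370172300720782200305942966692172260702726077098132298440554567361668437620945983975432088319122893890288937169250105105168264,
6825638061923258262140238835479347245474385558804917971056641292312,
156955112705007465258690618420936686197458169111757932109979623164315813782654273381740031884937334327318122722439466932328116957045981221404398445662707431970354050864116092179496,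
390714755198760866079118978710779885868509185187818945043348514643273805871558764286574040,
3469182293441195656858782181632661134536,
7288577367870464865518540184712659305603885998446048649949539565589038961704,
4893012189112167727252937202123223412991851497733079072142731622683421355294187078111098731005041645362691872838625623045934830354555530338379034529855784986,
7908152003385097319686427943281952523500930324727895144691249674794252,
33651682160418123234772635814935223432101164117927665569,
41284368257335671427774333221921,
1123641910619350446145059426273,
10124800948577252822742292937786028582605801822097849672915230625,
1076318890698655086600612488631014907039853314761080719294339297,
19264390669726023973130942902666590926625957811342600627033053,
989577640775080063974892466767528989,
78067916026270533584008097432028878646521720931357,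
732700208101949267231189047219979017540857216666407901,
10390475877447826661617748017057177276893,
1746975071710684237256451827400801410736542339822974126791914565064877563693868413731371253937671303902487577629,
3337202920124023785634621763753293827284744289,
50448015230833915847647134846014034909,
160157346971437633070772808390214685,
2042405548218849733172862688432044976149206765863965,
1959645889831352714729958139784351894942599014709196229146938077,
15199068878712117863971225003664523282379585600545,
27649923227760611941550667699747873,
99196300991523942670821780660690849,
4361899380300637020058776560741392585828043722281883505859387297,
177955208090758547459121420308701014266139513928217412895773,
38923256322066194525736534569911139884546919991927674143717808130161050653,
70297362278793563510985767117359812043475757846531242844463906105754702026701304431645,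
63085510426787927545041762182638346682899776881529821,
42898842019198103693225477487994318111668965853,
186863058807183601170082141307236715308259139872713431552942295835423619936753581838911290192195721218416252461360659187200288530338781,
227051533395091619158892406667727851656727103497433339471229528058778291944353108879515009670002257158427716073026990322008613274041889322856252116308821534005365469,
2156146712746998090698127152299137619761226831963112576498722606029342699838483453718587666480583734235909595333557195445321122907165,
91865941249451054886823634666555706765650354974881,
313132540177154514773458433678146593,
12415183259351272640089793647077786184686428440950242491980330093245365277462848585338913821,
1154124818345225854451979901466900327182257989623352721600034003993522857802796487478842333,
324360715970567848267390619517054541527304326122312157,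
20120817985994297313961828539592315869,
909411052144982544184524012599491181840316513,
62084941653807148887954011836445643831353462526256594697354550072216206976615586923549,
3423625563256187929017167550318065848825052158844803533505514466577417245,
6240087026787486557840931730805113120145406387454800399069,
170700026111100494227366133984205954316121170739225354164886863743814135771876492317,
30411577817712767892263662690756299898450378126589383894274728343018242185594078237,
1838475266426692543913313543732198310941,
3065458437516819511702960752015427981929507669926339188079945456273741676086301,
13957050398470341118436451497574599228916765,
215839892671548088881049698117206606877,
16111317345341233724550982553144117439448747410982431132868969420049952339915549157588703130060257372497067780628922958877]

def certA8 : List ℕ := [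
73362253684012227923568162427667119804452942084379182433906010396339980546443141949361811905134785310124923915756880112605005443800450479206872668672989,
1959050164868113930654216607423590388206267458561856866619869,
102636513321388082042237366388527154276021256254699321998195927618104001565,
174370144006636661443668066004584666978417928542982323532285262838353501481471119963705787289633821,
294094448530226096758712331311804678735921087517,
1343869095634715013076915062824396781582873036808223782310877,
54670944449187276981170374310464093905044007948048889883868998568815413856175308788944492664839114167748977127043158003056940188526334238338049435661357189588387529438058275498657194858596269324109475531710133043889757,
1907527887406458094085976074438527804033958999495133,
207860743536489270156856021556803093969998813,
44299069642840647555552158554036822313271806893127635989499599830510722700541,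
41630271352815811875143818132122015933,
186194034787096384872348905082692472596137579974826654639145721759882138381521430686762589,
146230544273322362656093683292866141,
10148995313473453579147691553,
1943083016596627713200551311582768858141,
235506306948861652251646241617475550012500689327338919537057081949029658744999359985680602390344134580465072526530368952376328134479015481465719638472087501873824937355122493431789209487772381,
6183247990005790482877233466990932109726882881,
568945874898462423255417982413184929,
23363508424615687534323073520960541,
12756880847200606250077725519054484173338806422765228121672540652260491489873677432234115911924522610902708247267354786757492216927197,
59417683582797760731796673493473727334779458013,
2457982893724531383602725511746968366278362353824401461079477522709703070261573156633617207481893662761742791875323560989,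
4310278674641989638852763928406839571460377459028017027085325023741737419073530850447837,
3471022181613100068889641684488069605876434957,
753672063020290733531391281272850445,
660461170699764025407950559424858908722205,
2777481325343923783667914449451208344605,
8850290986740345107520648074906542916256977470179468313629,
225032612896582624405927147702130830773663194850358988337,
2307508027349150498350775186424861,
233387784249183888919139199886546947545224242726859248129754870995686638255137,
26795521427655715843949212861452382842719360557933388287639772676816876494947025949,
66516296971021072274662257815624046206681865375550173,
16330846882139603433037063927261792270950251069120985671528624172599184093,
102100713360643422249818643586292730840670077981,
5035465443143846045377438151934993,
54575826842218409148756523846876149603340241259859841498764440950609280910689309,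
462331236578459408087116516695727866909,
246136006295630522161427194234846250013,
4771890721826356846801957091877500036978560838077179247244503688742429206882747421,
18171530162015337281138607352755931796210972593310531184843332811299286948108731997,
821402161191439164581905435991049415941113097968632214908709206876343100665467869,
12579280433675978771907387071006640650444493367733407836834411900153128279316726901891674827888257756648798135546265668302527323986617232330834504562250205,
175025073761699833566689239568973208565515293,
10276270304576384303633061462229478923292342554371036457092985789862305435044760800650515945693156166312095138345461997018345291055156461152244103959657895622183645,
3472616284746120619650467232925719002129347805538915150931663348047180551555485061894112285,
29827430497234115174487668438141735531462219216765731933603824669,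
10672383840494911714193881205487021107174997029829084040049482660598756982858815525915576078420742694964866889475641373694407395186683483186974259344244160767202001358739727457631886431924094247984611959029854598018360304915402201232965508945945868758197875652635311612062225087732325210394307062000489437,
103969976952560452763990786610110054855136192235541379524402432757486401728219835004689119872801554672167254256161,
124615377639152415418887182379394520533258640599979636755771744896250571014648857023271691549100450604313657158131822909866914057674809044743513162242855389,
356062468459859367925229302315513189469636790310049335773,
22648606257865827657930865083898554342890314314563843957877177386013,
18847827156978170340745477319923675951736521510726720364562903265950711769800742042306277806557,
1014416129931165211274426879855996741411367130235917376888141149284955188994570483980058952733,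
31805250030499938591676140940901390309238117490092589545314428511416419357,
8005656397799324380294381394419302632157,
1744667587640523031334967092116567598535645,
5538484800724485487408113145637178621720010739350772147885571986818941,
1804958126739389113891768452550464611676724294460185777689850328169045473943169098935675672594371499363037,
161405922168881725151649251918673972820646968128249379168089560671624139432792012570590941089763961186483365398993842377907728465285054544621584851236542222813,
11791302678872978980514074847196148035773270734214678162168777178299062634166365247041158336063672797,
2336465879295784288710062437087843581,
976264781269060047049290711635911022781,
2490523835038385192268756596847560731809540174834422753738720017865613304691757836069349099223155535603239819002447520426895192180754808410543165858193517878170678128037519441796369117,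
10096489720246256590877047335572406882243549,
45823135014971589060223555808357683814172322393347046332195936953051179377531836377655771847936994899069864173131341383334429380502654452444694533573066860990894557,
1013655098207817431891750994996585042909,
23752398217806639515533041822212060766024467373102045,
348078728197720936243947015341878365176468733,
1211246921322821527947524165588015656854608672445,
1944985129184639632734539386398432189,
1071780644247561198742761421873492922541597064262166193361850122306589,
6493491377539501761951249295114952456456898523916159842429530790227341125792471676396507613,
5245895160932787307174143800617153758414389549621909433287709,
5940910605519997146506926229517,
73023950641827756204252897587234829,
7851986523616340484010176425305757729749105488254205,
257202479784124086741265548239000829,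
952376445157970330063931958731035901,
25536418349986922883239572478582840253,
81743559889442961318766557218747157976952881724048892312674016876609691696621058301066967832892242745796587975249032475989150044818293416249417202677092334935615280443233719231998490639627630181651391002632965246040441121906223967687531170394171052428780570836151868,
535879435180749355031633900,
4343895197230710494529548,
102515295532050518493883580,
80307279748388761509031100,
111616100423938566600205520541484422432254447577139969016823625483868,
220976517082016303375086904535689084,
5031999536328386546909140301749245566224102832546125517400769531924020060302205459910808131413278454712174538694832628757267805618993279397247429738159779901433703236696358333040154019994634390330060573090993747723943462273482799138060677222254,
58127945313749722326030,
106171852493942065448877036769745372421334098687984271576849059013235439524661464305658752434825123032308042638644062219544094584727253100944329,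
1225495457705748953127811487455353,
114217059455861525229696823165688150805311189403430961388645760754485717224916295922503247282146937,
30949150481326642479772474461655898980529293220653403481,
438816122770145221699406245707321,
17290517563008405929394629204295225,
5224784992445791120118283335342716807570228233738265810003122009,
4676541015785711442836468137875692475232982654600955754306952313945,
1309974785979177703809737307976688123146304130906501771631266929885794927274657985549393058121989218771374141568790854128330336958026837373285139223444678663629400959989148287451055023107315623793522813883,
59227839320187659767819,
347027573660453640337034311977897097251362683]

def certA9 : List ℕ := [
23942873418577147362013507722426067995637877543857527463039924648960055351896036956036129529223950523135026845569632307417199629,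
2222928042360623676518041548284312307115817921083704132304037264127,
2645933895658064428927363456566008581372613831935525885091297325941556627724360096069320178622207997257806219530506283464,
51614329200437335152544468419163343172067640,
3254657541882928877266292422695131450379132874040,
9554423439542955704256978922340266303191422020040,
17653396658136746273133320138059360712,
77611163947684704525270737260952445427206521271597572702994418692466860156635580736309728122758998060993828459263724858,
1555178984419299928333048243647057210,
9771903080993524518988826992322151604641860861642963549818771684588,
17658266699946320023261461019396862]

theorem certA_ok : chks 8 9 7 910305201149 (certA0 ++ certA1 ++ certA2 ++ certA3 ++ certA4 ++ certA5 ++ certA6 ++ certA7 ++ certA8 ++ certA9) 0 = true := by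
  decide +kernel

def certB0 : List ℕ := [
66867287902765509142262804311329890754048672993122412341045845653634806880388017558226977083116333431747236767045524049029793569760557945114,
2695927931745639498262927687185946393985437978,
370267108578869992301952342357012154139827740186000928537276088386010275143871099013377999902180978630449473810869221606330035997976672406278585535011459188637092110990096262831014320668889137436705214222284251704773102862978451921715000928916037040038311711190899103385674109970874681267351592207639360812860630767544913724529924271845617856797097456705819946907126621450336411006373133026144721571117625761174877237577234481948842275085,
104280320374166041824939068025206926704278508849334,
2231378980976287620528812864678678926998219388918,
23450196606033195823476286375774418492354064403563067581484897183562130071614245032218,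
493109387163223270628568553025413700979773722,
555803416149427320530686119788507946093774672943511530,
1591837969629708802831109224032359490544314132833072010447518421274,
36781601753466055420160132156661158170,
3729607022077093143564956048796852442818263888613658,
241591129935047679165298107190723260063353002,
109470993794117434542096115597404198130351584775080091452992634561127171582984129624524968,
71926440792036000290657062168774027318,
27624027502944302204478655496849115722235482893912477621249034651817,
34308424437990098096812225330438,
31428933652347819521519334560707538498191663031183777701895264501604663984772104663054250469070277750170615299394291119832240168958275078584413160747289,
27176720682997556876153730355558151393742019713942137404382255371,
5745082284771937321756564103006162851572007590362410661170928940634566267292521276927248673267990921122861338,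
1483689244746998671763805146401167552611287045056405611071355831984031932711003447581869131917947833485750137346000171195081223668518238217601582702480775060832001859083744935350919707849532347766217933412877748684958,
3030803963304394366051506654218398,
599083702615269618328158123803167963783805045519784079614710455881160966950375706,
13239071746626041421709251429749589383781420687054018671095302891313609014383713271116677889854222087173957518901705350325371612978121224401332671099161,
5209653848171155921917428994735693903674121069407722,
564379166908454691781896410468560006279884601175530,
7484858413682923214913185092417104594558159173170652826967450,
30788696667019261567099083820932990177760731052629226,
40890238601444411262256131105339517422435107632764107426475861696899528899837010952352189516471252399098450202,
1906768061866437565880542500296201361946,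
19938822410832059844938931750448987380169649579563700506,
260676144987408738169022216195898798676050870901845457176410675469251921088937530343586450873468813060828607706739976601961683446640913432753846500386404625809362612793667685359200408191233214874419246430754142048753712992501775572304013000421286135006333829686056133716838914572248024030844236880072696663505535047270510994416620904700060258120295812745212257638675440987891869657504740884001222152569923959394741073406610907636547264751853825595594076651635149654425634223874397864658792432235276954267296012,
1914645013544762625270937353954680142864785346100875001415488923414579370,
118048230175295732383623722740981999638454886618687518,
6605980249967024409203300369774703197787643102,
10745863929241088009961113283478959935326,
73619586933624510513958120814262829264158715821121116220838944464312519442520782457717671961222244587134770396989948986607844795032513179583910502474,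
31291991208342288174120263386184825347973312700602015564364322631048307286274703747420834814612450080676375264257289405717417549914396642023707189975137722883188075536227674669283795402242659295564682317583746144659156262143160736349110048925353589734385821,
1123699705600204892783679604893,
151989313422309959898474538,
4475848574935883072446371198151759688566954,
608260657145095637439410079618003666195083915156772393,
136047316842853737863760554153640970127529,
767106969384045719376018739649356902805981595817,
110431507896261136180583864004074725042156116272894541970130667985320536769976816773269119332983348490058610667919878325298870664550426176935610538,
98127359524636311337120420202829498538,
31374067799116095160889136939525286826490291016592581117859816620064525035631412223428778,
119125081692855299112381247919820721568052684261141592897931434,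
398924383059850632822581621257201102473966085033624094890,
1312215584826003270493362218882863228755355330156584527062604851698314308610438296914818990434050662976155698431526852175815302890561139865008124588373352658739936998833833621912597424125171288270242083863307546243058641075167578789522244202941739751572550755373339636292906952860,
2204664224987396430521649223583177712724817368405902215449909870833588317501149830996703588108549216648726318196407958835812545757614949825734452852668390927322396093439154519479272510861700744523378499896031758840240562882716,
3730787464003106401587334214692281811783141868344949794655959725198,
3778086123746512646733342400192873720117687240660698613123814473285211393945115637313946427211458869318561492871569660672035568550289596869565742088856641034,
968720342232761233050516133008328294645528896330544805385846051376646635494069865250598627993902017005965882006587669626673520727204785566603185852555418783670765683267698692831362797314698068473374440248579521327056759514140246002237624157,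
2563177950446303860704586364901676720372484896039333772828476056653597741408009048624307482977646156137078781441568465990940737735036599751328207108725673647121003244967342129959633692410720010,
437182364013601880608226119234453023752222185504608229692731991725617441177285827399699681851837926798856875413659227121650495617335791715205261006996694344166754119853363044532612705849277200736933903631837533793790413518158030357011393536795881704306990968179214105458592672765305528476548469339124539969705791564987044497566759780286,
6137384787109213170234866636576105830232909049400150210432327384556061328260582033704810636618528887817166030683352751628900772789627897807895434070220771759705178569309688121076995219704535853091219121824187790125764611741661692577623846653855347039754,
15593807666107338011347835286825322502680054,
806710179295487453310664316285329789200288434178348249334615337902877164249772169,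
1406930121544512337433357135529043550598194790035353066,
7601441297892037450935250951485414718023184460374490808741785064764113174774232145760589880803654601222643977835080477125203787308989258404175706142180558905859329298797453884959133381745828153471190874454104359293231930604880654125243916170540109527826263271051017532752531237518913008887970053311369543351365851705321967302369767859897084340240700318136765651426746061811803170124312288742475317560000917408121742683659994182618208023645070403540955377797012473008640072981622703330484060,
3646405086753494046013469189851739275841978570614433343379775130877589862216642634907029425620049240358610607757650500787185980383720089599652074295899604942308181031326596954,
3118740712391794902083152881334432632607967390611549735878924550433429941458228416948600827408614362654841547953489348005133322555053759784203735446049716749390593779703723211476654260660712129806069258951258257602865332041823254506,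
225100134275967682809646090324571282965604775736749157400647989550201730503704810233793308830305061457232157314458300623446861354444729628382139644718559438221098167377726672630304980410427705389682245974389811449559610319666694749920483355811249983654231698084122906,
5329438903665581420214173463888028977089479273534058873235173962,
324422185279054783757243813767871581440701002,
41888205613842335178722380499271016522,
95106966631051190253167912423180460106,
10285334306840356415996924459459761385636106000584842,
91218172411508058045798612194386858483875335097781223295569649085538662101569180174495936143006660474854316906424868743537600268774314811150718714857814492788114815609220135247551455299959709893727685530888511454834403084273425625882990196308234378,
186626205426027414848316439743986612842568994795792739687269237754455638166663865067000255529708913016603212632568083383309988570114686861747267059388384413033731140198937031208290775459209910090589497799035673786268817651529519024614877629507990992400466937006899779627769244820731803131272538794583451998503766790803537587897752699709631575938914215701803525372132263797373138793082539223380876197589161858465532760716058170493891567726543841453268322727710479811933230405343382759993633454468634896092124723910641096791277674587147373020344912623534284592231301035493658623436742564713790384418314066075363255810835906838237913560252616133242059859165173313178161979325,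
6030377547325767475376648635951053775701255784150,
11210965443596251561736832342356272541635629029972374,
33985125092307813630520727570749557158592214,
83322826189123069379609989017622,
179347745337693230740850405775430132673671565225189503672150,
383123973041699883177350928845044101240241117308394756541681640406,
25047908319807558043138407192982,
132062992774752838659370256916301818413552277560139399545118992698544687605174231126,
1223252186893192777479383992764241571754649023629351488585802562455801780433407290400201821746612268484105262314552204635233993,
128906153441442561630815583832135601146361397438049433772999281542319138529383423385538686526810454381974038767922663444117298915456989491337,
30820131424952090310928074110996809757027601886258396162841411918498837408773102311042648872277445040375958004389883877285519049,
31421662034378822591070948670009776039548426795614124030681119275051587206372583523573419836939018,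
554606817283490011040167717140315850,
2275707180980982101788058030840049974986,
91703162308814888697838401541680216283907888023046320689084162577788477185932928035290492443852961924705453543929157700733340955281460888098018743292906332500788247252792969627869120354424680370255478523505458890556907840198431250291473746443380343031928527701893880160390079001768442372427288035512593466474097595022401112008087656954284963746199879472948793921009698851279064341505505024732388578581534862206435093606704708175242484279586512732179263750357831870585495268561736282906433007666696079038873047162897185551561377161256856554795938343037982897651182586869726749876885104591012281372174214280029118518096830038168869527432327029380738955244578021960573534846782537634010513801844231349632103421774467327000209907036092,
351288938470048803960440576069851180630,
174008291689688066742612097019425684700224032173554228407060675148085526849911320245950749309292381004790308747466,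
80177228723119384832710514583926396131790565484713,
94869179003197174359417874866121520696689255532653644660377045303242,
234631234913517937108321649731661906182090,
4382351594532603214215401421500675590260497729131838902566599655370,
2676559576747801030563709273055941590384586,
54136780674492104518687842231339010839602869560223561881414538,
1315246392339316963581714715228952482212313066,
43010047832672685188211365532141609034,
5606418376869620237134035479916110073994,
14175218249750590074425392882093864312330,
429428798372448177135060868912791490648980415160996457445354,
22368177728422043338002972680135606379050986,
158281806268618406405344233530151620941586081128739419448864351223838563517030482065160905849165097914506]

def certB1 : List ℕ := [
174549893034636661385025202684014058,
11221433371957483855143754018138098062695669253104772780143755485831804259077346982038244786922561595289021631342239125363002375098190011677307859480522259763605248212548718302074826516171086950076,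
380784668517285938885788930767638294575653295976655485822037460297004257130296457024803161158946670781850959523016630209924985759291157448481017009818911918327959604039341335855931583493676356575405358039126524607597726456101626711152052176011368493630724729483561819495122100234803080893423303843961223587218934623075126337078886995070308209266379110104607061452178738443481100970764241922606575195298105368466980243308941566906386310253819280719776776038497553925008577296850186169564433407624652112310531985056823891965798495979346130063954331089271460164868036092781660013084282586207738389336182068386606331656489519735582663526277938522750599286497406459742962410169421490105399146966166705178098566267707702930357886715425566760203188047275121668695167864138185257183395809364865465585385062943059585671956255204068898804617504840705640496606771790167132101776842615945507624676067975409557313031947848051646996831795996770059339061071708492123475272062196830474363792727840807111630556699139474201627069284702209119967954173507453424010747224038322578157407341550441119601490315819437382080140376901334904151590618042773419473416013750068630535908214419563660297753087786046239754266580238545011018370535933137459285733663883193933762638869929418978247908757852303,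
129881987924503385852047035280682124825498811316140246,
25373165425126422832798798140061347796856277319353395407886314104240732570061487962,
2768738017941594496260536047631113832308798639929756359869278253974652230803798155413119194,
36130776366883996819443423476702473954721494,
96111340430480212142379281189665341540689407868584487194814768739390801342090445348410260543695623298269901768458716487178,
1182494852906218285128632561382312208041353302,
88040934996441492195663330458529680434463899108504707950105692067138747569135879330299569136836291313358759669394540626869478995170948133840154809766809680376780316547069501608717426626818120211001498,
8069765424080978446669942950451603961349141883128872340496866922972189190273376839297597395498221856067385434572234507571664769499236497102865864180255558341606280933761650975975380723781064718950592912002967490448493586044570529433639769957917178,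
3096689254027617562484374283581758275878102,
86668580063679277274300431092501207987905429729741767839129840798474226230401228215830117906501506482349751694000610631322,
95062350953340926454798927515127958,
144320563927506047442311445852535132492265853693829009385348225024897947876336733812057692285644602841123058629888272035677137119662402787738781521335100972496161174858529597919975828004270029607424137,
343669305868828563498735094685193,
18119205120961574636452572713242,
968108395227549535853706259487547376354093437260370098832049568098146443373830007503367735415069029305220904241289636789610032365825234372479888825307392467562862969202924058925160164671815024618606783513546350076182593482325286965430666846192021437993875918669137284060371776644626685084344191403670307717756247526870313349072431940846747981932237515563283654992615676863367130504482383179927522970081192189886577096960966527238161723568762948793836292014872919760664504601598002695739628189484542152731948641328726047549,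
111740396415561391149964678498812292667114740731084502,
4465604561225229571302616767800168875558935930373422448577487510437590,
190466826243241161741852122691166726971910,
113629835089043909404564548932171886656347599045504701644971582762338921399500013873261852155838879924702154791526783283026713104665190366798882713450067068741385786433173731522179812355204195370020638394224094876992585124493805636800435101096016008755978353495175832677870184540521876713668044463827881820569567281882609281329790666,
61709830991291329803967947802714153859415766,
13057422121633170210428244332000860328230,
25063464407565414347026374978441758727543744631190487774547866896041431246871170515094511251855330042743315831249866522282959402409038609145066187570488117126483182780864387985161,
17307348411690435000618032681934345,
235731896682757051645349498131250408141429483198695746264466854734556632802432834917535191868492349317184253077125721004204592511768963722423006166740092750599129715899515496538073752261338933726741395832438229030363072740548990373879454032104264745275786206020511135355596266,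
963881708407132592475484376319323914,
143913440334781964792955127498427446,
32596892992621612006323369448827513599099810472826282371860767392947878,
1429285909328142830446047034994903241039958,
201823621441369916198591302982395096363557425014132852625360748829046135043778530168622336969956660350821908618711190,
204456344269224234678090915487960314500386966,
376916635130932216707203160408063464570531717206,
7283356482731673990227341937372468040677583030801356855575629718,
1495878470297788443281413672858160228811782998,
70548297026440614616024550648559271830328472932428447006095665408636263958,
29749712400568938433484295450826912281312444146998086394548198682377,
5907555267063807843792921263203156288457842198,
62675990175317242003636604777726376156475995064342894490447012319369,
925528978849505817346471808261295437430648484428000011229170813035908535077691020859896932707037344194029771481576038490126247241442908815960562676324833242480847588717224315137121782561312415091108692502538628072042266999055477001950613476432215651703153160676466936417333109785177590918933182907533507620120445257323415876800539371790712708341100663732924075721337736296800477700608948866606951619027749607765627487300041028077470140111414038480689268460566413300586997255298815841000776708487771159289998197640293833059039201147870385362363579702657576674631548110416295514371405471797866246067487854629319879406930324277730718526846760873070043155440775374565696439217771964453446976800851778694652422719933561794882023838553609589048495615715460418568082682112012807142335581531726105804498205143799060563440073970898134102952052892,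
24897816506377790252957836623803393302,
24068548817369858677233325789712072662,
4009389820310965069623410228938,
7278456347783821612498533116779687247182638705532918155752528413431023818098393341990934141025517039868096008581151660438807018458,
82550508686403503911902042727430739912403230077764517369165129519589494843854558695686704760743504032895418733673676382512797322309974824575226824230568133871309778235334263389530,
4283169904340914829107480466169836064128722878598,
406181935629783884374052433959060422,
1282853399753094741397979551841936639936326,
52461857034035751472816521021557059670256911302,
16736505441873463049759836813577147269869314161404283117034094819674199363471307898863832408703835086989323176772831930998682121759782211462097037867642,
1167183017170567567176188532592845529137330742025835219822456590292592123007295552593675181642024181249354,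
34476787418093233393018125039082963654887663572566850170,
1786699986677324105082315271096621261318,
110272015944206631432764216986133773305968216857104014474097408686220789562,
1170589180197999779424823432393717380502396295296661145288204368314,
240230166647172586668147265052446904319215744890,
2961001987582211130910373250032437511828297196616019663021817178,
52563525511221582804914945303606556999526,
168489129387778900520913706083261548350195416758301408490515226438960039793073260271685185306703308417883126093808623834,
7962942774998059134217210479528273207526,
28502830103355497954912667779503604581869476041470167130915942362393947265158533706211902360060661112692706038504409,
5108668718980858297382106702342365978933091610248224608206682,
5330074028230965920239014750821721,
142857461238919886808271673139539770060275159437033924028755525299066337301791405780067415608321358073856373153630104795623617528073416153009551800605878943583467705756421661931569657,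
300201424630652589317175381819897,
184170402248788111908452845207148847574,
276692951562363855429782082386429970397071795285331347082010115054583930,
10544247600595376190166375905582923435764011848521800479343819161545246301453702809402,
691677640529280798666649124284070833058318442706916358586,
35701351632788318254306932133145394621570433432441609008522396456765292994602195166452702888939949150582743724554976579140950964666,
7713111379613874661249482261380095818873425991007285884694100859930285411420524435931145571735014302934345509571385942055086817877526808843767875686293767776413088346,
21744059346101805323067179351397683693961731475978586,
161039313384948835705032832420466080090,
17122403110865282661529456071400716804077975230347339699066060748666,
152565461746794134486015542357733191340946181324200425818,
822529117218963436598320716353253783234554969767327500294290622617407338410088217558996489600495000843934750105552466361527431546785529187155290,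
246137750835467318264499549840778399296875895234993651775769680272442,
197124806933039001430048930538538208870028140774838554,
24981008411024981069293313859055277281380641443700350497932932187076696567719809306,
268134874107271779569511358989580109320077120583402607840253455129593467033132562716871542075724348498559932192990250211181863458422899806544093306842240202907165143838230198411502324374483825052324019785795519182297305291439695734742954282802602023036835832286132337162135720443821768511052847648064246847973695480845219150066773435885696817249865563988019975903387702869876667613505886992879698158433634005504913046614090349681098937556002323339793646538736133184436160128335623356465250578575354490913040127973093310054253343660704776021285925417595160029140563981964994197921669123562298351840876172845786385724898907644755474152301174913635598013,
351288938470048803960440575915232505430,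
93613639556712553507903892589106479977254667944711892395059420329880608410,
164411836661992271095924499367988572368415581690202837274,
3994174362962466327180881583972361142113657525636670731463476959621518865116917106895177749106194616047097087605132285891760125767540417342157213862574945265237889274138,
391122882602651597548115307232789781506786696947444546336960302387187994,
1268925605788239532836089827487665673246752762912770351429774363700827975523650449699989027912326603302052964392601515166395119168031380677975770744136889050,
640069344683298533839909511337463415219958063233529915038694730676441639413600385545493731653899082177174999525943295315176611836490796731483974786677325882635231802918705196582654144586305982070496626337602039134159999751387475760865318714025456101624834121946,
5690583432199650047278825632691237565945292038080742651462613205064362536394086836115047929787144217479151648339975219460301949921826144343983713151824727175343888627484358081229105829345647127952108258197354961758912963630160532169236791768906496973642615698979406776352544748613582049699685839020578315071702700949790801479096435397369066959611954923427366848559982879156454132798545071659903706352301567232351012288243143284447439025968980312956994819160579918309664560184974725127085745023116608462581662223785571407021025741015614314850174766,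
1175913696816590205844727767426072090459221574167109561833,
313324752797546001028223841521076708615576216025790547005289,
1498702270549494053310579800193824406252794576445526030121767089605550154,
73061735689287835098890966982204297353858638932856492807244658044002522,
2684471854735874800914608169303142900190501001446430718437418,
565847880045643141255570186506619832039578858,
18712793380972784289077703608205418570,
4243708749143664712760404701394795077706,
4787828272765806666890610179576304607306,
90798641548278369897779415214532464072002974018188600677789015274,
417751900462412936728481045758966919654929260817956984271525300052477842110749079170872446801186228547542242314]

def certB2 : List ℕ := [
4130939132068273055099836494359408546210804113557124735851991365551660461278786657991175407563994524779789636045949541410490930477353766521359128669401874267880274150754028280621633773386434283676,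
20962950377254858679674876785185638838635269373795611251128544649570737679609886086519045691774,
39554039489117196225516897606106122720270493455140895945,
23860774637200411822588118546157113347596586225104422831062115405957535404702729504938,
173231506686871786589591309694784522976458,
38044761433614323816022245639652728858220687828863874394532699287395775418598710035141874568690962628038324651524752106632767716583002684428948090225040608211242401201392913103194799902753783054753288426959746084217148817909676422572817318545703881095257991408141221953081920912021014461569802167076085866375858917463280101470336870805053553853,
1468197728406867490954591370894729149981688785668497450509402504683006269358640255406306893125961906264288271785668671322660905474099732607963816745509796626259246907243299642400380126099402328399906284967519648216787859816111628511856439321427069234770354641887030152485938163114013382535837798617865904809966746813,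
16103495539862393577601971609509820346590278007819011818397460289932435154413751045647629353338733728392355886909989548087524853937516106696078054689255468709490355013995520175526614685956891033117178182126137946418845751946303359246311815806997979078104909263101804888396916972316333691362137176536847396799932992505009696652192273037190439475922390082478797361040408619766839758996016533855117776534556520487844334035413864885411935840758388821356825893140362993726,
7609085738690101398060786903319511044366,
38196287221078394673236211157797900389662,
54006619788053725795683321412974801908666638,
16508960644380122660149616835479094393133514237689727134,
299835618974536148134656426413655887998,
25635138276250352142934273319339616744402093491837468173905956624603903311758764004014159300438344370308404411605057626489302858255992743509096143754719251073814317776102543078951534194799982944261282969243875640686353871869561916530427119308412501221554161169334865702862499415924082229636889190464906461395308755278429440126322960719829663643920219262019891385926982493723522738932012329235103304037139203743662789538600832407052954722127836841974236618132763217693701046800265403679482733057270686023867189843731022395258304445014818472729961045778292687517293940780209215988791265925925620815966320,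
1044043041435474886229904263312,
76721468775130890322484999660885543437859042236822,
5341770405174732735252926459718610110646,
3102814242135690587444242023466,
32952448896913363839077722652287378741447073787514,
1454028894136560106008761229878508025690,
4932799153740071173852461245847001142592383556032836664221229953889627919569937446333365433011537853443922688287494473897,
1724569034068551671905007961130,
1795713489783163249915514687409258404698,
8044584588341643559803688671347839021353025105061439095673271338271817805524106617657272989316851979485160686523169312170382296617660676823728621737,
177897857546617850268907554434595970857939766133759227584773322241256191511504980137,
5214696013471902471554364462396093122774034729142,
92415417789204631710527712380091801052904428320383594498217,
818754035265837247370735573194,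
120627016557426355824062442154096140135722488781397307258,
2468759613372502418037319066467383421217236504103393145201860232629864181304455573697322021846682668155078484900198300138922445698559371647990045011577350931021536124208667135401645524757786426639448927171086505,
61698770773337287805861675180994385757138936483311608286088856173261754999266612406992580690864035963894788984368189312601828418956583632615627681457393454527422761129,
6886024865319468081296455805840694119657143460978676971092490300396494836175479553070491877639934536596651184874905634744749361321,
990899002435993366019671819771601676406517269877411493045710332840278326187962458227024284683110831877825458925941082281,
57338151432790887845205192668975380463309637801,
25643384327643764642235904550273451788457,
818124844882605437205750602074,
818651280478993523871583426906,
13025123856271646906388166669839556997228304378358941007682674141993326460209334,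
55085722314023616937106669690854356506418022582,
9322465019605620109048218083589648270952630,
103105950724299098716684133561717729523214390,
1651808157342573936698041869881482199787309238,
1669236428041712771247542597912424768800950,
831489483217271218990001912506,
2240950723313291406800048338426337197882,
3973467256654707918254519420611063031592880546305386803081118553540301295347399664353635456921111680949502116639729992475309534218332667094898187333242769958317018184633096199441207458792546104160392,
50764134929577576787552656760477610983733132287342746,
1897737517544640351687546706639380487633934759926,
588447649348726737341474873530581284267364214,
17957744228387055214666399516113146267995417125997957550230,
21697860236554144912648668281732654171442696218153110,
36726386493659254093291507649182885202000408288507456138109533299864110893039335369479987272151430301865,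
8483083859021911711088189345682561142,
4161142589386591031720363928922,
5564282848660925500926089501975006747298856709542037512428804103847525291857462,
617943453213607774793901346975740141428738230,
15148818029703442360768700867787249889016602665276472103062,
2890537274658948363914214130609915157587628182,
689179119508615904855289888868962820570410988250618093157650259973823606718367174394352642416276236100021396353140778586422198241879486433310529471186204010781640274184470179284814194152654734991181911816681801896,
665644555245179099755636830088059770279705854168378692546812020906,
576904141948155377980274958921423880025880790358508372948519082,
155774335640657963222910354741071240411806192830289536375920917992900778,
6345667231353919744599530574864915028923582634,
205091624584758339607563973549818268743716814574639133138508204651023494864092654301535768794954828401347207696398054787242,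
28605363892673444712165847268855969177842642853983160602663222927718233276712123986953636656646391978,
15518500348702889893211997476534256068890175169949805487111731185618315520226768899999914,
1928031164270724830685143699405351129666677545909417849642383863664488673165387551703789538144254102742075562,
6342040243497211615453591959036180564836551122913450,
2907473655418253289320884966584048076656169862872260539893336234,
42955645674966092402101843240262347617519236729002,
16953444276676379316526399766199583574321603505626819925996882667963225477832149162,
32970557457028590804679376121182110086130737356045761110714756340565172735668228408980284576251539894921252632294309452066957748653769346191225222724652929429538268513142954,
8405396948651342924766361714217991125970028584925671399248747497642,
212183851220837788208167509852375512353015978,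
28726434413465887671884847326315287611562,
66900700125346859392593993292938263073704066593654850039761066,
146151961212620447009124918893605487792830674969378492094810282,
1114833495944672522640426772926069652412146009124651337898,
23493995268118551102231766172946622743887060946014728816810,
725739860077260260437294990205244079198459900779585085792187365390653917488717196811771648180594279958766812747848411839718014535838066413851427752270039104003797628723908576443205802,
123445742703843739425080314787318867419304327472908458,
64337516576107599650310744329900453645149168607909050523668021916434020059305181951159109802,
22821710590079435713687755167038674641016483952604148824563853970458768001090947241,
3314948595502672895782261694834304903455942876659201744179057674239621738760361,
3109431085071261493542964082430743065148309009770391472373336233,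
2977105212023471860201697816219274414249,
131697954671289864816550008031401,
1624191523042399797014796585836447913,
155227743781130130534578902605401484902110568182597873293160535413459113,
319474104034223538424851218441192966313,
586735714887947495744163194227594293022058312320823493304661423289464516633397417,
204090500721423220117276748758300354171334316921919571241482534658332285552242040815910633483736168957408737106587434719942405573732007738982416223624219231004707508835332364435378789629952715513181173531175508972784004886950630430337179,
231727986293709455031424111970444884619381201162463387989938186352548820303711284673247834748162145573218488550319136048247135692614009214725859169395973581637613657815019035567144634464798960007641752347894863652486835976354668575191155006859078578974440359964316102937,
14762055228312447434894645160787558875788841758945870200951258360504222724468479784143018,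
313648700736067419084268666369030,
180792812625289089680998751116966,
7446339739312572853788244946266,
299706324014186784687050796158213949608254856023919171439172009510489248424020980296614714111969117080096613258616691507715691420886080063939078,
17101222801780051554071415432601760009990149334961295086618897632524138288883958845734,
21862628874044981724763295091405089728671178475303471604596240695098759769258991139216683621876867253262102125310490025758377650345]

def certB3 : List ℕ := [
1199898464569129921421199942102208844119935376249268520754570664986261801632851460405907305,
183430540935740375431239567706016021710752854624366367805377808127454376650704736394,
32613330504131697925284518089690407830571577606819176068525340464430174058,
195414707803975471663529636784770578106216227549496604007089641346772126082173119733825739607611370509571262967739105379360684354304640050628067348762,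
114822073480139252706316058221115625754,
10866990690603828620999262930497436057339449626,
60639856162719766377940537822572496929376879112430001315564887951165887694350483494095222098837188815905688472285471536260238527245812288712848033097712509898164142119228233269610998196761885760211114,
711926573322430007434498938661411738012534954,
9941317119224620966819689052534994789489887402,
10112850608939287529057655389092410335563532458,
1747624039223502305941038186897329776325413515896876337909610,
3760677927077015823529580600772693348110165061931875578072938,
5656686301777256672714647296673992553185601696143992003433464974937773101609304321671201689772864751786,
1514339364689201970799228907179133098,
6493036463375424313509106728600048255699553235335591626783717324733725957426532923205841229615738917102679899585966808647194055400164834170786388627924151019445362160898794324880467989114504982734300646751882301597493061665252521475965342021546040162781936590676496779198789895130457239364892649477424212836295022308092230142281004213513603281571629326559304884703517731592348,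
307661147110948979671550108,
1744500688468244581692876820042,
4952049361489941108518304232064578022602,
2136646838603597253410823316883922226181464582,
11391657741927339913311386984328242172461662590808321125818970930750431461922584278515259183808711930305244006989046040,
1182211166059920261500901650748735618323841782815580993722006810760,
2384827012943395067171533041274600976394030943961807342719270,
221005236639177173755443403736667212664940867037080767196422130694031329622986638684015809849504372406953035637876391410543265849012601443289033871777878474923500801755892728341590700117307404569,
54522087986598608173787404932214598961475476749711384695499057482183150880327217272671009631102701517389197592130465858665234413996201,
3482029964275479216114787747582636601800786606240861401431468662262351998171942761,
25075321946955949311639331251493719347481,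
2730726716646458496124418707430690967081471545625,
417709530297207975606220226766558849214760275755250137749949404698971218415596545488993854246638706318237388493026746863941636117042811521309302883103744455906967460236484125512474406407319689,
1134293581327164818485035639365779701167836026744249947400574863932511124631634389682862137966273083746473,
2538897168125262478272416911641,
8424458736618014122614115077333985449,
314549690982232406085674690786436523122668479659757509560843680177695800515816226675849811890722311647535903592912302955080012948045914271509589943561084875071110747593842344061083,
335361831030637675369819596727410875226040958692362800743097946582276624396146041718012701599630072398811900643988033959554551515908211861734736091845026981704131386942182029096985923804077290081248025389858217451902065889340040664085202048293567253255343244846182833140991528856199943940251,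
66989115091216736002188109900495991472945420809718316461869989278218857458747561,
369932835007255972170174873824749737,
21143280903159599898766104061552809,
188496573865957889833037807158132004878453403716704639482093650282911273,
418902045639055641860790347013805611151080437396552518413444378085812379,
380722380389873492063697799981384126094540591079053,
57348781804581674272407661910981993671327702,
95878725779522528374629492004044885,
324840686192937590357951953152650185572245590,
19473738962505195827967759300282176538706044869239329022717838505575918360513698601122072003898933709532228399063360380086564919540888240826019017018875730792033787798815261008207708127305,
291057278549209273558980693567001095391033220029037867060561229814,
551305958019662609233168278602012914116989947607267816347745096137215862,
63289463842476778729445666969984682280259719030,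
49923072450971427543551982032208252776558115030901891232072810061003766501579775627910990178161999447374477383639704272723850094047224434194581768152005460918099061795127342715036355882233408860009,
33276015423673391749608171275257946816305118005472447905984250630937989527128330282518711924080030149517132148197357480819376604221419987294221981135743719507193317752717684279692372877430900636673955911140514459602606895338098444298361048504596634660293731765428547352824805901127641064498889129930,
63100744531538025968498821584076174300895886064089234443647445550823343530720538450428205927630322185131993257,
141858645514338417388088867240217317490182326,
467569748815246581058729692833213042613801148113065034750967583943819821454462806341682107351605296493689316070417675765139236222066762,
81005544220128448117937369576549167792513601636550838,
206571917433886717517679745738715370245346412018776203058902092245960060284554042736628232742705695287560746557418412367946,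
200982546095746190611288536292432521325198824688283401960080405879178,
9564184383711566989215756222126025668481162,
92254331663267556935350649842628318926450021169718434280115223815113820330,
4771406136688206366114784835894401968482372614201757927649462442,
1299792834913939573726166331606330932842164305127707919958317531023530,
31628762826967918322558955491496500609036467201069109329489184938,
10104231163899915998928622626828966531647800914516394729098114451769839933762178730743316677365415058523657324465993877674,
95546877760916043136119246507711034212789069481377103529166129322,
43006273992173746782993109367647847446391145091282310447532202,
2628161186779053825466875842135487562771169916870395110394026,
377600601164229035283089787717814661523899091090666553010829504636400695706979149084106131795580574614418016141654427818,
81024992138089005687287805045261592492574890,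
229366794624928028468547302249543394500545817227840821836856461482,
1412839103892712864762033805436352589357429582432737424044089833385384589364200380559602905950529203121495809511527087732641291539967122242543579540968628687668683914692578310994302160478717685480488965603078812797098,
199925019350282885437029408991218630433582856533519906262780062,
604906523390346835151079616583415675671709307812863765082000989972195419813669383194129944150036272316793277826037720878282829327605927895025195090564538807555689541880376196380996425871341533194423985197477678716871164856490,
282779002833427551718911240601002732392032106244848287653892902466666540566952302765270960999338295343621939426173470100195958891838495143391747229106317584395536575510469034386327310221299601306847402,
68337919956187080174354464619835754059434154,
3438708795948480941577535066257644734783195306,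
74487736528381941819423770100626755193002,
33139807997111708262733365671095340636372688324778,
18321163129317618290147590598693697605535328358552436943017,
13305466334207988475431893808962662330080983207988105,
35524147938005693832748875998857953442717208550833889964741084651846909465757865,
50752116942270206431019461589135793856466862462931323275977942968489,
6805966987741638058374184984985057999777634590776257129,
1188559880990833503799027506094357140361863110935683994613242431657,
20863074917784466863709585860494536116393,
3472635579433887030418556697955807257939592407048027646753654953,
31431517461048287117359608436565727233355095146277612327049,
237429559773404719246808838660707962534466365231274952873,
772712983006476266540552392176582403438592908139270395104947918579319473442173118271759140310613350647337466587896595368105,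
9828349556892249094434944031734571278054944485748390365079588071311529,
10921916096640177812344213881332321845736521885768252788323618077745309439619562118600476841,
877419965067242137952299553571336289273476127516731561,
421622913988097330430657094242505680401011971288085147749175685526438254664261444283409191836378989417044136,
3228188520632329941762952326875286086714352428349680189125455414815936299704941834923633110876553788356665651708615792675716862213546533927319692148563573310919226776613556833841158439132339694266308870888907537111797337133043850,
15405289527465574046997495439868889066674141088407879983548334860624391633983349380619467396064747878364423779628963082193125497321722063562763605567196314582156474718952781240895231849619761642101252991681265817140254729003774658730,
112893848866167398435697328557969233379634724141482914592515224353655971906029866323708608418231602197808651673040227940050972833309694672932058297656027976148556419300838625992215683253318076586,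
419110287856887728893191670988375270484995676549395185771447450089727803550153491137811478373571266399707629957608091882737840747827259890157511853624757491145212229911310363555790406658889309830913170101790536093227718726937861596380552478305982761130,
74643343725987016106925004385561659678594058410,
2616737702402819742186351566441771900387633340216797662469346083017375473950502727986451784433480719548099816526850709404890295102278910028066340999501434270899358300131027182735918492584493337378332577067296697126049360750326279258532669777207528841231030680937373613282760973841763262974838529285051326652105621910741818717370712870463573981343451688886735751954140335596646498743767087896324274241955774086333003905386989144034092969398392437260102892601972144906989820668615143765936284,
27994100585105189563999076933367078514627339912880222848100471203582725416,
1375445087621805991392180406042288329353108469,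
494971026823222277817820842074995010807856897256783188118,
13255198993859460967969507743889785732425375944930789558,
157995807555912303785469054908482632355126]

def certB4 : List ℕ := [
2549220147467775142650994268218,
4914680707638793991514522194122,
113111720987649620404625385991486812808191299425177237467447627731129218101926600610196745981893388759588736442,
6775638389626102870162519035038702378394904741844828032731776917163859200120154229902442757085138625767607435235528177465792301225,
4971161036609267653256026578562017167529,
792558665121957018016491588061353,
103522935625255187131142216567154523495875381417,
6536805045867998629968528530896777181088604643740924623957329137213515944,
1327862019481105186084752642829583362134729799363909320193817182617671381654151563579107496,
109696676922006805529343208550088376139719367008696735571051461533702587141941941056486463170207794694242774211116844446391202055080105,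
9110613918048359671671191233068221657988513195036407171241,
190130896645686286499420335054042574607177720279207078725823810203291582673101146281,
2134332744142792351028875738106025,
64762065364429464114762724380121215813801,
2639707760640449332860145542536382633,
7668306777828372164510961655391587348217429390096525448218395494432887161483304278652946987631714951108348915547253397773311907235089394086802154937494260397639802749060014027087831542646856069679154243273560964954225975314800934517507158326642224993589471563382426830222201544717180907281901175582825858384458223231046107341889921186299653529691854742239810896816745339481472546603618163833868066446489281870310400108668042047427355968194785186943632674569406421505327668377991414373081352652197288078198569445628946190560413186336866391763969827313247844566716623326141713461284972295600158420749049705379006086888153406525910375123099,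
1131650202769919422103416972322884489941309453702491482280,
269202387883679213532562855531082394028515080653611881413426241363849889802682307995802,
349947671695775251475218772034097667780169983322075111727708755264669639531427224268863751542949784766011569849847057335637640442137,
19433986718106745222511404120444652028556397377977264023020516143442060860720832138271994362998290755865,
1938105430001119659020108780506724189028610464470501240284084617,
27014905056551622958608296615551922313,
1562611021832908107525890596261209857819125615578732417268115080337275130007588359229646585130977418920412313147456445925211927625582982826940928548269202811049,
1575014550138583212876396710109349275445493587147809087072714766266488127347467541293686369043334388852817342024220322234790967717854334880044434653024906083801402224519538181933341144687319140533661083925252861817067062358627542357176425558247007928978464887711640473442269035826473112200314212603211634625068640004292868845405758386458726870828658442668730615391741098361116547348499630861549024639742503717774193837619853,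
20229335000060205648404237528746154339755612785718,
10639319400971371577937738156712618971548877820791173782774,
493729081506780185772434029734911366659571436439275119702972892728589531862133755392550736820201,
3215122453818906518776788879510262028086093743279878901046,
11102989037275497025602976826796080103322378475627886474435427895296643927337,
236828132942780930662606696994383082330690992400621116801594789738,
405124725096029447345620887206350248231137535862411586357491300674000572265,
4423355327198726288072338383489435692235809546323554112881444955043484773190131239532373107008583189672527346259293126007752190585418377021386852209132472919331646672257400494698043721515606466357629215144066907,
6139253190186338902602311427280367078622603286894417055296274007565688531022105,
57348390949468764512581064091649206494101462,
845354711093021419171205462690239164540301264430993980233112750260482165555730487494980542657225271409110622896219809186809414895469394726934564896161777463640433663148519561,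
2793697148928647724202230246785821189313265842733953003334358,
157086553895258253713389416844985207656756523299127099999703477744901646829916467644065201407752025163010380022786079346930728626729220708328447578134827399897162,
1482844679556613325926228600189492807577611541639209941913738,
1042777097697903143016805425674364088628573099292429622,
75244625496021141987432728986411703666960799119953335606647059538398462713502536769265539176403565313235503868519579944788145840556163625837014055311311989182036515011965037433990490459617661741459888098008736963959971384524587816161987157918436961698153071806437037556538518859968988854696042266121,
8128670718101616544054801243740518728641789933753271478866341269570033147499516351212193770199501500679301062496928089941051665326175352918005226561366005909827499817065887087578226379426858014713458213442858033053495629011809178721835956583310312384001713889807921132761053604286363105303643070026711815481019995005045579868393615180907022163821315229435713357337596521594452708372510123042043409330119653033585739817047452707210081533898,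
36542941758329991814072917857870729640137276127365682994896140710,
14753272948167494253289917251724952852814509817280837469868550242527206653684941369690517125862694814208246050589806253987717318456773228120705262104927322292407598451462564711919219087714806546770248463039257840084981684495720709960849220197396149368991290392696863692328200076493135747304054683712340710302961326774150604622381492559673938051097882720825563496362583808822038118264047434290674634458434538235934417534844782713652933922966143643470990001118242925442696822381726847114,
4144757168630478304779500651240497788329461083660011440024517449227333786528904863627752808690597400165998182569615951307580505499775399508813324374603824216971633402596571477740826018258388636530056821406974720219137962069763368133277787839682588170036629642,
5771085443648224082357551538287071370,
154316217649435901100992664076735664266,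
44880272665337459231306861144330359188099618208657546560549019862538592193856036302001986833893810075513993542313674435961864537267244287108035725623610107572269216266394432669042557144152739381712711546925115613208285867189004455368191416115113875427197535401870431340102240553331288468022364035354114927941752245597529340940113035768969886599421471887432851940044419529387845002923392023109625904298819719406852663088886583356,
444998388591364207270587188164329112256427166009594300402978993663674538,
655734465047507167850818901594166855850,
483715082475532664824347744979831074094301975082651942307205141680669205006506,
75437710980078439558745598049238238696529887564397807423090352601265888030650669959577084318767188138,
2354574141364315509673637654738831530,
5307810620319421415100795999133830442,
540248961700613184872648167439474333418848986594228078762,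
77615987556089769500783570494869454751926,
11976685413034019382256042176910543790041296233667790152491141392516670264834003319252475775196612777,
19708476904680448939757324053550302057471162049431665851294372872381582252128604727042674461302221757393789021997226,
642059733353602013061690800175466666,
17005087044864789766275860096323979434,
2627224765192465268710229176006488790570,
1447366244346422321061224031599889706,
530110120081017583177120883607368224743501057927944301547593715894443558668178588715463080625147937516343723567422535718216663248856258319079160152082956908084989948536119397741902631647101787932661163095611332979363130397518766155593482611691462631184296877821488429748282089144581015991059378887276668791434162649550798003507881904256397365633362076,
1863180950364846491786970746475606960911283472396401739193936955142617947829882584326134154,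
214756149286319838327161409713708661933604810,
13113452865573488095948414222556000671499871875786003942768776283446458146236575721658112968709678934507488150317596976127613674505414789013997278945510669219789734520367865930,
24348092487220850096386703537247036057440522890709421941934621747672037210103074970412919502761698875865749600867167878389051402357585700337851248166720089612362,
504103619566260305741157162076090606556567627936444731872509859281749938044261264617168055495108395316419395070233727990248759370,
8411290311963821597409475272096604021736642795127825593501498103531548264029888170403972606929148813016913366243641183274514843455695347786,
4391467182657114418285289672580116547820266956612394622085771858735369793370782092668093094644337170271232463811563079751385106860473292859143851306739777905192320333285815095181842594368669907130406532602102868738102405412811087783214214357667284480982006390552539131697415052953265456174318263460354442,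
2243252353719481819869556626945414234296458,
116416173563446972482696571737965866026253113204718372783151001524460580718560140957214753717205073993,
126567267414904040008458287320381521993,
189692175873988339061555012074203370755813446274079266033979966956682389380353141349580297,
12066079521260988451256645449039511059977,
1665247237765675262763740134047796369013751440615108745,
14939737282568649706030539494355081,
1161957697911389110862597479887977489670493121667190160798329346336922996899637661959468499074412650392371149278787761852530557483997379055955088729020712722634099282227462481739875072385518570872426552158729534341691749501353748950174797010911919144074037924830710628453277136637268642285936376906465005723,
958758958375381302234914171651488139183408000617763281345812413550734516972491613126773650893392327580192087125785380184701143234032575462289740810410,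
802766706712374255419755136328480032239840158341309350683819298438671869886965065413792085950696560669765757784548267558558811395111051776606609811348278692570957259403008810519892838299466720749134517473025549113557811756509790999427758845489349457460660314911779967763630448832958072243653995175716249023903756169912440260583007706550883351662966585894827144677298601475135245062988043914449048334855936523508766688434131751249672725777491143696079476698864578511221601179971424190421071353561268204287814261747282189440400160219589479270535530864613125598953863454142369079488921860804648885097799981187755693975688166494893718203375495325,
119862370219383332011894130248654555261886766073690033516681661626666419742393425359692365883341137994820989538795499068038149923686322305520351277968811712284469768313665170317831033644086836742314,
1775332131853693252614560490846046378,
2056743349885585903273762378377233057962,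
97147517163070061763279388051141831521441411183996566930259798938445136570607516785406205093479549526612681267345705706993439004437390791361240194048925812818152457715185878206525437824090576979753711292395372987105229043201044620993359327678360194446739286502830628782293086243940339409812787503526961700882482993347177391678902883730220176531544302036243098228921950131638968051353281412909233049478548055133772103466238088084229049696458704692205169815420950612298634909063213234605541457253522393885162205823225785554200353878804342560742972696533425001228653514839852650464066670378306389795641775896950956259856859285579393395623801747203923201469003553263560970266480639431797902,
982551321534517401863037057466013987702708041280824907140853288060034236515954207691331919708158182237055141695770,
1280795714029302078310094160016642841990390692186,
6233554906931015511601429813756262556759284126119616022628566496948787138889583828087514923724409431326625738234984788150934547256666545008199692216112980241166762026151057270708797144370941184673901073899540072258752794,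
3092312650193769412369348026597451847323930,
675145726223093767399049019472838651033350473423831871311492223761852512179635102424154966725653202731771975750142658224046824408830807467533237756622268681708768863737777723774703212742794484839448921541683754903057885194669253085688499948230766757661464337503207837075380972366007237055439597014964588171351806497884813742995828155519350374175435134758527659917447604804614584924435884917360451950136222289128376811701116190960272871398431315049422919348519586104319472680583065937595267999913064469264433409797393833348646476545086625624803942345326530381299513618730837547580180974201284200605,
383516345235109055792603248833266820865777102300348704326701082305669741496841518115947001,
43100917772801216140174317675594177142646816304014265,
1734321882276353981603160310507328657001115599418374928284594410422380364605115171717572684795509364305009913,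
46010478716283058242177610653358303301934101953775308287605377948611267769690513078938249335633461293857228555677900599833509044760857,
6787269342397590587446982664694808275670936352942077252099542452963960508388780698345363161296459654532508018770396368340859745122229484198466840556301745645669183600641974971590560893023703919109204809695252657003598158823476290260998359916618,
245536332482637613800393848045448113978979552394137845900134167366208123917733946399584054889283485665545806634160875497846336812870003364183846686569658367741086200359903756337585143871959435890488885121295581548023415851969405678077172695019145497210046031568419931698329874520896262139082966625113631569523809933025545766565280659165226426858995336864353891300134360765288944185246524218475823249059081774921595332356769212450442063558244472228574543123110432485599551130135403498895540339470332192410155091138575590304865857785585735819415350617455058287903181482126443283473428282067606055808845549561193636557254797755623227009602036401479957915860965455330754719117749107890298311140098572120216665621831846698159177651492281468147361988425185153694050486428,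
189878301752394281146397745980772408045275840702414264482924702,
169745475446851413124054200295102613662,
149837088467807275877950449270917278,
6564318645642577272989856909370753160734,
4617344308627249475826027033687492766,
1732584131078466581896114146792704158]

def certB5 : List ℕ := [
10505964657391239094505679358713118386428965641499710277083419186836149790,
781525150330570282032621178420862160176731605964318,
58745707836428150364733931344182728198302,
13728327356200977162910982070608588441758,
178940350222782571620021918690834975165345695902,
9813647375907079997466180498676687566238581266976601970452510,
925100566057810833397840105644998732938234521858908873296018,
7177350990589783314808716184884585004948785310,
85771093721491206467672919737261361310,
7086000292694008230185036435141656258951883724822046,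
91843920673689578296007808602299019656387365022,
994068649942442357941879921501587396248490251329156462579021073589385868085406,
475373811188627100169343941654528196753037557031747109197122695581799966,
113852230309313327257798856832894252053031041282633373214,
647190270295011643568547320649780977323915409990712611769682078,
17436294050485388537454330637437558603936668356644467566402281806760094,
37793935224353395421995676390138115036848674778549103394,
929359369159633745572721034088528769910579117854296222,
14893490935452697704488330600107477150,
66621141718925847705916132911592667138960080506758918152529950,
104789528516136316181779194840727038475511881826258404937508640571606901790,
2408483454652641928465776943571024702361151735966,
11871032884713646810176201336149068818111585347963038,
435371166267530804681942320210540615940831627195100622544991471292671847725064091805335679276574,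
6628303379000776933525404810477432336186577169751263254093236382,
60014893087449686210608163561387869338397719448786462,
33164174815757493475114417782044018980283537426590,
30156970250904841933432366144818532730620854561163446430,
9778484975901057467514972554973233490806028634270,
3975920189721670891666667591434656803990751323359390,
35376965813040642827965703170628543015288769597024286,
4349367252669325506192161745892226959424590633161619102704670,
16182679304093777844446481773627565110339614,
68701848201933518117624765623947804875938091275239541704862,
13503903966332830898943346488680303941542210143258782,
106167893253509877722988458659311190345352227272926158859092375143319341214,
3231251620414718441061007545496881305178282695055332198181926197790878,
210226371131655000844285936330082727461394999838905886,
883025850676475715742673351074241185801878545883720267785524978767820785388492318,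
133651028058475211923524979126922103093987302095035623122563401728005777817926438334761118,
240130359536064357194030926531566000071084190226828979795424477765078447031383466916221552798,
3399656961004348984222514426339071714788116638,
85321995399500597474847090764676671721019467298525642006288117729986717883937204254,
410150228990459403434300559624645712692955935861707906549797457305431262754344851753165193067159162272093885572785095999169566,
24371033148567510702398102428682747341409355934,
7334118042727443975972238233723980319820677033695077202959401873609856715682309196008264245063578424694395440605214,
1477082118700176232069468574231515395079119452950491932506806401466549510126415595265189488581968616525794492594397611160242168862,
338297368361888324059939314702915174824618862979102,
30506840857248648984676767806623135032959581660297147087965068812562250462018213402059806,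
462271890619610510568995491862901654133447208415454898782,
33147368746400226228944406106246767538385374,
652868251110851347504755335350333873064562420106327510892366198818,
59667663353973753665889841377105541225978997372962,
16534840243458733806940671505337157790,
1735927425307609214805114560118806314787539102,
204851678256549072700396026238282933793370417425943631390,
95627601993447227895453020884665662544179628190,
251102515966449710058137342411830858454986008828840094,
480573697057308266330577463056177047416253739960478,
166758345420355429687029916808283231596596047637807069473821812739482654,
863032265070487031497494748616639615493704405148072870152350,
270047146417132099481699175739260480264341662,
102684800018656491338566259809255582347288627139315870,
50692889085369930361542077548904591610072450241394302948280143221888930136969091955500062,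
8644397270551632890845229908795587433725523106331249312967269645643771117595003038,
1041791269091459703899883267475929565342,
525472208436695937605227719222124502187287936603677989069632086336378619490057095348755649746003225222226350300662252788127262,
1162863721105651156857461302764644444756719317134424630884878747468839930626397369570579062191605506601173881366547398822110955678,
23002634494119571492840556548499179678,
2061882819762738475238813713889982324073189436766772434464001176095951856154183838,
1609331490968616487103812972521654585502,
7061701129167713793773734251650799701632215361509088909207582,
56856931490082546240088258436807584756705003678,
6152941963843484467170105272488041714236204062,
2367232405963488501912591750776514167206168430683833764481169360416901695646,
17112437001157838396575718915914015011719346700134407412964834838055070,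
121832553372979833220579095095074212993433895495591467480919320517937310,
466064560841940366105746758402833499203667860326503023893759218612642846,
199144697010462272883929542222576741926337513630,
790902661935946805962076431009618331174423442580051291426088066542849211501017328220422996435998,
21900505099572327021699372025823298367929848942075240962552534541874960483697434177821739166,
4954964093497017060672417303764538910,
1206611764477194313449873373600190493163186379523022563020488100808862,
64474243470220994592682750665003507709814406480012727864032787732917941297125655520286,
44793203665823780799530959966965022184608181346592285952095812768713594411621158959220579817131626660278066351428019230,
582543260268316483303512006886037070555742,
85776766951137522662369917326373644566311390,
14871312742220972206324235289144684443996019344931425843525140312246053342408582895295978649635992225121481271898101952453510794045302814,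
29897565932665435775918837495538708322358302,
64483171442780829568111222726963354142878,
351466679455082964423367492392508381853792557857119826318141564774725281147974831133293463763826295598984409829259241461278,
316817330606079760943684258355530946740121118750,
47993194663961886798150765440967331590492813460320388581541438516789148525791390,
4925054551418821541875633789151354464974083418114785269081869119602382714217983460697570408956509990210719218985908576826648959202242777050468424863413901649290852766511504179754915402556446,
7573062383465810985043283948167033817933854,
163363634165118294184190555032696889872408914526,
1522374733902039298598668917522937621491542740921822,
521433429253007770140440863725371552380894,
1398780625799238424522314785916863276893187535993813570160798,
1997288530295233227051706397891285994510247758255168561977026778477491477984466563988656381233310]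

def certB6 : List ℕ := [
704858111299589733192021673597449042982591429024388398074138350776418404205254298210083870,
278275277520314452473749367829922123614,
462110007860712564165761212444563312486040737943678,
41331166545561098693516804540502664750822892098505231801895202187343312530014,
4140902171083429044953793717665230795518620173353895993496574046,
968444687563452600646034873816935728525759294046,
77886741257775743387903649199698407139934,
2245428557372171063373965095402646347397086,
2581479614389509162020352275847262,
19751640429507011282764426340401405824862,
39264240984711338146177342214794576136350,
161646886862630032535166205353316432660553478270234979111473336292894,
40609380124919620856958593784253184298617928593432715490594,
228116406747599821626207604816916075494359987182276104820449998352418974,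
4711862734135280777314956715982074212886909479885189460250001933044266111576713869097299957413569944793788761160421712710495681154013576703110918237666603090250307102,
379894000910839859121819715973446471079476543471467882940923415408064908099539965470,
184280699506777339511766228217578496476540229433388326099383475542,
1556612277195370059963944990462818302420134534505012921125046430,
4496521830697288102643710342257736173047633444372717305256667606348598162402551819143326,
5753749982495841454371548436984612255358092439773964968529679025872009443531938597022,
5221818571221787849161356133260866657543683542869870750,
29272387724602986664724741140674804811185960594528261769533010317400891666890043983843092846348446,
265339040266851822200191546493023929417846386178287104612949442817761998729615665983617524788811313972385280587624219678814,
1169862588434867816547037893115603297426842060958,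
25543495703303106198000227553433514445614176636042905564011887395823659404716141590274377886,
284917074407879694680441912241400225834987316730924603903905309530360161675043468740766,
476471124920934499699437530835869160103941876694691463340493274399842170926613550914244733752390727763445455256123084638,
1307636942306164461850220423908492052638,
108781837409862168149494567236212710231852199300963056018293921310,
83007758907250750525485723244156201857128197961706402995671849291751724330983782382248990,
7767552990722891810219180240653546185051904163824081985090411717280373884073606256469022,
109141077641470928737661997906732577294255260524524569912353494558,
9456454461054350602028874568885660691506073972540726560705243650457034823071944853440611611459123136861214,
5562933595190851044447745619269150,
58064264605081662421168423420765358488279216306775760708906051906739959901159103879844809616342523019566664734,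
7463440985550389468632240726582866832176327210443027266,
141448139216487667999475994263300867994901969524516445227166,
9398910617690638185759910971188459079838,
2190179943492089196435655285320163191260366105260112405240211007662440246759696410242350748917134434970861483144736893818770974,
1270486363037184731275260314676709278019720569795374984116867431048421327942725029087914656206836560760946007521883101496610654,
47254612017794062255978118166366365045893150,
27425817404086977602385007226340338887581463606835285854,
9571875413868574669707212418828403216510,
93776251717048990325529852468268894,
19653678109987677323022873450104782090668190,
36391901140157387100631213667691540334846092679357989108493630978114737691400326338740757966194410002526,
957796763819016029100937350619094706315480094,
1545221374272207561855251547677265108263614798980276295198,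
3576403573528252660497934978741132075210270,
46367535017707118709107691435988847952742324318,
476100351760556613323054952889726942,
5665806745683767014070809952534181527882701999966,
181618747125288963754185378470718242843839323441310,
37336607025237766975705315492474321111198,
8830384577963161614664089182277441683083534,
2208490260931132078520123093365455621296630042320345315962653023902243759799743110185475509907677826092105663114168924141384333920802429043646129934957205794864690112385792057706808262166489822217500375154055256272339277559775105650192218749867155030419486,
7348819590473746996386654043321742472212086911817910948715900101185968880961448830118534946540451562067952552188482526656273960428381856322293886,
91456820059609504920738928854325847614720782373165582259768675669350263903112218079722835034682102841939251089182558,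
8267855503594182240873501916416924358316158,
222417983572753995519790041926432804351161317312779328945413791816202848414,
199429021590769767000430563469297822,
8525159741331313911549038488053570671565908710768818415319194846,
44639913992969925488786816265458566230557157265534,
26592392390505816321800321459214897418366,
16833215804095303463674516110118750,
514500523820341072618202129928364257708190,
9869993512024587401573862708878798138593636961985808299799867218935174328613679910238213704007564974753771022773483715615203089503943615165069444668663207584991480412645139152004708558283817248813392317684994211732693921395338836237159617049571929824585804246023544682533939612064364635020919707277926958416994431968643369716424931384561758136620336489305371405804092217507716923447291989028779573287620216050016824512897791616569785510718308463661959044468324421285263217507701765775336498791708070292723372548157,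
756152715308290853718809008647442701,
1531212675888597115504176460327554333,
4760428641605961755787509631457930409286412883599352520891038152021077944699037,
29371972274979196164870449628317853,
56325237063987627965717611439754537931443664716515045373387544909094462293992571910790815367434942627806385162219808549915529357375214706410703826181735128742004294344125266560172461391561282056068787262142466825180484741222237414700328781645326959156356795526197759460287727589863597920809036355513144590058844108151911379624925676500526056593191424061087616955078964377573517205830495451603483799007504720599211824268152218726846132065161104912714299224331094159,
102276130751819144625883279,
6391813467282620549108808333800662716284028517543135927526405428278618977052991167514580570874888736522186,
14275144603509562821095757111946968778,
6157142018539655671002885967276503623539611584314,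
558605005139689483216692898259376983379546394,
59222466861783130667878567138950741850,
460885248445713056818135932802383992798554,
1133360861824156032467147536629710170,
72375321693966559457266528580916540813868699989287481788137162,
140674613012324948980503323451896536226153862840348939152724901834,
6275154203031684450235029501105822232246042572602019481082030037782043980954411504450271074575540165699911045870144042359442537822722877283304598869878314265539286265296784444869363777646051677624090829308481269089287058464832805409545332832253087341750072037930699766312209861676707354560503428461424834470097373332735436468307501653696565056320502897206786391629756,
158919429468516058749546620,
14518462126985997517534457354425202289477788,
48383351349451708876104651555093746507262558240510423861751294804286847988285530875698548770838445495436294250758934875126137327331946386929292388227430695533653105150697835174048350536959420985912108136210069610989623349659039549582,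
14166446019825558678159989052470781218498767608577058402525321548805128688248227333051209541382184807087440981744344817507354905472,
450314511071205553730310767780531632458873703023280097430550,
547007549495271667052088272029268473314461590,
8556095127790817156355438756610768130972544710739632456215304452330461206284291995627011067387496041,
10604844489686325586216765886662988580254927007631043528197161,
2539118602108128122580081776778187559925,
6545908415655517699769927206189866247521094090018547665654,
97120944102543237808342637480512426888174029792872,
68076795037132704704769413330349092636455476713075280988494973902426,
3177463180363070119216836905143138256939873251399894,
10600607611775393831790573583256271573,
35282816583724094983803885656922715451039801353283082454,
3198629895915837812414300698868556626393113359966344651813705246180363383302161786877876206629736369789259484766095869703988166034645386254225496915289575296613797803405012642856321661007689,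
47695291450491137194233230902481723083945324183023177]

def certB7 : List ℕ := [
64637540988664431302155499674690894863967195606,
13784018350705867810727437195770435285,
97364229880389564866444024632129788865721180709937301562871462236346607582395798691232790078538037128,
42288177728508326938508878533513682258506305280407671960590509069736106556504449813474899241220479405559818848369208386252459712648355943871293574851653050670811395089756818084832641962774859993712176501326215907612481099898004371592972177094506695270071130211549245300128776,
97818317027214002999947486920408799488351037773109749542899475817244882564822,
317586781576995126667820495535136085508331221,
26391165278695335614705619906309617014192223609746384459990,
166513543958937421019348265614276884198006053939392400887664860676394374157153181553369778490880032952371898002190457911379233689238741936647227517706688615263312151034883874679740388875517585160144453788401649731784185504600043615256245206963322695692126002209431889908617863572348262017358180374189918676961320522998094063964001434545173709078572998672029110450220235215035585397076681234119735141755996626841570019955207766593684401916739244289070857039406468453588550798634518449196339145964489,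
1946305161564796221892249522094856112883232596793551812138899540582107720041475856836553586985636575256,
213740921331139560250794953277047904683868296492799663201916896650288789993374315593990193328676324374172672196996462462858,
48938621793330564345338951656041424300329994,
78094689172578051502552104387607446084686218883815897778601744203581112571772092617213148667665446602,
11317023501813483511607027220194587476895939753799313364010890,
905897837447061209734683032919773548263478248142762580813076080176317283469077011672368280187355363877582538,
2202477663528743425484549510871102253917596636496584180216326100936458,
6957476640206075201522011388890104156869130619786741033223221308094860298,
287551836036584235502512699620144629642,
2016758199812557433873350578168221916238290499369041114597695031427615468427992269373990710353112064850097078747630092835157464185578391006007921975606246671139541683705090968311873533675273,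
697849625828995208605485012645129,
1684087646441376382844186591061897,
55959562942451231814921342750055105902108063463370844293291193956296828782790434308648818155111661647751775671321401822269970668880521504541724136346608732770143508122103530308459223591394383099605772046967992966978738552808601360657815560477935959051139155515,
347308201337327998098491954876356660148072183674343100886,
154585294228305904020223407602446179835892465457324196743317709261731032003601303092823274968992712,
35421781336122234030907907793864070732890463179759631958740039497,
9554586208634928994867564260157481841993,
83186548908089155640476094213337524034277967566970019441110325383784585348075864148537060085915475635233202480074976841,
64710006650125971755611713994339097931300654925791016038609998598605415494935546424717194861106123601150594248265,
1988741447714124918260462595592693503375055902274686813654824663028333116896944169590804305145417,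
166639679959539141098802862048554859793135372113021534202978463701497155554537041884526034500594698808905,
69981474957065899509189552786942628684049168619483310146066055576841312524715768118248511962791838236250939521865872716363428926193900646190636812748546224756152505267078557282586359591648920174236246818923927337564771670977957096457,
4135244913893792933588866398329215849332296,
7321455245495965706579342726004296,
331100466217594915829045271452896941456392,
697978765918793692520218086561168392,
2993059235481919709140962426476247296964632950664,
423504989001623806169497933555948441649418283805278663357262943391683582186779741765359904416817691975089079018312622827488300870957098340153966506966395722702554357521839079168725087505549882,
1415346228041370582469944725594293479374907436957351132819244345150287655907087867823335437924751695228365193569833593863187229988344509299640584388039191178533002220481830103508207728359114407280831565335068194375704548076656650495354528537697377877237783698235036099842423751478340419637045692968380128033505476385489299231643627780963631032734163003376562880103774629208282634917146983285448439611890251096943106309546856532545988693390823682314006331383117070367373947413075911661771914572889878195775297632584587521074995087416963126169292691513261094273299138019266537971266284799904696983793772089375345909955193916538634955000090871690,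
2197008288877805959512626768354097073645265326937523769024178700181161465893614847434767102536937942046277471750709947307386282134068158812137019908543148014537,
317962257961840813871207199181133158022296712114144585428630269521105176230449018608985525171420137742178251016455000448583313997495111119975157081882986695466081553788568299704455451854442,
9952225640181078313852530724420142698,
14996331240613778620493359470784367338,
2772000703651515694323622362987268439754346,
9137138265614147355894468426061479994604951460916774421382108596483115740063204780334141479402432228766308250527615780040544209529345846505644142617992255529385404342132216465238167076468361890434265353652543440871168394570886818074930887303514899838480372717634460553926525569721303150610772374025118389051239783405719959598150922177555225425015743045991631946259610953468536080085936441287374132623589554507995031441704453765612584111525825967116198938838521207230767797276271489667642783271375213596,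
1649381291373566621619489440289166574066014775849778186936107307182677459021942459679312021157505904258266254626549015681070229827733661289,
287650653094333700652392655595113,
2224103261588748164542969167155685563997302970411570998521646979229253739123589324049803764483165404139124344686002575064639525770212775282222655499963630194105009058574690562168825943287004210560273651826997272343406250285821918914905675938711054572369382529824424309685399573652321821387741820202941812478246287717239555941673997140460369201708579203401773561107377177331543461927088588144289794147349794050653316353540310541,
2176824842788490048467001669481350645285067347163676663405418468408548274562444253178220678510221477769,
223551544468790138778504908269860806429156059016,
4310675171802096092944977002609339656183,
985181228258476460522729539492707684239996035764027920306893668694473875841525603414482423268085885518396307951280378960536602,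
306591815473500368271262918669095916929298232,
7614293865825356202647292797021224157637774675896,
714684708010223442245631606126535385803442024729976217582042466453336,
32528015861985462351661987140799047465988194000210593258903576,
295708317111060459414389321582178795972419921255556596756507265040510441266959074567141573970033367954526532188300270886348477141398826065646846150954076657603681989516283799622668135444415938680344932808252017711326720582017639399423458261342311044582255962,
316538366829707048209315906309277224121043921855454146497913182281279286337406810817412885257676028940735645999444411690432885198169,
766698225530911479565213140297792375063064076221882418934379516300349902917314847270652090603540902651440388048311807630904313633713045905824165888384113979171446742863483627034410798097389153473763944018803779115015011962353030458858351987399241929925805616425334194936922194825008113067711884785027096344175076228755255382653322074352384562201797076102490023224324464695378992951471452944423888544486384834308794652721923691146044530252121965660739403588514205716071757155699474956873014009282501147411908410315930020429552742297233160774641115654038891488096174304606450695267125725210171638431129186698791867,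
44299502980923282816273673819212157895806097742280075940309924194951884347029058169898749010331448064076620430857445279430280221,
480871345294947502993055210275869,
2929142226745860146724742300701,
13832650577716287699917423445021,
273337306983572581109861174994576860083517442545502669407033060630754131691036733983795976443346578586473216353332691997,
228646272572101618600052852196381,
869222216266331364222012261252669034505525130084899119848065757,
838312553052807743323605030512700099406832971766665749857941845989391514238098144956429505717121363130556639351773,
2564709784683058291307761497005753373,
31225435641452989615914820335561239980359326565405,
1904981771877718661305829335921249346972288926588310493,
7202287782508614877421489010187735832860345058980503853272323366083597121995461771308139690087730449940586445954560994114494927930397,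
541266104172773804281544220598295077828146308776989,
33029661110069443178205594665935974556310028289211372643195395036603832985998440973141629513439159616285140007257693,
64316395817124810411490245890947068561997944934083070261555642136000280424422257855427869369658264347418961000446338280285231666519635082019869,
561842789711716770228787094414629948605205028210452148792043034272781879549360460380823816358060029513511954791939285429348710188086407951000731647015862243336877385080308765,
338795600057137035421715308037186500735012903443980473418527137982394971362654566845149,
1361391438732698332048327403088847675816163895993328675673114152066104235728908477805770018917088161235517236665929698013,
60935002445398273916147860388145806775723948686215924408814409484360465012529853161917797352261793811657689230990566488568532969717431328290762599105565,
33143128683622030361211807150341325471598866871851601686292741016836193859512967324023395293,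
3655158831721991475957427628327957972408954371780624264726512669,
7504306316098797140401777975828963559556787247789062464984512383581964674458915299236881359193942465082557469,
680177344441548860721181568061867672699251088819027416710882226362009168291187833967407928567707233310727483044962240536998584934659701329807600229536902943829066781,
51512757990803469080609956594919940841035330946077,
63083196636835342466866055959333082956259536010187741,
4449160682356335908526647934331899485045783762434438553817338352093,
45602087198350809264009350732326733287282957152448814543188746297673453108781633407910197521685932125893327741887432524942537808293021025309,
124642125850669839528491728882952591004038004254328864696244433433266867920164654614626118053869109793194741356414391913181,
9436750537104428463784689298429594502380885836366875462613894948180580548002872960586433501684444545170963398322029597,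
3143416907285356041610263314908590107521196452215796662391568634341941496512466265726625333884077523648130847709,
1308000229082375519317773761511949341,
880444058497638098255459822103715817597210944308313523229,
51920306587812625180180430687503389,
14425402750150192999791664741902566471628611015167522742750609728445768400356916564957,
843310798843647398851575422019927650843945994769404381,
52255348885361662986155290516722258909,
21836079203810497501012260659210289843045981,
125075517887885879321648830751252059404176778857508861655750122862146371247663037646934282156011394170176624374750554293034391355256181883357686013288416861,
335629471258575270263359845124611720120078835493639103194601513099764137355973390682270829554306057245,
33006394208286186448164848888906781,
499229597864055035156832649435654295323677,
167883584242815966489304561987531840592028994269,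
561517310008680366845223460512586976565202376523280709469113351322614759527568047042280354422698970897209959200771697123550245463558749743927497693]

def certB8 : List ℕ := [
8782114401676300981559477627248426645627687674367780529497837241255659660385745013419395604896589252622217850817554200847118354641313944228004893,
519199673517376002242063714157597,
14390539674581057261298271095444217037207261384681262189716146377779391602689428796350939540207957656470368876938769101396588497002990713439261,
215345719686056921176959260766830003229,
548846383445856742549940565446175477320175092606063722449736573668821924360932181647940415185719657192246429778485272395509103179133627320299964775828227101,
1157270816472285405831218972660034613643444294910555305210522747027676345635805,
25139081036583388800279828023764719895150827251943091206411786490226873541973137508878261654912230047189200581075318891738846980594517716472927502080294783126462458482862758133420265949,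
2152212740871312419895822490036875639840905271029885047392327461953643880290494916447354908122238110930041662643969505303028265252531748424814717240349,
2359452744740421267239618968115831973513162690317634792139707100913884157583741250298811069091174705753136134290318361951566009309,
4132271340312813363373877474194775502049475856826358042935423120006402405053102772580505140328832271242602988078674473566011740576511704073932106923688456783453,
177943260152781937757421895045073398763153829355931967992168779479913322046435841457972378108675965960656148159827328620799005973882117209169912274551251515452544969704835805,
1907133643377221723091417924549070981726251404759517,
540432421694693046135000889508406107763086301,
507687902116487832522137150686417438829212172754404428106433292481996835510030813,
89313065703418167779055221140458168321774662276349,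
108185290552003039118773285953473648829,
45525866917567260580127149147828507131049803868078415836663267514247511850904919858262530982364329263455608641426182480368389792917048216200256925139997,
607134765706169317615983451859379593749716041182435892785940583662417127082072086317787235133905103178929422381933956611966039163933,
9834935431096687931358570353113804136449053,
936400143070336174556452809298391238041524381498391499123190831384893733735887190919648045928975639608671701298214859286353903844996351005,
734452968805551245064567781664669802964954238343646215983615825509855861062947630446713611551773,
536184503461949354721339231562831376068674812487663012748876366606701852237025085600788698845491559382438067403522323200569939554568925,
437287394172390881807662218086292793883901002706390290577941094751733152769586983815726168729810137437848283598096630813,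
108530286869091821603965741635198594664065570503693881834614628035675985832904551270876565094991392605213,
597653950484407071523824689129128989,
1616957205451464975964512670385181,
73660471860676422203057038794445160053319952982565204176094116968369576162443414340130904519411112076004182662358091540825267447753003921633881246099516097565,
3737030125310782763150109586747040538684285922790717280410787437245170310220052873403396840035143248806247540415025120285,
1068171316915713540128414154298369553184995135532762141,
1237252530503892112068881377639352981884540310657633038553289693,
154529341808904629909732074393461180964284666333,
7687458607231160827263120696189096807337448191844697047655941678365243760469631676847834295992770452824398159315071599645,
1313606676213812469584397479003071920075751265600541,
18265687250272011665735084446576134390813,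
260254560907278551457222264678843873217589700832469283356819412922001796589902337413597,
257542560713458086884794530988301452297267133835486434070251585557018230929523076327483686050103933372519880077,
658228985117635448501246162750551032861,
126165982205589878684852532257785817152721848615165785857771443618050373005495617536544146461,
18298063943601748263350089683290922712884120652938000310666269,
93872137308113508567593585219606771860509,
28377835189453422581743937122401032736079009393097156339607074780280898232378499152238279539601371200098686636807203910217673304114205,
5499569568300763899534192572575160874880254080729933170470737585491208516515497824335122877077269829450317593764360487965,
842812311246328671848217686942507310056001526151101816314441711933901700293487537621463303628399957347092649593360542363093227112189162732795948733947411407965656661478016029,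
248495011019343567899377972843640888513936383536915557942646463826001444990926178512241201318887584314606090163539259785413661,
48295439826121854203802550769521170118385091837078651345764737326215432925,
5792657868988639545473534802340831040365817984408155426222483923841067569371222225416606020929607622817807533085,
257241703579167231350817624178207159738715809093941599340923111911342509588168765604893,
36329244410543668584141731541336872395976985931997207210306799562369791305369315167751179989120174053729708488718782682628883996410909,
7612302384721897776086340624280295874688056598700023322766506133011710857803649498612760950665784167829799446829732922397,
1906028260190851402662264007343851910209441678347604634977136665363485,
1220187473399876374477133484383906756763395996623471696077442748034690722589319366270993350530896432705325631069,
92731371864666014773306285901398528731841816191673370390880671708968832416584669,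
8362360067648309917385573965364382608879973683016241629,
565330877782778278338726222100792166253597,
102934598464795667830552774017576552244058667656745911325,
7624337563255619404280656366181996154936092103546252741744092819209845426421194017425215032113447765458714781228526104792247741216001541547306427393936954647783153984596891354671867608928221584323760980402150077575350329192510849675901775178552436382732286272115941682798383160500851472594559024632353580360025619414011474750832159471314219116522825477490446134870183159938725604624476118359991572202096987766983084287385462200443027447986577183570693824032269288824030589355802306658671067362429840929257421329904559288762189055019858287005894429076183199472054915284591628242619989388021729977748686705297342787033797941473115577036426847847137863911197764778557805702702014013931851685075021445417763261102265321320914935773470057042366793411096231346519714916677031142714150032252831968798852969906334127034937013510806595280941153899221981,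
5437598289509597968184428496108215683614887347037441019347350908042955549545667003916106960296009532204571936794607246289318942872116385546890869170235412398380225110666139015717686434609429300597496313202969020394762305351051458265779929301309840660035878563940171234446075645399517,
12945946402282257199787776414173,
74636481756703516857204059613536550600745927351982063084528141142765538603304933495619182593053,
11592294747000736717700395819183333162354822184622189053987088040989,
348464767325533977107993248564211353091347762203052202358615783274136395700968243426318356957,
299942405680618195906881632747716352888703339579937311467274178013316375607633251041672674503647102572929191897198850147357,
151351751456193888705956188650388662844854112420029149855438120697838027379875988639491285370993008157937299344233928289319825420637541635712414343453883302989759628559927886021661,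
1829608507827161292925822849156701,
308416349401789097777264059321053,
35295209445263287765352276628584871916938240712500658301790498939319441722397361572349375817685011459509475118010649721683985653990613410303135348600136186057220116949534301,
3007246571378127173256201379089117,
64418966531476354314540643721527366411047284639155179729009840128815841228919949904525300185731943399546567179777283637282034414327435741,
2511144891857681606699933120638302476229735565225056068639295930147082890972158293081286071608558686685,
6055564935718472891170443622249665789,
2538283721985139115929503400271411189949,
1370138924006601935132522971825277213035191768170575778495915132611199072417176712389535061121389222048033984991974962576590671102926512620866842290283141048473394370483913508219956355004173952157541522175968466163031739932849533949042405638158059456268402514109127265446157945087327507299009288386082520055428292883352285,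
280428316895606425656686928974136354233357277,
63737400975148063019299145094544026011267760930527692047672301219111225395052800731181514337025461162530105855577346623351295460468056792276976669144706110196550436783501702338515421,
2632337321345888821752543635028951176157,
39494607974648934521836701328704053945759449279370205,
678808365363782407554175094660882203415805,
3149011050491919277383622339896142805598091605693,
5051277097609399458419024365918084029,
281970704930203433249823622378084153437550385792341489869277444707194698321253780007835811325526367338328163357,
159473711383187561966733537293647864812853251436198239160426222681939095713323998766892061,
1476768351405623716432300563917270206820048697965851561640782857497379949757356467185323610589,
45530256909211674537953557713953899000056384301257019294749,
5940692429227186601872628123661,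
492107462874682104025486964062423053,
7851809947577027994957659591892454020811761045558525,
256404334625227945311094932500206845,
2468494733698203511113723849243186429,
66434402886915724359850029925591407549,
15497539874228491525433741496829821,
6315052107874097051471618816048289065474895520176584959231230334386573062319483291961779041685608353536117939936202,
88934589319021337457155054317920739258,
209699242886635805984619050105835514,
4911146706025699029919478582835009197435734409765373656136834545557189221104951477685612787546,
261371811896104714658208705165490335866319204313586257790983061050,
1044839794519035058588257911459348158450225926399906881065445734250837663490870017289586104241300770032178333085687900810274112171187569949684154786216210680507682382618856956228887245561990927276938770554,
113622456865699203807803782167808163293044481978,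
373769043142527034987137157138018202518737723322,
1685032261505632936757875553379752101902291570394,
1375572005221888309415078985471131717765002]

def certB9 : List ℕ := [
15014055010449088455030868023788185930,
14260768379668673058028672998995774192732331120161842413516634,
15352874458538042710018101466689556565284616160081397473516475788180720895818264514659327320086011747548986,
458615133113397875556334762866403796927180454586,
51619393124966437955374311442687518793434108409978,
503867112411114501653645352546269315470564791580057076143046029742705818,
44166091352871610614445725279025842475974204657370,
47510857854519602194239612875719118554,
115649586491059385759782224581709979690207258,
106023157950954218190735945516902374655735293909450,
231828280412833462617132169422853942285142892132625052396326286029081831917968218,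
893080084627219888018716618482822114846393544992999784308202797123768026,
118693304050870134650811220389211460475164295562077937594,
2309111238128231110364350212774834384074898327474692237348602,
167638182280619594170867297533873744252015486773896341169551661241103315213360192637272314688874094512296022013869565689596745322004830488873705863422678164264759950862901579588163683240238623524521954245255171121553707372250,
448991243840387903233436032015667447601956343793514623327958449005462106244721980858681528314,
48213884138556452651263197335662633760458,
247003457880572610596911826843671779028793868440780827557471993356667579274229414332149396034738810,
2336375602670581667316726040118831331643027817766092704904879679596677228904225412878944292710609669182785127214342930766113722249562,
25566569243075076696180507109433966732806631770,
69976893681790773404914155945879003312733508188474,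
416485402692511209475891336012923344814043210500802069600617613677762389573353405035706,
85708905344359354475314578749581914840588595210532794714811154088931066469562,
7681229387236205839822865300838759754162457866426,
15234287447318632852606384362971155582673064893530,
160273884941366741794248790898598010173130,
82066962289616270740417253950176543989185918810,
622058944950137831410558177432272129292103365481043753132757540543195901203694336279698859695432301562631822282,
10581182400150289506531100313829611836291020220028172598431949081014367699506076585978,
74672449976997635779507724289889503091294740905474894321424346,
12135142153035943229810138663663691923429610635766968168518586074,
5423499122386508676170601824523375091218187966074758610027581207471030698202015549111305817092769263275090777481741519769053091455846370147088438123997715734499998262157282974701607447894018077947624765999552006552927835338568976330669436167547030608617690244221754036895315398192697013987271371256693173634696279689502731941313076599154224413955655826701254076712892705216649981181054668,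
930017308372405604057532542683148,
4242526415075629786315777795622780,
44682127212014713308780626321815430138902456585546,
16071061285263155191692604681245706971603245521668401824526902730660430290764130003695442170,
865691098046312581993060230415141847404690842469612100853902602232920709367093080218813391754094213364821959101109314800229466592917716547418,
1373973540255936307188712905604679094222727498,
94753072478583332362247223846489304798801428171998936770499159361066343453358921984414299428146160510268777572106,
368089228115364486099420380875401720188503721132782479325483996215115447016928379625269164062554,
129195798702148593044801637147167694085024796641306,
3284202864266262325812900154493879453722,
2112325861447572668594573147149286047294128821713978,
2347516233825564199831705517739221385119270938,
303292693860690054313520981498191503599196442330,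
291600017115190801106838469017752581166107282484360273277566677057390387396344751483407476963592424211649005875686202119129943212822200318904357576595611847490104666,
3268606413379009429159928833784034437744546669399770,
178997768566444927687262494834218826914547370762421931738,
10326771232053545537981127960620433611340489049130148866959593537968161383726243692172471940654768444147594,
4618497802328738432837723808725460239091852271074234210704445580789387821641295904885512150102821876858095437756336301647951717151016986,
99864085994383755763306643432190133828972959144156014320483358393056759574757018063430996741907519514614964401558778774455692259511205698390315025049803991017995901025855565018549848675523326333077316482142603740836080764235534727724462323402620,
175567838354854805149024012809930332,
6649809130453046537162512043638552435050919518733916,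
1477389393796876735081346009573107580,
23301252092324324025080556398371973466853881366090176619369870970064822840491406748785722710820788637278172149400600611286965080869465343002998944551371745018869739332946450557819393218912084676150415360364120545083578105394115705769838,
148576152792781023732750,
3615205233084590786061884441,
3222027783889341194506059216616091898388846477114460270372205052648415680184848273875945971191623313117515635016680339637094712979364137321570734982412,
127110875915853530880396787570159513624224667294318751091982472577753460964250826904736881268407415639767101240313676948488207001639635306902932699311636179689019,
228369457772316637417483,
6075341374897719982159611472045162973526333307,
64952443557415310351909974042543451768994682691585735000620620763780449832025294172463169841120196906508083293932495942669,
4859091535631075654788490349537711525951514184058403491670672767,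
1970469693336905323281116306327420766643919889654030472495664442,
68501458789663658362534654188468997434,
821906982999143730847857975387817327490512913134816702867305135340,
44379275631298056834339490324537982]

theorem certB_ok : chks 14 10 7 673673474474 (certB0 ++ certB1 ++ certB2 ++ certB3 ++ certB4 ++ certB5 ++ certB6 ++ certB7 ++ certB8 ++ certB9) 0 = true := by
  decide +kernel

section Rays

variable {E : Type} [NormedAddCommGroup E] [InnerProductSpace ℂ E]

/-- Unit vectors in a four-dimensional space, no two of them parallel. -/
structure Rays {ι : Type} (r : ι → E) : Prop where
  finrank : Module.finrank ℂ E = 4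
  norm : ∀ i, ‖r i‖ = 1
  lt : ∀ i j, i ≠ j → ‖inner ℂ (r i) (r j)‖ < 1

/-- A basis: four mutually adjacent elements. -/
def IsBase {ι : Type} (adj : ι → ι → Prop) (B : Finset ι) : Prop :=
  B.card = 4 ∧ ∀ x ∈ B, ∀ y ∈ B, x ≠ y → adj x y

/-- Orthogonality of the rays with the given indices. -/
def orth {ι : Type} (r : ι → E) (i j : ι) : Prop := inner ℂ (r i) (r j) = 0

namespace Rays

variable {ι : Type} {r : ι → E}

theorem orth_symm {i j : ι} (h : orth r i j) : orth r j i := inner_eq_zero_symm.1 h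

theorem orth_irrefl (R : Rays r) (i : ι) : ¬ orth r i i := fun h => by
  have := R.norm i
  rw [inner_self_eq_zero.1 h, norm_zero] at this
  exact zero_ne_one this

theorem orthonormal (R : Rays r) {K : Finset ι} (h : ∀ x ∈ K, ∀ y ∈ K, x ≠ y → orth r x y) :
    Orthonormal ℂ fun x : K => r x :=
  ⟨fun x => R.norm x, fun x y q => h x x.2 y y.2 fun e => q (Subtype.ext e)⟩

/-- The orthonormal basis indexed by a base. -/
theorem exists_basis (R : Rays r) {B : Finset ι} (h : IsBase (orth r) B) :
    ∃ b : OrthonormalBasis B ℂ E, ∀ x, b x = r x := by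
  have : Nonempty B := (Finset.card_pos.1 (by rw [h.1]; norm_num)).to_subtype
  have o := R.orthonormal h.2
  let b := basisOfOrthonormalOfCardEqFinrank o (by rw [R.finrank, Fintype.card_coe, h.1])
  have e : ⇑b = fun x : B => r x := coe_basisOfOrthonormalOfCardEqFinrank o _
  exact ⟨b.toOrthonormalBasis (by rw [e]; exact o), fun x => by rw [Module.Basis.coe_toOrthonormalBasis, e]⟩

theorem expand (R : Rays r) {B : Finset ι} (h : IsBase (orth r) B) (v : E) :
    v = ∑ x ∈ B, inner ℂ (r x) v • r x := by
  obtain ⟨b, hb⟩ := R.exists_basis h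
  rw [← Finset.sum_coe_sort B fun x => inner ℂ (r x) v • r x]
  simpa only [hb] using (b.sum_repr' v).symm

theorem parseval (R : Rays r) {B : Finset ι} (h : IsBase (orth r) B) (v : E) :
    ∑ x ∈ B, ‖inner ℂ (r x) v‖ ^ 2 = ‖v‖ ^ 2 := by
  obtain ⟨b, hb⟩ := R.exists_basis h
  rw [← Finset.sum_coe_sort B fun x => ‖inner ℂ (r x) v‖ ^ 2]
  simpa only [hb] using b.sum_sq_norm_inner_right v

theorem unique (R : Rays r) {B : Finset ι} (h : IsBase (orth r) B) {b x : ι} (hb : b ∈ B)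
    (hx : ∀ c ∈ B, c ≠ b → orth r x c) : x = b := by
  by_contra q
  have := R.parseval h (r x)
  rw [Finset.sum_eq_single b (fun c hc hcb => ?_) (fun q => absurd hb q), R.norm] at this
  · have h1 := R.lt b x (Ne.symm q)
    nlinarith [norm_nonneg (inner ℂ (r b) (r x))]
  · rw [show inner ℂ (r c) (r x) = 0 from orth_symm (hx c hc hcb), norm_zero]; norm_num

theorem square (R : Rays r) {a b x y z t : ι} (hab : a ≠ b) (hxy : x ≠ y) (hax : orth r a x)
    (hay : orth r a y) (hbx : orth r b x) (hby : orth r b y) (haz : orth r a z)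
    (hbz : orth r b z) (hxt : orth r x t) (hyt : orth r y t) : orth r z t := by
  have : FiniteDimensional ℂ E := Module.finite_of_finrank_pos (by rw [R.finrank]; norm_num)
  have li : ∀ i j : ι, i ≠ j → LinearIndependent ℂ ![r i, r j] := fun i j hij => by
    have ne : ∀ i, r i ≠ 0 := fun i q => by have := R.norm i; rw [q, norm_zero] at this; exact zero_ne_one this
    rw [LinearIndependent.pair_iff' (ne i)]
    intro c hc
    have h1 := R.lt i j hij
    have h2 := R.norm j
    rw [← hc, norm_smul, R.norm, mul_one] at h2
    rw [← hc, inner_smul_right, norm_mul, h2, inner_self_eq_norm_sq_to_K, R.norm] at h1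
    norm_num at h1
  have rk : ∀ i j : ι, i ≠ j → Module.finrank ℂ (Submodule.span ℂ {r i, r j}) = 2 := fun i j hij => by
    have := finrank_span_eq_card (li i j hij)
    rwa [show Set.range ![r i, r j] = {r i, r j} by ext; simp [or_comm],
      Fintype.card_fin] at this
  have perp : ∀ i j : ι, ∀ u, orth r i u → orth r j u → r u ∈ (Submodule.span ℂ {r i, r j})ᗮ :=
    fun i j u hi hj => by
      rw [Submodule.mem_orthogonal]
      intro v hv
      obtain ⟨p, q, rfl⟩ := Submodule.mem_span_pair.1 hv
      rw [inner_add_left, inner_smul_left, inner_smul_left, show inner ℂ (r i) (r u) = 0 from hi,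
        show inner ℂ (r j) (r u) = 0 from hj]
      simp
  have le : Submodule.span ℂ {r x, r y} ≤ (Submodule.span ℂ {r a, r b})ᗮ := by
    rw [Submodule.span_le]
    rintro v (rfl | rfl)
    exacts [perp a b x hax hbx, perp a b y hay hby]
  have eq : Submodule.span ℂ {r x, r y} = (Submodule.span ℂ {r a, r b})ᗮ := by
    refine Submodule.eq_of_le_of_finrank_eq le ?_
    have := Submodule.finrank_add_finrank_orthogonal (Submodule.span ℂ {r a, r b})
    rw [rk a b hab, R.finrank] at this
    rw [rk x y hxy]
    omega
  have hz := perp a b z haz hbz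
  rw [← eq] at hz
  exact Submodule.inner_right_of_mem_orthogonal hz (perp x y t hxt hyt)

end Rays

end Rays

section Scene

open Classical in
/-- The elements distinct from and not adjacent to `v`. -/
noncomputable def far {ι : Type} [Fintype ι] (adj : ι → ι → Prop) (v : ι) : Finset ι :=
  {x | x ≠ v ∧ ¬ adj x v}

/-- The traces on `far adj v` of the bases avoiding `v`. -/
def Trace {ι : Type} [Fintype ι] [DecidableEq ι] (adj : ι → ι → Prop) (v : ι) (K : Finset ι) : Prop :=
  ∃ B, IsBase adj B ∧ v ∉ B ∧ K = B ∩ far adj v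

/-- No set of pairwise nonadjacent elements meets every base. -/
def Unsat {ι : Type} (adj : ι → ι → Prop) : Prop :=
  ∀ I : Finset ι, (∀ x ∈ I, ∀ y ∈ I, ¬ adj x y) → ∃ B, IsBase adj B ∧ Disjoint B I

theorem mem_far {ι : Type} [Fintype ι] {adj : ι → ι → Prop} {v x : ι} : x ∈ far adj v ↔ x ≠ v ∧ ¬ adj x v := by
  simp [far]

variable {E : Type} [NormedAddCommGroup E] [InnerProductSpace ℂ E] {ι : Type} [Fintype ι]
  [DecidableEq ι] {r : ι → E}

namespace Rays

theorem trace_expand (R : Rays r) {v : ι} {K : Finset ι} (h : Trace (orth r) v K) (u : E) :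
    inner ℂ u (r v) = ∑ x ∈ K, inner ℂ (r x) (r v) * inner ℂ u (r x) := by
  obtain ⟨B, hB, hv, rfl⟩ := h
  conv_lhs => rw [R.expand hB (r v), inner_sum]
  simp only [inner_smul_right]
  refine (Finset.sum_subset Finset.inter_subset_left fun x hx q => ?_).symm
  have : orth r x v := by
    by_contra n
    exact q (Finset.mem_inter.2 ⟨hx, mem_far.2 ⟨fun e => hv (e ▸ hx), n⟩⟩)
  rw [show inner ℂ (r x) (r v) = 0 from this, zero_mul]

theorem sys (R : Rays r) (un : Unsat (orth r)) (v : ι) :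
    Sys (far (orth r) v) (orth r) (Trace (orth r) v) fun x => ‖inner ℂ (r x) (r v)‖ ^ 2 where
  symm := orth_symm
  irrefl := R.orth_irrefl
  sub h := by
    obtain ⟨B, hB, hv, rfl⟩ := h
    exact Finset.inter_subset_right
  clique h x hx y hy := by
    obtain ⟨B, hB, hv, rfl⟩ := h
    exact hB.2 x (Finset.mem_inter.1 hx).1 y (Finset.mem_inter.1 hy).1
  two_le h := by
    obtain ⟨B, hB, hv, rfl⟩ := h
    by_contra! q
    obtain ⟨b, hb, hc⟩ : ∃ b ∈ B, ∀ c ∈ B, c ∈ far (orth r) v → c = b := by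
      rcases (B ∩ far (orth r) v).eq_empty_or_nonempty with e | ⟨b, hb⟩
      · obtain ⟨b, hb⟩ := Finset.card_pos.1 (by rw [hB.1]; norm_num : 0 < B.card)
        refine ⟨b, hb, fun c hc hf => absurd (Finset.mem_inter.2 ⟨hc, hf⟩) (by simp [e])⟩
      · exact ⟨b, (Finset.mem_inter.1 hb).1, fun c hc hf =>
          Finset.card_le_one.1 (Nat.le_of_lt_succ q) c (Finset.mem_inter.2 ⟨hc, hf⟩) b hb⟩
    refine hv (R.unique hB hb (x := v) (fun c hcB hcb => ?_) ▸ hb)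
    by_contra n
    exact hcb (hc c hcB (mem_far.2 ⟨fun e => hv (e ▸ hcB), fun n' => n (orth_symm n')⟩))
  le_four h := by
    obtain ⟨B, hB, hv, rfl⟩ := h
    exact (Finset.card_le_card Finset.inter_subset_left).trans hB.1.le
  tight_of_clique K hK h4 hc :=
    ⟨K, ⟨h4, hc⟩, fun q => (mem_far.1 (hK q)).1 rfl, (Finset.inter_eq_left.2 hK).symm⟩
  exists_not_adj {K} h y hy _ := by
    by_contra! q
    refine (mem_far.1 hy).2 ?_
    rw [orth, R.trace_expand h, Finset.sum_eq_zero fun x hx => ?_]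
    rw [show inner ℂ (r y) (r x) = 0 from q x hx, mul_zero]
  overlap_lt {K} h y hy hyK x hx hz := by
    have hxf : x ∈ far (orth r) v := by
      obtain ⟨B, hB, hv, rfl⟩ := h
      exact (Finset.mem_inter.1 hx).2
    have e : inner ℂ (r y) (r v) = inner ℂ (r x) (r v) * inner ℂ (r y) (r x) := by
      rw [R.trace_expand h, Finset.sum_eq_single x (fun z hzK hzx => ?_) fun q => absurd hx q]
      rw [show inner ℂ (r y) (r z) = 0 from hz z hzK hzx, mul_zero]
    have h1 := R.lt y x fun q => hyK (q ▸ hx)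
    have h0 : 0 < ‖inner ℂ (r x) (r v)‖ := norm_pos_iff.2 (mem_far.1 hxf).2
    simp only [e, norm_mul]
    exact pow_lt_pow_left₀ (mul_lt_of_lt_one_right h0 h1) (by positivity) two_ne_zero
  four {K} h h4 y hy hyK x hx q := by
    obtain ⟨B, hB, hv, rfl⟩ := h
    have e : B ∩ far (orth r) v = B :=
      Finset.eq_of_subset_of_card_le Finset.inter_subset_left (by rw [h4, hB.1])
    rw [e] at hx hyK q
    exact hyK (R.unique hB hx q ▸ hx)
  diff {K L} hK hL z hz _ p hp hq := by
    clear * - R hK hL hp hq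
    have e := (R.trace_expand hK (r z)).symm.trans (R.trace_expand hL (r z))
    wlog hpK : p ∈ K \ L generalizing K L
    · rw [symmDiff_comm] at hp hq
      exact this hL hK hp hq e.symm (by
        rw [Finset.mem_symmDiff] at hp
        rw [Finset.mem_sdiff] at hpK ⊢
        tauto)
    rw [← Finset.sum_inter_add_sum_sdiff K L, ← Finset.sum_inter_add_sum_sdiff L K,
      Finset.inter_comm L K, add_right_inj] at e
    rw [Finset.sum_eq_single p (fun q hqK hqp => ?_) fun q => absurd hpK q,
      Finset.sum_eq_zero fun q hqL => ?_] at e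
    · have hpf : p ∈ far (orth r) v := by
        obtain ⟨B, hB, hv, rfl⟩ := hK
        exact (Finset.mem_inter.1 (Finset.mem_sdiff.1 hpK).1).2
      exact (mul_eq_zero.1 e).resolve_left (mem_far.1 hpf).2
    · rw [show inner ℂ (r z) (r q) = 0 from hq q (Finset.mem_symmDiff.2 (Or.inr (Finset.mem_sdiff.1 hqL)))
        fun e => (Finset.mem_sdiff.1 hqL).2 (e ▸ (Finset.mem_sdiff.1 hpK).1), mul_zero]
    · rw [show inner ℂ (r z) (r q) = 0 from hq q (Finset.mem_symmDiff.2 (Or.inl (Finset.mem_sdiff.1 hqK)))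
        hqp, mul_zero]
  square := R.square
  nonneg x := by positivity
  clique_le K hK hc := by
    have := (R.orthonormal hc).sum_inner_products_le (s := Finset.univ) (r v)
    rw [R.norm, one_pow] at this
    rwa [← Finset.sum_coe_sort K fun x => ‖inner ℂ (r x) (r v)‖ ^ 2]
  sum_eq {K} h := by
    obtain ⟨B, hB, hv, rfl⟩ := h
    have := R.parseval hB (r v)
    rw [R.norm, one_pow] at this
    rw [← this]
    refine Finset.sum_subset Finset.inter_subset_left fun x hx q => ?_
    have : orth r x v := by
      by_contra n
      exact q (Finset.mem_inter.2 ⟨hx, mem_far.2 ⟨fun e => hv (e ▸ hx), n⟩⟩)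
    rw [show inner ℂ (r x) (r v) = 0 from this, norm_zero]; norm_num
  unsat I hI hs := by
    have hv : ∀ x ∈ I, ¬ orth r x v := fun x hx => (mem_far.1 (hI hx)).2
    obtain ⟨B, hB, hd⟩ := un (insert v I) (by
      simp only [Finset.mem_insert]
      rintro x (rfl | hx) y (rfl | hy)
      exacts [R.orth_irrefl _, fun q => hv y hy (orth_symm q), hv x hx, hs x hx y hy])
    rw [Finset.disjoint_insert_right] at hd
    exact ⟨B ∩ far (orth r) v, ⟨B, hB, hd.1, rfl⟩,
      Finset.disjoint_of_subset_left Finset.inter_subset_left hd.2⟩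

theorem ten_le_card_far (R : Rays r) (un : Unsat (orth r)) (v : ι) :
    10 ≤ (far (orth r) v).card := by
  by_contra! h
  exact not_chks (R.sys un v) (Nat.le_of_lt_succ h) (by norm_num) (Or.inl rfl) (by norm_num) _
    certA_ok

end Rays

end Scene

section Net

variable {ι : Type} {adj : ι → ι → Prop}

/-- The properties of the orthogonality graph of a set of rays used for counting. -/
structure Net (adj : ι → ι → Prop) : Prop where
  symm : ∀ {x y}, adj x y → adj y x
  irrefl : ∀ x, ¬ adj x x
  unique : ∀ {B}, IsBase adj B → ∀ {b x}, b ∈ B → (∀ c ∈ B, c ≠ b → adj x c) → x = b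
  square : ∀ {a b x y z t}, a ≠ b → x ≠ y → adj a x → adj a y → adj b x → adj b y →
    adj a z → adj b z → adj x t → adj y t → adj z t

open Classical in
/-- The elements adjacent to `v`. -/
noncomputable def nbr [Fintype ι] (adj : ι → ι → Prop) (v : ι) : Finset ι := {x | adj x v}

theorem mem_nbr [Fintype ι] {v x : ι} : x ∈ nbr adj v ↔ adj x v := by simp [nbr]

open Classical in
/-- The bases containing `x`. -/
noncomputable def through [Fintype ι] (adj : ι → ι → Prop) (x : ι) : Finset (Finset ι) :=
  {B | IsBase adj B ∧ x ∈ B}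

theorem mem_through [Fintype ι] {x : ι} {B : Finset ι} :
    B ∈ through adj x ↔ IsBase adj B ∧ x ∈ B := by simp [through]

theorem IsBase.eq_of_subset {B C : Finset ι} (hB : IsBase adj B) (hC : IsBase adj C) (h : B ⊆ C) :
    B = C :=
  Finset.eq_of_subset_of_card_le h (by rw [hB.1, hC.1])

theorem IsBase.card_union_add [DecidableEq ι] {B C : Finset ι} (hB : IsBase adj B) (hC : IsBase adj C) :
    (B ∪ C).card + (B ∩ C).card = 8 := by
  rw [Finset.card_union_add_card_inter, hB.1, hC.1]

/-- An element outside a base misses at least two of its members. -/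
theorem Net.two_le_sdiff [DecidableEq ι] (N : Net adj) {D : Finset ι} (hD : IsBase adj D) {e : ι} (he : e ∉ D)
    {U : Finset ι} (hU : ∀ c ∈ D ∩ U, adj e c) : 2 ≤ (D \ U).card := by
  by_contra! q
  obtain ⟨b, hb, hc⟩ : ∃ b ∈ D, ∀ c ∈ D, c ∉ U → c = b := by
    rcases (D \ U).eq_empty_or_nonempty with h | ⟨b, hb⟩
    · obtain ⟨b, hb⟩ := Finset.card_pos.1 (by rw [hD.1]; norm_num : 0 < D.card)
      exact ⟨b, hb, fun c hc hf => absurd (Finset.mem_sdiff.2 ⟨hc, hf⟩) (by simp [h])⟩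
    · exact ⟨b, (Finset.mem_sdiff.1 hb).1, fun c hc hf =>
        Finset.card_le_one.1 (Nat.le_of_lt_succ q) c (Finset.mem_sdiff.2 ⟨hc, hf⟩) b hb⟩
  refine he (N.unique hD hb (fun c hcD hcb => hU c (Finset.mem_inter.2 ⟨hcD, ?_⟩)) ▸ hb)
  by_contra n
  exact hcb (hc c hcD n)

theorem Net.card_inter_le [DecidableEq ι] (N : Net adj) {B C : Finset ι} (hB : IsBase adj B) (hC : IsBase adj C)
    (h : B ≠ C) : (B ∩ C).card ≤ 2 := by
  obtain ⟨c, hc, hcB⟩ := Finset.not_subset.1 fun q => h (hC.eq_of_subset hB q).symm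
  have := N.two_le_sdiff hB hcB (U := C) fun d hd =>
    hC.2 c hc d (Finset.mem_inter.1 hd).2 fun e => hcB (e ▸ (Finset.mem_inter.1 hd).1)
  have := Finset.card_inter_add_card_sdiff B C
  rw [hB.1] at this
  omega

theorem Net.five_le_union [DecidableEq ι] (N : Net adj) {B C : Finset ι} (hB : IsBase adj B)
    (hC : IsBase adj C) (h : B ≠ C) {x : ι} (hxB : x ∈ B) : 5 ≤ ((B ∪ C).erase x).card := by
  rw [Finset.card_erase_of_mem (Finset.mem_union_left _ hxB)]
  have := N.card_inter_le hB hC h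
  have := hB.card_union_add hC
  omega

variable [Fintype ι] [DecidableEq ι]

theorem IsBase.erase_subset {B : Finset ι} (hB : IsBase adj B) {x : ι} (hx : x ∈ B) :
    B.erase x ⊆ nbr adj x := fun y hy => by
  rw [Finset.mem_erase] at hy
  exact mem_nbr.2 (hB.2 y hy.2 x hx hy.1)

namespace Net

theorem card_add (N : Net adj) (v : ι) :
    (nbr adj v).card + (far adj v).card + 1 = Fintype.card ι := by
  have e : (Finset.univ : Finset ι) = insert v (nbr adj v ∪ far adj v) := by
    ext x
    simp only [Finset.mem_univ, Finset.mem_insert, Finset.mem_union, mem_nbr, mem_far, true_iff]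
    tauto
  rw [← Finset.card_univ, e, Finset.card_insert_of_notMem, Finset.card_union_of_disjoint]
  · rw [Finset.disjoint_left]
    exact fun x hx hy => (mem_far.1 hy).2 (mem_nbr.1 hx)
  · rw [Finset.mem_union, mem_nbr, mem_far]
    exact fun h => h.elim (N.irrefl v) fun h => h.1 rfl

theorem union_erase_subset {B C : Finset ι} (hB : IsBase adj B) (hC : IsBase adj C) {x : ι}
    (hxB : x ∈ B) (hxC : x ∈ C) : (B ∪ C).erase x ⊆ nbr adj x := by
  rw [Finset.erase_union_distrib]
  exact Finset.union_subset (hB.erase_subset hxB) (hC.erase_subset hxC)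

/-- An element of three bases has at least seven neighbours. -/
theorem seven_le (N : Net adj) {B C D : Finset ι} {x : ι} (hB : B ∈ through adj x)
    (hC : C ∈ through adj x) (hD : D ∈ through adj x) (hBC : B ≠ C) (hBD : B ≠ D) (hCD : C ≠ D) :
    7 ≤ (nbr adj x).card := by
  rw [mem_through] at hB hC hD
  obtain ⟨hB, xB⟩ := hB
  obtain ⟨hC, xC⟩ := hC
  obtain ⟨hD, xD⟩ := hD
  have hle : ((B ∪ C ∪ D).erase x).card ≤ (nbr adj x).card := by
    refine Finset.card_le_card ?_
    rw [Finset.erase_union_distrib]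
    exact Finset.union_subset (union_erase_subset hB hC xB xC) (hD.erase_subset xD)
  rw [Finset.card_erase_of_mem (Finset.mem_union_right _ xD), Finset.union_comm,
    ← Finset.card_sdiff_add_card D (B ∪ C)] at hle
  have h1 := hB.card_union_add hC
  have h2 := N.card_inter_le hB hC hBC
  have h3 := Finset.card_inter_add_card_sdiff D (B ∪ C)
  rw [hD.1, Finset.inter_union_distrib_left] at h3
  have h4 := N.card_inter_le hD hB hBD.symm
  have h5 := N.card_inter_le hD hC hCD.symm
  by_cases hx : B ∩ C ⊆ {x}
  · have h6 := Finset.card_le_card hx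
    rw [Finset.card_singleton] at h6
    have h7 := Finset.card_union_add_card_inter (D ∩ B) (D ∩ C)
    have h8 : 0 < ((D ∩ B) ∩ (D ∩ C)).card := Finset.card_pos.2 ⟨x, by simp [xB, xC, xD]⟩
    omega
  · obtain ⟨e, he, hex⟩ := Finset.not_subset.1 hx
    rw [Finset.mem_inter] at he
    rw [Finset.mem_singleton] at hex
    by_cases heD : e ∈ D
    · have pair : ∀ F : Finset ι, (D ∩ F).card ≤ 2 → x ∈ F → e ∈ F → D ∩ F = {x, e} :=
        fun F hF hx he => (Finset.eq_of_subset_of_card_le (by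
          rintro y hy
          rw [Finset.mem_insert, Finset.mem_singleton] at hy
          rcases hy with rfl | rfl <;> exact Finset.mem_inter.2 ⟨‹_›, ‹_›⟩)
          (by rwa [Finset.card_pair (Ne.symm hex)])).symm
      rw [pair B h4 xB he.1, pair C h5 xC he.2, Finset.union_self, Finset.card_pair (Ne.symm hex)] at h3
      omega
    · have h6 := N.two_le_sdiff hD heD (U := B ∪ C) fun c hc => by
        rw [Finset.mem_inter, Finset.mem_union] at hc
        have hec : e ≠ c := fun q => heD (q ▸ hc.1)
        exact hc.2.elim (fun h => hB.2 e he.1 c h hec) fun h => hC.2 e he.2 c h hec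
      omega

theorem card_through_le (N : Net adj) {x : ι} (h : (nbr adj x).card ≤ 6) :
    (through adj x).card ≤ 2 := by
  by_contra! q
  obtain ⟨B, hB, C, hC, D, hD, h1, h2, h3⟩ := Finset.two_lt_card.1 q
  exact absurd (N.seven_le hB hC hD h1 h2 h3) (by omega)

end Net

end Net

section Count

variable {ι : Type} [Fintype ι] {adj : ι → ι → Prop}

theorem hidden_adj {B : Finset ι} {v y : ι} (hv : v ∉ B) (hy : y ∈ B) (h : y ∉ far adj v) :
    adj y v := by
  by_contra n
  exact h (mem_far.2 ⟨fun e => hv (e ▸ hy), n⟩)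

variable [DecidableEq ι]

namespace Net

/-- The counting rules hold around `v` when no neighbour of `v` lies in two bases avoiding `v`. -/
theorem bRules (N : Net adj) {v : ι} (deg : ∀ x, (nbr adj x).card ≤ 6)
    (hid : ∀ h, adj h v → ∀ B C, IsBase adj B → IsBase adj C → v ∉ B → v ∉ C → h ∈ B → h ∈ C →
      B = C) : BRules (far adj v) adj (Trace adj v) where
  two_bases := by
    rintro _ _ _ ⟨B, hB, vB, rfl⟩ ⟨C, hC, vC, rfl⟩ ⟨D, hD, vD, rfl⟩ x xB xC xD
    rw [Finset.mem_inter] at xB xC xD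
    by_contra! q
    refine absurd (N.seven_le (mem_through.2 ⟨hB, xB.1⟩) (mem_through.2 ⟨hC, xC.1⟩)
      (mem_through.2 ⟨hD, xD.1⟩) ?_ ?_ ?_) (by have := deg x; omega)
    · rintro rfl; exact q.1 rfl
    · rintro rfl; exact q.2.2 rfl
    · rintro rfl; exact q.2.1 rfl
  single := by
    rintro _ _ ⟨B, hB, vB, rfl⟩ ⟨C, hC, vC, rfl⟩ x hx z hz hxz
    have xm : x ∈ (B ∩ far adj v) ∩ (C ∩ far adj v) := by rw [hx]; exact Finset.mem_singleton_self x
    simp only [Finset.mem_inter] at xm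
    have key : ∀ y ∈ B ∩ C, y ∈ far adj v → y = x := fun y hy hf => by
      rw [← Finset.mem_singleton, ← hx]
      simp only [Finset.mem_inter] at hy ⊢
      exact ⟨⟨hy.1, hf⟩, hy.2, hf⟩
    have hBC : B ≠ C := by
      rintro rfl
      have h2 := N.two_le_sdiff hB vB (U := nbr adj v) fun c hc =>
        N.symm (mem_nbr.1 (Finset.mem_inter.1 hc).2)
      have h1 : B \ nbr adj v ⊆ {x} := fun y hy => by
        rw [Finset.mem_sdiff, mem_nbr] at hy
        exact Finset.mem_singleton.2 (key y (by simpa using hy.1)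
          (by by_contra q; exact hy.2 (hidden_adj vB hy.1 q)))
      have := Finset.card_le_card h1
      rw [Finset.card_singleton] at this
      omega
    have h1 : B ∩ C ⊆ {x} := fun y hy => by
      refine Finset.mem_singleton.2 (key y hy ?_)
      by_contra q
      rw [Finset.mem_inter] at hy
      exact hBC (hid y (hidden_adj vB hy.1 q) B C hB hC vB vC hy.1 hy.2)
    have h1 := Finset.card_le_card h1
    rw [Finset.card_singleton] at h1
    have h2 := hB.card_union_add hC
    have e := Finset.eq_of_subset_of_card_le (union_erase_subset hB hC xm.1.1 xm.2.1) (by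
      rw [Finset.card_erase_of_mem (Finset.mem_union_left _ xm.1.1)]
      have := deg x
      omega)
    have hz' := mem_nbr.2 (N.symm hxz)
    rw [← e] at hz'
    simp only [Finset.mem_erase, Finset.mem_union, Finset.mem_inter] at hz' ⊢
    tauto
  double := by
    rintro _ _ ⟨B, hB, vB, rfl⟩ ⟨C, hC, vC, rfl⟩ ne h2 x hx z hz z' hz' xz xz' zn zn'
    simp only [Finset.mem_inter] at hx
    have hBC : B ≠ C := by rintro rfl; exact ne rfl
    have out : ∀ y ∈ far adj v, y ∉ B ∩ far adj v ∪ C ∩ far adj v → y ∉ (B ∪ C).erase x := by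
      intro y hy h q
      simp only [Finset.mem_erase, Finset.mem_union, Finset.mem_inter] at h q
      tauto
    by_contra q
    have h5 := N.five_le_union hB hC hBC hx.1.1
    have sub : insert z (insert z' ((B ∪ C).erase x)) ⊆ nbr adj x :=
      Finset.insert_subset (mem_nbr.2 (N.symm xz)) (Finset.insert_subset (mem_nbr.2 (N.symm xz'))
        (union_erase_subset hB hC hx.1.1 hx.2.1))
    have := Finset.card_le_card sub
    rw [Finset.card_insert_of_notMem, Finset.card_insert_of_notMem (out z' hz' zn')] at this
    · have := deg x
      omega
    · rw [Finset.mem_insert]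
      exact fun h => h.elim q (out z hz zn)
  hidden P hP := by
    choose! b hb hv he using hP
    have hsub : P.biUnion (fun K => b K \ far adj v) ⊆ nbr adj v := by
      intro y hy
      simp only [Finset.mem_biUnion, Finset.mem_sdiff] at hy
      obtain ⟨K, hK, hy, hf⟩ := hy
      exact mem_nbr.2 (hidden_adj (hv K hK) hy hf)
    refine le_trans (le_of_eq ?_) ((Finset.card_le_card hsub).trans (deg v))
    rw [Finset.card_biUnion]
    · refine Finset.sum_congr rfl fun K hK => ?_
      have := Finset.card_inter_add_card_sdiff (b K) (far adj v)
      rw [← he K hK, (hb K hK).1] at this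
      omega
    · intro K hK L hL hKL
      refine Finset.disjoint_left.2 fun y hy hy' => ?_
      rw [Finset.mem_sdiff] at hy hy'
      refine hKL ?_
      rw [he K hK, he L hL, hid y (hidden_adj (hv K hK) hy.1 hy.2) (b K) (b L) (hb K hK) (hb L hL)
        (hv K hK) (hv L hL) hy.1 hy'.1]
  quad := by
    rintro _ _ _ ⟨B, hB, vB, rfl⟩ ⟨C, hC, vC, rfl⟩ ⟨D, hD, vD, rfl⟩ hB4 hC3 - hsub hCB hDB
    have eB : B ∩ far adj v = B :=
      Finset.eq_of_subset_of_card_le Finset.inter_subset_left (by rw [hB4, hB.1])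
    rw [eB] at hsub hCB hDB
    obtain ⟨h, hh⟩ : (C \ far adj v).Nonempty := by
      rw [← Finset.card_pos]
      have := Finset.card_inter_add_card_sdiff C (far adj v)
      rw [hC3, hC.1] at this
      omega
    rw [Finset.mem_sdiff] at hh
    have dis : (C ∩ far adj v ∩ B) ∩ (D ∩ far adj v ∩ B) = ∅ := by
      rw [← Finset.card_eq_zero]
      have h1 := Finset.card_union_add_card_inter (C ∩ far adj v ∩ B) (D ∩ far adj v ∩ B)
      rw [← Finset.union_inter_distrib_right, Finset.inter_eq_right.2 hsub, hB.1, hCB, hDB] at h1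
      omega
    obtain ⟨k₁, k₂, hk, eC⟩ := Finset.card_eq_two.1 hCB
    obtain ⟨l₁, l₂, hl, eD⟩ := Finset.card_eq_two.1 hDB
    have mC : ∀ y, y = k₁ ∨ y = k₂ → (y ∈ C ∧ y ∈ far adj v) ∧ y ∈ B := fun y hy => by
      rw [← Finset.mem_inter, ← Finset.mem_inter, eC]; simpa using hy
    have mD : ∀ y, y = l₁ ∨ y = l₂ → (y ∈ D ∧ y ∈ far adj v) ∧ y ∈ B := fun y hy => by
      rw [← Finset.mem_inter, ← Finset.mem_inter, eD]; simpa using hy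
    have ne : ∀ k l, k = k₁ ∨ k = k₂ → l = l₁ ∨ l = l₂ → k ≠ l := by
      rintro k _ h1 h2 rfl
      have : k ∈ (C ∩ far adj v ∩ B) ∩ (D ∩ far adj v ∩ B) := by rw [eC, eD]; simp [h1, h2]
      rw [dis] at this
      exact Finset.notMem_empty _ this
    have adjB : ∀ k l, k = k₁ ∨ k = k₂ → l = l₁ ∨ l = l₂ → adj k l := fun k l h1 h2 =>
      hB.2 k (mC k h1).2 l (mD l h2).2 (ne k l h1 h2)
    have cross : ∀ c ∈ C \ {k₁, k₂}, ∀ d ∈ D \ {l₁, l₂}, adj c d := fun c hc d hd => by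
      simp only [Finset.mem_sdiff, Finset.mem_insert, Finset.mem_singleton, not_or] at hc hd
      exact N.square hk hl (adjB _ _ (.inl rfl) (.inl rfl)) (adjB _ _ (.inl rfl) (.inr rfl))
        (adjB _ _ (.inr rfl) (.inl rfl)) (adjB _ _ (.inr rfl) (.inr rfl))
        (hC.2 _ (mC _ (.inl rfl)).1.1 _ hc.1 (Ne.symm hc.2.1))
        (hC.2 _ (mC _ (.inr rfl)).1.1 _ hc.1 (Ne.symm hc.2.2))
        (hD.2 _ (mD _ (.inl rfl)).1.1 _ hd.1 (Ne.symm hd.2.1))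
        (hD.2 _ (mD _ (.inr rfl)).1.1 _ hd.1 (Ne.symm hd.2.2))
    have hF : IsBase adj (C \ {k₁, k₂} ∪ D \ {l₁, l₂}) := by
      constructor
      · rw [Finset.card_union_of_disjoint (Finset.disjoint_left.2 fun y h1 h2 =>
          N.irrefl y (cross y h1 y h2)), Finset.card_sdiff_of_subset, Finset.card_sdiff_of_subset, hC.1, hD.1,
          Finset.card_pair hk, Finset.card_pair hl]
        · exact fun y hy => (mD y (by simpa using hy)).1.1
        · exact fun y hy => (mC y (by simpa using hy)).1.1
      · intro x hx y hy hxy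
        rw [Finset.mem_union] at hx hy
        rcases hx with hx | hx <;> rcases hy with hy | hy
        · exact hC.2 x (Finset.mem_sdiff.1 hx).1 y (Finset.mem_sdiff.1 hy).1 hxy
        · exact cross x hx y hy
        · exact N.symm (cross y hy x hx)
        · exact hD.2 x (Finset.mem_sdiff.1 hx).1 y (Finset.mem_sdiff.1 hy).1 hxy
    have hk₁ := mC k₁ (.inl rfl)
    have e := hid h (hidden_adj vC hh.1 hh.2) _ C hF hC (by simp [vC, vD]) vC (by
      refine Finset.mem_union_left _ (Finset.mem_sdiff.2 ⟨hh.1, fun q => hh.2 ?_⟩)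
      exact (mC h (by simpa using q)).1.2) hh.1
    have hk' := hk₁.1.1
    rw [← e] at hk'
    simp only [Finset.mem_union, Finset.mem_sdiff, Finset.mem_insert, true_or, not_true, and_false,
      false_or] at hk'
    have : k₁ ∈ D ∩ far adj v ∩ B :=
      Finset.mem_inter.2 ⟨Finset.mem_inter.2 ⟨hk'.1, hk₁.1.2⟩, hk₁.2⟩
    rw [eD] at this
    simp only [Finset.mem_insert, Finset.mem_singleton] at this
    exact ne k₁ k₁ (.inl rfl) this rfl

end Net

end Count

section Bound

namespace Net

variable {ι : Type} [Fintype ι] [DecidableEq ι] {adj : ι → ι → Prop}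

/-- If all degrees are at most four, then the bases are disjoint and a greedy choice meets up to
four of them. -/
theorem exists_transversal (N : Net adj) (deg : ∀ x, (nbr adj x).card ≤ 4) (P : Finset (Finset ι)) :
    (∀ B ∈ P, IsBase adj B) → P.card ≤ 4 → ∃ I ⊆ P.biUnion id, I.card ≤ P.card ∧
      (∀ x ∈ I, ∀ y ∈ I, ¬ adj x y) ∧ ∀ B ∈ P, ¬ Disjoint B I := by
  have dis : ∀ B C, IsBase adj B → IsBase adj C → ∀ x, x ∈ B → x ∈ C → B = C := by
    intro B C hB hC x hx hx'
    by_contra q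
    have h1 := N.five_le_union hB hC q hx
    have h2 := Finset.card_le_card (union_erase_subset hB hC hx hx')
    have h3 := deg x
    omega
  induction P using Finset.induction_on with
  | empty => exact fun _ _ => ⟨∅, by simp⟩
  | insert B P hBP ih =>
    intro hP hc
    rw [Finset.card_insert_of_notMem hBP] at hc
    obtain ⟨I, hI, hIc, hs, hd⟩ := ih (fun C hC => hP C (Finset.mem_insert_of_mem hC)) (by omega)
    have hB := hP B (Finset.mem_insert_self _ _)
    have one : ∀ x ∈ I, (B ∩ nbr adj x).card ≤ 1 := fun x hx => by
      obtain ⟨C, hC, hxC : x ∈ C⟩ := Finset.mem_biUnion.1 (hI hx)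
      have hC' := hP C (Finset.mem_insert_of_mem hC)
      have h1 : Disjoint (C.erase x) (B ∩ nbr adj x) := Finset.disjoint_left.2 fun y h1 h2 =>
        hBP (dis B C hB hC' y (Finset.mem_inter.1 h2).1 (Finset.mem_erase.1 h1).2 ▸ hC)
      have h2 := Finset.card_le_card
        (Finset.union_subset (hC'.erase_subset hxC) (Finset.inter_subset_right (s₁ := B)))
      rw [Finset.card_union_of_disjoint h1, Finset.card_erase_of_mem hxC, hC'.1] at h2
      have h3 := deg x
      omega
    obtain ⟨b, hb, hbI⟩ : ∃ b ∈ B, b ∉ I.biUnion fun x => B ∩ nbr adj x :=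
      Finset.exists_mem_notMem_of_card_lt_card (by
        have := Finset.card_biUnion_le_card_mul I _ 1 one
        rw [hB.1]
        omega)
    have hb' : ∀ x ∈ I, ¬ adj b x := fun x hx q =>
      hbI (Finset.mem_biUnion.2 ⟨x, hx, Finset.mem_inter.2 ⟨hb, mem_nbr.2 q⟩⟩)
    refine ⟨insert b I, ?_, ?_, ?_, ?_⟩
    · rw [Finset.biUnion_insert, Finset.insert_subset_iff]
      exact ⟨Finset.mem_union_left _ hb, hI.trans Finset.subset_union_right⟩
    · rw [Finset.card_insert_of_notMem hBP]
      exact (Finset.card_insert_le _ _).trans (by omega)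
    · simp only [Finset.mem_insert]
      rintro x (rfl | hx) y (rfl | hy)
      exacts [N.irrefl _, hb' y hy, fun q => hb' x hx (N.symm q), hs x hx y hy]
    · intro C hC
      rw [Finset.disjoint_insert_right]
      rcases Finset.mem_insert.1 hC with rfl | hC
      · exact fun q => q.1 hb
      · exact fun q => hd C hC q.2

/-- If all degrees are at most four and there are at most sixteen elements, then some set of
pairwise nonadjacent elements meets every base. -/
theorem not_unsat (N : Net adj) (deg : ∀ x, (nbr adj x).card ≤ 4) (hn : Fintype.card ι ≤ 16) : ¬ Unsat adj := by
  classical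
  intro un
  let P : Finset (Finset ι) := {B | IsBase adj B}
  have hP : ∀ {B}, B ∈ P ↔ IsBase adj B := by simp [P]
  have hc : P.card ≤ 4 := by
    have := Finset.card_biUnion (s := P) (t := id) fun B hB C hC q => Finset.disjoint_left.2
      fun x hx hx' => by
        have h1 := N.five_le_union (hP.1 hB) (hP.1 hC) q hx
        have h2 := Finset.card_le_card (union_erase_subset (hP.1 hB) (hP.1 hC) hx hx')
        have h3 := deg x
        omega
    rw [Finset.sum_congr rfl fun B hB => show (id B).card = 4 from (hP.1 hB).1, Finset.sum_const,
      smul_eq_mul] at this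
    have := Finset.card_le_univ (P.biUnion id)
    omega
  obtain ⟨I, -, -, hs, hd⟩ := N.exists_transversal deg P (fun B => hP.1) hc
  obtain ⟨B, hB, h⟩ := un I hs
  exact hd B (hP.2 hB) h

/-- With an odd number of elements, some two bases meet in a single element. -/
theorem exists_inter_eq_singleton (N : Net adj) (cover : ∀ x, ∃ B, IsBase adj B ∧ x ∈ B)
    (deg : ∀ x, (nbr adj x).card ≤ 6) (hn : Odd (Fintype.card ι)) :
    ∃ B C x, IsBase adj B ∧ IsBase adj C ∧ B ∩ C = {x} := by
  classical
  by_contra! none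
  let P : Finset (Finset ι) := {B | IsBase adj B}
  let d : Finset ι := {x | (through adj x).card = 2}
  have count : ∑ x, (through adj x).card = 4 * P.card := by
    have := Finset.sum_card_bipartiteAbove_eq_sum_card_bipartiteBelow (s := Finset.univ) (t := P)
      fun (x : ι) B => x ∈ B
    rw [Finset.sum_congr rfl fun B hB => show (Finset.univ.bipartiteBelow _ B).card = 4 by
      simp [Finset.bipartiteBelow, ((Finset.mem_filter.1 hB).2).1], Finset.sum_const, smul_eq_mul,
      mul_comm] at this
    rw [← this]
    refine Finset.sum_congr rfl fun x _ => ?_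
    congr 1
    ext B
    simp [Finset.bipartiteAbove, mem_through, P]
  have split : ∑ x, (through adj x).card = Fintype.card ι + d.card := by
    rw [← Finset.card_univ, Finset.card_filter, Finset.card_eq_sum_ones, ← Finset.sum_add_distrib]
    refine Finset.sum_congr rfl fun x _ => ?_
    have h1 := N.card_through_le (deg x)
    obtain ⟨B, hB, hx⟩ := cover x
    have h2 := Finset.card_pos.2 ⟨B, mem_through.2 ⟨hB, hx⟩⟩
    split_ifs <;> omega
  have fibre : ∀ p ∈ d.image (through adj), {x ∈ d | through adj x = p}.card = 2 := by
    intro p hp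
    obtain ⟨x, hx, rfl⟩ := Finset.mem_image.1 hp
    obtain ⟨B, C, hBC, e⟩ := Finset.card_eq_two.1 (Finset.mem_filter.1 hx).2
    have mB : ∀ z, through adj z = {B, C} → IsBase adj B ∧ z ∈ B := fun z h =>
      mem_through.1 (by rw [h]; simp)
    have mC : ∀ z, through adj z = {B, C} → IsBase adj C ∧ z ∈ C := fun z h =>
      mem_through.1 (by rw [h]; simp)
    have hB := (mB x e).1
    have hC := (mC x e).1
    have hF : {y ∈ d | through adj y = through adj x} = B ∩ C := by
      ext y
      rw [e, Finset.mem_filter, Finset.mem_inter]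
      refine ⟨fun h => ⟨(mB y h.2).2, (mC y h.2).2⟩, fun h => ?_⟩
      have ey : through adj y = {B, C} := (Finset.eq_of_subset_of_card_le (by
        simp [Finset.insert_subset_iff, mem_through, hB, hC, h.1, h.2]) (by
        rw [Finset.card_pair hBC]; exact N.card_through_le (deg y))).symm
      exact ⟨by simp [d, ey, Finset.card_pair hBC], ey⟩
    rw [hF]
    refine le_antisymm (N.card_inter_le hB hC hBC) ?_
    by_contra! q
    have mx := Finset.mem_inter.2 ⟨(mB x e).2, (mC x e).2⟩
    exact none B C x hB hC (Finset.eq_singleton_iff_unique_mem.2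
      ⟨mx, fun y hy => Finset.card_le_one.1 (Nat.le_of_lt_succ q) y hy x mx⟩)
  have := Finset.card_eq_sum_card_image (through adj) d
  rw [Finset.sum_congr rfl fibre, Finset.sum_const, smul_eq_mul] at this
  obtain ⟨k, hk⟩ := hn
  omega

end Net

theorem Rays.net {E : Type} [NormedAddCommGroup E] [InnerProductSpace ℂ E] {ι : Type} {r : ι → E}
    (R : Rays r) : Net (orth r) :=
  ⟨orth_symm, R.orth_irrefl, R.unique, R.square⟩

/-- At most seventeen rays, each in some base, admit a set of pairwise nonorthogonal rays meeting
every base. -/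
theorem Rays.not_unsat {E : Type} [NormedAddCommGroup E] [InnerProductSpace ℂ E] {ι : Type}
    [Fintype ι] {r : ι → E} (R : Rays r) (cover : ∀ x, ∃ B, IsBase (orth r) B ∧ x ∈ B)
    (hn : Fintype.card ι ≤ 17) : ¬ Unsat (orth r) := by
  classical
  intro un
  have N := R.net
  have sum := N.card_add
  have ten := R.ten_le_card_far un
  have deg : ∀ x, (nbr (orth r) x).card ≤ 6 := fun x => by
    have := sum x
    have := ten x
    omega
  have key : ∀ v, (far (orth r) v).card ≤ 10 → (∀ h, orth r h v → ∀ B C, IsBase (orth r) B →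
      IsBase (orth r) C → v ∉ B → v ∉ C → h ∈ B → h ∈ C → B = C) → False := fun v hv hid =>
    not_chks (R.sys un v) hv (by norm_num) (Or.inr (N.bRules deg hid)) (by norm_num) _ certB_ok
  rcases Nat.lt_or_ge 16 (Fintype.card ι) with h17 | h16
  · obtain ⟨B, C, v, hB, hC, e⟩ := N.exists_inter_eq_singleton cover deg
      (by rw [le_antisymm hn h17]; decide)
    obtain ⟨vB, vC⟩ := Finset.mem_inter.1 (e ▸ Finset.mem_singleton_self v : v ∈ B ∩ C)
    have h1 := hB.card_union_add hC
    rw [e, Finset.card_singleton] at h1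
    have h2 : ((B ∪ C).erase v).card = 6 := by
      rw [Finset.card_erase_of_mem (Finset.mem_union_left _ vB)]; omega
    have h3 := Finset.eq_of_subset_of_card_le (Net.union_erase_subset hB hC vB vC)
      (by rw [h2]; exact deg v)
    refine key v (by have := sum v; rw [← h3, h2] at this; omega) fun h hh D F hD hF vD vF hhD hhF => ?_
    by_contra q
    have h4 : h ∈ B ∪ C := Finset.mem_of_mem_erase (h3 ▸ mem_nbr.2 hh)
    have last : ∀ G, IsBase (orth r) G → v ∈ G → h ∈ G → False := fun G hG vG hhG =>
      absurd (N.seven_le (mem_through.2 ⟨hG, hhG⟩) (mem_through.2 ⟨hD, hhD⟩)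
        (mem_through.2 ⟨hF, hhF⟩) (fun e => vD (e ▸ vG)) (fun e => vF (e ▸ vG)) q)
        (by have := deg h; omega)
    exact (Finset.mem_union.1 h4).elim (last B hB vB) (last C hC vC)
  · by_cases d4 : ∀ x, (nbr (orth r) x).card ≤ 4
    · exact N.not_unsat d4 h16 un
    · push Not at d4
      obtain ⟨v, hv⟩ := d4
      refine key v (by have := sum v; omega) fun h hh D F hD hF vD vF hhD hhF => ?_
      by_contra q
      have h1 := N.five_le_union hD hF q hhD
      have h2 : insert v ((D ∪ F).erase h) ⊆ nbr (orth r) h :=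
        Finset.insert_subset (mem_nbr.2 (N.symm hh)) (Net.union_erase_subset hD hF hhD hhF)
      have h3 := Finset.card_le_card h2
      rw [Finset.card_insert_of_notMem (by simp [vD, vF])] at h3
      have := sum h
      have := ten h
      omega

end Bound

section Reduction

/-- Two vectors spanning the same line. -/
def Par (x y : Fin 4 → ℂ) : Prop := ∃ c : ℂ, c ≠ 0 ∧ x = c • y

theorem Par.refl (x : Fin 4 → ℂ) : Par x x := ⟨1, one_ne_zero, (one_smul _ _).symm⟩

theorem Par.dot_eq_zero_iff {x y x' y' : Fin 4 → ℂ} (h : Par x x') (h' : Par y y') :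
    star x ⬝ᵥ y = 0 ↔ star x' ⬝ᵥ y' = 0 := by
  obtain ⟨c, hc, rfl⟩ := h
  obtain ⟨d, hd, rfl⟩ := h'
  simp [star_smul, smul_dotProduct, dotProduct_smul, hc, hd]

theorem Par.symm {x y : Fin 4 → ℂ} (h : Par x y) : Par y x := by
  obtain ⟨c, hc, rfl⟩ := h
  exact ⟨c⁻¹, inv_ne_zero hc, (inv_smul_smul₀ hc y).symm⟩

theorem Par.trans {x y z : Fin 4 → ℂ} (h : Par x y) (h' : Par y z) : Par x z := by
  obtain ⟨c, hc, rfl⟩ := h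
  obtain ⟨d, hd, rfl⟩ := h'
  exact ⟨c * d, mul_ne_zero hc hd, (mul_smul _ _ _).symm⟩

theorem exists_representatives (S : Finset (Fin 4 → ℂ)) :
    ∃ R ⊆ S, (∀ x ∈ R, ∀ y ∈ R, Par x y → x = y) ∧ ∀ x ∈ S, ∃ y ∈ R, Par x y := by
  classical
  induction S using Finset.induction_on with
  | empty => exact ⟨∅, by simp⟩
  | insert a S _ ih =>
    obtain ⟨R, hR, hp, hc⟩ := ih
    by_cases h : ∃ y ∈ R, Par a y
    · refine ⟨R, hR.trans (Finset.subset_insert _ _), hp, fun x hx => ?_⟩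
      rcases Finset.mem_insert.1 hx with rfl | hx
      exacts [h, hc x hx]
    · push Not at h
      refine ⟨insert a R, Finset.insert_subset_insert _ hR, ?_, fun x hx => ?_⟩
      · simp only [Finset.mem_insert]
        rintro x (rfl | hx) y (rfl | hy) q
        exacts [rfl, absurd q (h y hy), absurd q.symm (h x hx), hp x hx y hy q]
      · rcases Finset.mem_insert.1 hx with rfl | hx
        · exact ⟨x, Finset.mem_insert_self _ _, Par.refl x⟩
        · obtain ⟨y, hy, q⟩ := hc x hx
          exact ⟨y, Finset.mem_insert_of_mem hy, q⟩

/-- A vector of `ℂ⁴` as a point of the Euclidean space. -/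
def point (x : Fin 4 → ℂ) : EuclideanSpace ℂ (Fin 4) := WithLp.toLp 2 x

theorem inner_point (x y : Fin 4 → ℂ) : inner ℂ (point x) (point y) = star x ⬝ᵥ y := by
  rw [point, point, EuclideanSpace.inner_toLp_toLp, dotProduct_comm]

theorem norm_point {x : Fin 4 → ℂ} (h : star x ⬝ᵥ x = (1 : ℂ)) : ‖point x‖ = 1 := by
  have := inner_self_eq_norm_sq_to_K (𝕜 := ℂ) (point x)
  rw [inner_point, h] at this
  have : ‖point x‖ ^ 2 = 1 := by exact Complex.ofReal_injective (by push_cast; exact this.symm)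
  exact (pow_eq_one_iff_of_nonneg (norm_nonneg _) two_ne_zero).1 this

theorem norm_inner_point_lt {x y : Fin 4 → ℂ} (hx : star x ⬝ᵥ x = (1 : ℂ)) (hy : star y ⬝ᵥ y = (1 : ℂ))
    (h : ¬ Par x y) : ‖inner ℂ (point x) (point y)‖ < 1 := by
  have h1 := norm_inner_le_norm (𝕜 := ℂ) (point x) (point y)
  have nx := norm_point hx
  have ny := norm_point hy
  rw [nx, ny, mul_one] at h1
  refine lt_of_le_of_ne h1 fun e => ?_
  obtain ⟨c, hc, q⟩ := (norm_inner_eq_norm_iff (𝕜 := ℂ) (norm_ne_zero_iff.1 (by simp [nx]))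
    (norm_ne_zero_iff.1 (by simp [ny]))).1 (e.trans (by rw [nx, ny, mul_one]))
  exact h (Par.symm ⟨c, hc, congrArg WithLp.ofLp q⟩)

/-- Unit vectors, no two of them parallel, of which at most seventeen lie in bases: some set of
pairwise nonorthogonal ones meets every base. -/
theorem exists_stable {R : Finset (Fin 4 → ℂ)} (hunit : ∀ x ∈ R, star x ⬝ᵥ x = (1 : ℂ))
    (hp : ∀ x ∈ R, ∀ y ∈ R, Par x y → x = y) (hc : R.card ≤ 17) :
    ∃ I ⊆ R, (∀ x ∈ I, ∀ y ∈ I, star x ⬝ᵥ y ≠ 0) ∧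
      ∀ B ⊆ R, IsBase (fun x y => star x ⬝ᵥ y = 0) B → ∃ x ∈ B, x ∈ I := by
  classical
  let adj : (Fin 4 → ℂ) → (Fin 4 → ℂ) → Prop := fun x y => star x ⬝ᵥ y = 0
  let T : Finset (Fin 4 → ℂ) := {x ∈ R | ∃ B ⊆ R, IsBase adj B ∧ x ∈ B}
  have hT : ∀ B ⊆ R, IsBase adj B → B ⊆ T := fun B hB h x hx =>
    Finset.mem_filter.2 ⟨hB hx, B, hB, h, hx⟩
  have hTR : T ⊆ R := Finset.filter_subset _ _
  let r : T → EuclideanSpace ℂ (Fin 4) := fun x => point x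
  have ho : ∀ x y : T, orth r x y ↔ adj x y := fun x y => by
    rw [orth, inner_point]
  have base : ∀ B ⊆ R, IsBase adj B → IsBase (orth r) (B.subtype (· ∈ T)) := fun B hB h => by
    refine ⟨?_, fun x hx y hy q => ?_⟩
    · rw [Finset.card_subtype, Finset.filter_true_of_mem (hT B hB h), h.1]
    · exact (ho x y).2 (h.2 x (Finset.mem_subtype.1 hx) y (Finset.mem_subtype.1 hy)
        fun e => q (Subtype.ext e))
  have hr : Rays r := ⟨finrank_euclideanSpace_fin, fun x => norm_point (hunit x (hTR x.2)),
    fun x y q => norm_inner_point_lt (hunit x (hTR x.2)) (hunit y (hTR y.2)) fun e =>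
      q (Subtype.ext (hp x (hTR x.2) y (hTR y.2) e))⟩
  have := hr.not_unsat (fun x => by
    obtain ⟨B, hB, h, hx⟩ := (Finset.mem_filter.1 x.2).2
    exact ⟨_, base B hB h, Finset.mem_subtype.2 hx⟩)
    (by rw [Fintype.card_coe]; exact (Finset.card_le_card hTR).trans hc)
  rw [Unsat] at this
  push Not at this
  obtain ⟨I, hI, hB⟩ := this
  refine ⟨I.map (Function.Embedding.subtype _), fun x hx => ?_, ?_, fun B hBR h => ?_⟩
  · obtain ⟨y, -, rfl⟩ := Finset.mem_map.1 hx
    exact hTR y.2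
  · intro x hx y hy
    obtain ⟨x, mx, rfl⟩ := Finset.mem_map.1 hx
    obtain ⟨y, my, rfl⟩ := Finset.mem_map.1 hy
    exact fun q => hI x mx y my ((ho x y).2 q)
  · obtain ⟨x, hx, hxI⟩ := Finset.not_disjoint_iff.1 (hB _ (base B hBR h))
    exact ⟨x, Finset.mem_subtype.1 hx, Finset.mem_map.2 ⟨x, hxI, rfl⟩⟩

theorem exists_assignment {S : Finset (Fin 4 → ℂ)} (hunit : ∀ x ∈ S, star x ⬝ᵥ x = (1 : ℂ))
    (hc : S.card ≤ 17) : ∃ f : (Fin 4 → ℂ) → ℕ, IsKSAssignment4 S f := by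
  classical
  obtain ⟨R, hR, hp, hS⟩ := exists_representatives S
  obtain ⟨I, hI, hs, hB⟩ := exists_stable (fun x hx => hunit x (hR hx)) hp
    ((Finset.card_le_card hR).trans hc)
  let f : (Fin 4 → ℂ) → ℕ := fun u => if ∃ x ∈ I, Par u x then 1 else 0
  have hf : ∀ {u}, f u = 1 ↔ ∃ x ∈ I, Par u x := by simp [f]
  refine ⟨f, fun u _ => ?_, ?_, fun b hb ho => ?_⟩
  · by_cases h : ∃ x ∈ I, Par u x <;> simp [f, h]
  · rintro u - w - q ⟨hu, hw⟩
    obtain ⟨x, hx, ux⟩ := hf.1 hu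
    obtain ⟨y, hy, wy⟩ := hf.1 hw
    exact hs x hx y hy ((ux.dot_eq_zero_iff wy).1 q)
  · choose g hg hbg using fun k => hS (b k) (hb k)
    have go : ∀ k l, k ≠ l → star (g k) ⬝ᵥ g l = 0 := fun k l h =>
      ((hbg k).dot_eq_zero_iff (hbg l)).1 (ho k l h)
    have gi : Function.Injective g := fun k l e => by
      by_contra h
      have := go k l h
      rw [e, hunit _ (hR (hg l))] at this
      exact one_ne_zero this
    obtain ⟨x, hx, hxI⟩ := hB (Finset.univ.image g)
      (fun x hx => by obtain ⟨k, -, rfl⟩ := Finset.mem_image.1 hx; exact hg k) ⟨by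
        rw [Finset.card_image_of_injective _ gi, Finset.card_univ, Fintype.card_fin], by
        intro x hx y hy q
        obtain ⟨k, -, rfl⟩ := Finset.mem_image.1 hx
        obtain ⟨l, -, rfl⟩ := Finset.mem_image.1 hy
        exact go k l fun e => q (e ▸ rfl)⟩
    obtain ⟨k, -, rfl⟩ := Finset.mem_image.1 hx
    exact ⟨k, hf.2 ⟨_, hxI, hbg k⟩⟩

end Reduction

end KSCheck

/-- Every KS set in dimension 4 has at least 18 elements: if a finite set `S`
of unit vectors in `ℂ^4` admits no KS assignment, then `S` has cardinality at least 18. -/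
theorem statement18
    (S : Finset (Fin 4 → ℂ))
    (hunit : ∀ x ∈ S, star x ⬝ᵥ x = (1 : ℂ))
    (hKS : ¬ ∃ f : (Fin 4 → ℂ) → ℕ, IsKSAssignment4 S f) :
    18 ≤ S.card := by
  by_contra! h
  exact hKS (KSCheck.exists_assignment hunit (Nat.le_of_lt_succ h))
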